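/- arXiv:1706.08447 — 2 statements merged into one kernel-verified Lean document; each statement's English description precedes it below -/
import Mathlib

section
/- Let F_q be a finite field of characteristic p and let f ∈ F_q[X] with nonzero formal derivative (i.e. f ∉ F_q[X^p]) and deg(f) ≥ 8. If f is d̄-universal for some positive integer d̄, then there exists a positive integer d₀ such that f is d-universal for every integer d > d₀. -/
open Polynomial

/-- `f ∈ F_q[X]` is `d`-universal if for every positive `ℓ ≤ deg f` there is
`t₀ ∈ F_{q^d}` such that `f - t₀` has an irreducible factor of degree `ℓ` over `F_{q^d}`. -/
def IsDUniversal {F : Type} [Field F] [Fintype F] (f : Polynomial F) (d : ℕ) : Prop :=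
  ∀ (K : Type) [Field K] [Fintype K] [Algebra F K],
    Fintype.card K = Fintype.card F ^ d →
    ∀ ℓ : ℕ, 0 < ℓ → ℓ ≤ f.natDegree →
      ∃ t₀ : K, ∃ g : Polynomial K,
        Irreducible g ∧ g.natDegree = ℓ ∧ g ∣ (f.map (algebraMap F K) - C t₀)

section BertrandTwo
open Real

theorem two_real_main_inequality {x : ℝ} (x_large : (512 : ℝ) ≤ x) :
    x * (2 * x) ^ (√(2 * x) + 1) * 4 ^ (2 * x / 3) ≤ 4 ^ x := by
  let f : ℝ → ℝ := fun x => log x + log x + log 2 + √(2 * x) * log (2 * x) - log 4 / 3 * x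
  have hf' : ∀ x, 0 < x → 0 < x * (2 * x) ^ (√(2 * x) + 1) / 4 ^ (x / 3) := fun x h =>
    div_pos (mul_pos h (rpow_pos_of_pos (mul_pos two_pos h) _)) (rpow_pos_of_pos four_pos _)
  have hf : ∀ x, 0 < x → f x = log (x * (2 * x) ^ (√(2 * x) + 1) / 4 ^ (x / 3)) := by
    intro x h5
    have h6 := mul_pos (zero_lt_two' ℝ) h5
    have h7 := rpow_pos_of_pos h6 (√(2 * x) + 1)
    rw [log_div (mul_pos h5 h7).ne' (rpow_pos_of_pos four_pos _).ne', log_mul h5.ne' h7.ne',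
      log_rpow h6, log_rpow zero_lt_four]
    have : log (2 * x) = log 2 + log x := log_mul (by norm_num) h5.ne'
    simp only [f]
    linear_combination -this
  have h5 : 0 < x := lt_of_lt_of_le (by norm_num1) x_large
  rw [← div_le_one (rpow_pos_of_pos four_pos x), ← div_div_eq_mul_div, ← rpow_sub four_pos, ←
    mul_div 2 x, mul_div_left_comm, ← mul_one_sub, (by norm_num1 : (1 : ℝ) - 2 / 3 = 1 / 3),
    mul_one_div, ← log_nonpos_iff (hf' x h5).le, ← hf x h5]
  have hlog : ConcaveOn ℝ (Set.Ioi 0.5) log := strictConcaveOn_log_Ioi.concaveOn.subset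
          (Set.Ioi_subset_Ioi (by norm_num)) (convex_Ioi 0.5)
  have h : ConcaveOn ℝ (Set.Ioi 0.5) f := by
    apply ConcaveOn.sub
    · apply ConcaveOn.add
      · exact (hlog.add hlog).add_const _
      convert!
        ((strictConcaveOn_sqrt_mul_log_Ioi.concaveOn.comp_linearMap ((2 : ℝ) • LinearMap.id)))
        using 1
      ext x
      simp only [Set.mem_Ioi, Set.mem_preimage, LinearMap.smul_apply,
        LinearMap.id_coe, id_eq, smul_eq_mul]
      rw [← mul_lt_mul_iff_right₀ (two_pos)]
      norm_num1
      rfl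
    apply ConvexOn.smul
    · refine div_nonneg (log_nonneg (by norm_num1)) (by norm_num1)
    · exact convexOn_id (convex_Ioi (0.5 : ℝ))
  suffices ∃ x1 x2, 0.5 < x1 ∧ x1 < x2 ∧ x2 ≤ x ∧ 0 ≤ f x1 ∧ f x2 ≤ 0 by
    obtain ⟨x1, x2, h1, h2, h0, h3, h4⟩ := this
    exact (h.right_le_of_le_left'' h1 ((h1.trans h2).trans_le h0) h2 h0 (h4.trans h3)).trans h4
  refine ⟨18, 512, by norm_num1, by norm_num1, x_large, ?_, ?_⟩
  · have : √(2 * 18 : ℝ) = 6 := (sqrt_eq_iff_mul_self_eq_of_pos (by norm_num1)).mpr (by norm_num1)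
    rw [hf _ (by norm_num1), log_nonneg_iff (by positivity), this, one_le_div (by norm_num1)]
    norm_num1
  · have : √(2 * 512) = 32 :=
      (sqrt_eq_iff_mul_self_eq_of_pos (by norm_num1)).mpr (by norm_num1)
    rw [hf _ (by norm_num1), log_nonpos_iff (hf' _ (by norm_num1)).le, this,
        div_le_one (by positivity)]
    have e1 : (2 * 512 : ℝ) ^ ((32 : ℝ) + 1) = (2 * 512 : ℝ) ^ (33 : ℕ) := by
      rw [← rpow_natCast]; norm_num
    rw [e1]
    have e2 : (4 : ℝ) ^ ((512 : ℝ) / 3) = 2 ^ ((1024 : ℝ) / 3) := by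
      rw [show (4 : ℝ) = 2 ^ (2 : ℝ) by norm_num, ← rpow_mul (by norm_num)]; norm_num
    rw [e2, show (512 : ℝ) * (2 * 512) ^ 33 = 2 ^ (339 : ℝ) by
      rw [show (339 : ℝ) = ((339 : ℕ) : ℝ) by norm_num, rpow_natCast,
        show (2 * 512 : ℝ) = 2 ^ 10 by norm_num, show (512 : ℝ) = 2 ^ 9 by norm_num,
        ← pow_mul, ← pow_add]]
    apply rpow_le_rpow_of_exponent_le <;> norm_num

open Nat in
theorem two_bertrand_main_inequality {n : ℕ} (n_large : 512 ≤ n) :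
    n * (2 * n) ^ (Nat.sqrt (2 * n) + 1) * 4 ^ (2 * n / 3) ≤ 4 ^ n := by
  rw [← @Nat.cast_le ℝ]
  simp only [Nat.cast_mul, Nat.cast_pow, ← Real.rpow_natCast, Nat.cast_ofNat, Nat.cast_add, Nat.cast_one]
  refine _root_.trans ?_ (two_real_main_inequality (by exact_mod_cast n_large))
  gcongr
  · have n2_pos : 0 < 2 * n := by positivity
    exact mod_cast n2_pos
  · exact_mod_cast Real.nat_sqrt_le_real_sqrt
  · norm_num1
  · exact Nat.cast_div_le.trans (by norm_cast)

theorem two_centralBinom_le (n : ℕ) (n_large : 2 < n)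
    (no_prime : ∀ p : ℕ, p.Prime → n < p → p ≤ 2 * n → p = 2 * n - 1) :
    Nat.centralBinom n ≤ (2 * n) ^ (Nat.sqrt (2 * n) + 1) * 4 ^ (2 * n / 3) := by
  have n_pos : 0 < n := (Nat.zero_le _).trans_lt n_large
  have n2_pos : 1 ≤ 2 * n := mul_pos (zero_lt_two' ℕ) n_pos
  let f x := x ^ n.centralBinom.factorization x
  have hfle : ∀ p, f p ≤ 2 * n := fun p => Nat.pow_factorization_choose_le (mul_pos two_pos n_pos)
  let S := {p ∈ Finset.range (2 * n / 3 + 1) | Nat.Prime p}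
  have hS : ∏ x ∈ S, f x = ∏ x ∈ Finset.range (2 * n / 3 + 1), f x := by
    refine Finset.prod_filter_of_ne fun p _ h => ?_
    contrapose h; dsimp only [f]
    rw [Nat.factorization_eq_zero_of_not_prime n.centralBinom h, _root_.pow_zero]
  have h0 : Nat.centralBinom n = ∏ p ∈ insert (2 * n - 1) (Finset.range (2 * n / 3 + 1)), f p := by
    refine (Eq.trans ?_ n.prod_pow_factorization_centralBinom).symm
    apply Finset.prod_subset
    · intro x hx
      simp only [Finset.mem_insert, Finset.mem_range] at hx ⊢
      omega
    intro x hx h2x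
    simp only [Finset.mem_insert, Finset.mem_range] at hx h2x
    by_cases h : x.Prime
    · rcases le_or_gt x n with h' | h'
      · simp only [f]
        rw [Nat.factorization_centralBinom_of_two_mul_self_lt_three_mul n_large h' (by omega), Nat.pow_zero]
      · have := no_prime x h h' (by omega)
        omega
    · simp only [f]
      rw [Nat.factorization_eq_zero_of_not_prime n.centralBinom h, Nat.pow_zero]
  rw [h0, Finset.prod_insert (by simp; omega), ← hS, pow_succ', mul_assoc]
  apply mul_le_mul' (hfle _)
  rw [← Finset.prod_filter_mul_prod_filter_not S (· ≤ Nat.sqrt (2 * n))]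
  apply mul_le_mul'
  · refine (Finset.prod_le_prod' fun p _ => (hfle p)).trans ?_
    have : (Finset.Icc 1 (Nat.sqrt (2 * n))).card = Nat.sqrt (2 * n) := by rw [Nat.card_Icc, Nat.add_sub_cancel]
    rw [Finset.prod_const]
    refine pow_right_mono₀ n2_pos ((Finset.card_le_card fun x hx => ?_).trans this.le)
    obtain ⟨h1, h2⟩ := Finset.mem_filter.1 hx
    exact Finset.mem_Icc.mpr ⟨(Finset.mem_filter.1 h1).2.one_lt.le, h2⟩
  · refine le_trans ?_ (primorial_le_four_pow (2 * n / 3))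
    refine (Finset.prod_le_prod' fun p hp => (?_ : f p ≤ p)).trans ?_
    · obtain ⟨h1, h2⟩ := Finset.mem_filter.1 hp
      refine (pow_right_mono₀ (Finset.mem_filter.1 h1).2.one_lt.le ?_).trans (pow_one p).le
      exact Nat.factorization_choose_le_one (Nat.sqrt_lt'.mp <| not_le.1 h2)
    refine Finset.prod_le_prod_of_subset_of_one_le' (Finset.filter_subset _ _) ?_
    exact fun p hp _ => (Finset.mem_filter.1 hp).2.one_lt.le

theorem exists_prime_le_two_mul_sub_three (x : ℕ) (hx : 4 ≤ x) :
    ∃ p : ℕ, p.Prime ∧ x < p ∧ p + 3 ≤ 2 * x := by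
  rcases lt_or_ge x 512 with h | h
  · by_contra! hcon
    have h5 := hcon 5 (by norm_num)
    have h7 := hcon 7 (by norm_num)
    have h11 := hcon 11 (by norm_num)
    have h19 := hcon 19 (by norm_num)
    have h31 := hcon 31 (by norm_num)
    have h53 := hcon 53 (by norm_num)
    have h101 := hcon 101 (by norm_num)
    have h197 := hcon 197 (by norm_num)
    have h389 := hcon 389 (by norm_num)
    have h523 := hcon 523 (by norm_num)
    omega
  · have key : 4 ^ x < x * x.centralBinom :=
      Nat.four_pow_lt_mul_centralBinom x (le_trans (by norm_num1) h)
    contrapose! key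
    have : x.centralBinom ≤ (2 * x) ^ (Nat.sqrt (2 * x) + 1) * 4 ^ (2 * x / 3) := by
      apply two_centralBinom_le x (by omega)
      intro p hp h1 h2
      have := key p hp h1
      have hodd := hp.eq_two_or_odd
      omega
    calc x * x.centralBinom ≤ x * ((2 * x) ^ (Nat.sqrt (2 * x) + 1) * 4 ^ (2 * x / 3)) := by gcongr
      _ ≤ _ := by rw [← mul_assoc]; exact two_bertrand_main_inequality h

theorem exists_prime_for_jordan (n : ℕ) (hn : 8 ≤ n) :
    ∃ p : ℕ, p.Prime ∧ n < 2 * p ∧ p + 3 ≤ n := by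
  obtain ⟨p, hp, h1, h2⟩ := exists_prime_le_two_mul_sub_three (n / 2) (by omega)
  exact ⟨p, hp, by omega, by omega⟩

end BertrandTwo

section GroupPart
open MulAction Equiv Equiv.Perm

/-- The realisation of a permutation of the fixed points of a prime cycle. -/
theorem jordan_realise {α : Type*} [Fintype α] [DecidableEq α] {G : Subgroup (Perm α)}
    (hG : IsPreprimitive G α) {c : Perm α} (hc : c.IsCycle) (hcG : c ∈ G)
    (hp : c.support.card.Prime) (hcard : c.support.card + 3 ≤ Fintype.card α)
    (π : Perm α) (hπ : ∀ x ∈ c.support, π x = x) :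
    ∃ g ∈ G, (∀ x, x ∉ c.support → g x = π x) ∧ ∃ i : ℤ, g * c * g⁻¹ = c ^ i := by
  classical
  set s : Set α := (c.support : Set α)ᶜ with hs
  have hsn : s.ncard = Fintype.card α - c.support.card := by
    rw [hs, Set.ncard_compl, Set.ncard_coe_finset, Nat.card_eq_fintype_card]
  obtain ⟨m, hm⟩ : ∃ m, s.ncard = m + 1 := ⟨s.ncard - 1, by omega⟩
  have htr : IsPretransitive (fixingSubgroup G s) (SubMulAction.ofFixingSubgroup G s) :=
    isPretransitive_of_isCycle_mem hc hcG
  have hprim : IsPreprimitive (fixingSubgroup G s) (SubMulAction.ofFixingSubgroup G s) := by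
    apply IsPreprimitive.of_prime_card
    have : Nat.card (SubMulAction.ofFixingSubgroup G s) = c.support.card := by
      have h1 : (SubMulAction.ofFixingSubgroup G s : Set α) = (c.support : Set α) := by
        ext x; simp [SubMulAction.mem_ofFixingSubgroup_iff, hs]
      have : Nat.card ((SubMulAction.ofFixingSubgroup G s : Set α)) = c.support.card := by
        rw [h1, Nat.card_coe_set_eq, Set.ncard_coe_finset]
      exact this
    rw [this]; exact hp
  have hp2 := hp.two_le
  have hmp := hG.isMultiplyPreprimitive hm (by rw [Nat.card_eq_fintype_card]; omega) hprim
  have hmt : IsMultiplyPretransitive G α (m + 2) := hmp.isMultiplyPretransitive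
  have hmt1 : IsMultiplyPretransitive G α (m + 1) :=
    isMultiplyPretransitive_of_le (n := m + 2) (by omega) (by rw [Nat.card_eq_fintype_card]; omega)
  have hcs : Nat.card s = m + 1 := by rw [← hm]; rfl
  let e : Fin (m + 1) ≃ s := (Finite.equivFinOfCardEq hcs).symm
  let x : Fin (m + 1) ↪ α := ⟨fun i => (e i : α), fun i j h => e.injective (Subtype.ext h)⟩
  let y : Fin (m + 1) ↪ α := ⟨fun i => π (e i : α), fun i j h =>
    e.injective (Subtype.ext (π.injective h))⟩
  obtain ⟨g, hg⟩ := hmt1.exists_smul_eq x y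
  have hgs : ∀ a ∈ s, (g : Perm α) a = π a := by
    intro a ha
    have := DFunLike.congr_fun hg (e.symm ⟨a, ha⟩)
    have h0 : (g : Perm α) (e (e.symm ⟨a, ha⟩) : α) = π (e (e.symm ⟨a, ha⟩) : α) := this
    simpa using h0
  have hπs : ∀ a, a ∈ s → π a ∈ s := by
    intro a ha hb
    have h1 : π (π a) = π a := hπ _ (by simpa using hb)
    have h2 := π.injective h1
    rw [h2] at hb
    exact ha hb
  have hgsupp : ∀ a, a ∈ s → (g : Perm α) a ∈ s := fun a ha => by rw [hgs a ha]; exact hπs a ha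
  have hginv : ∀ a, a ∈ s → (g : Perm α)⁻¹ a ∈ s := by
    have hsurj := Finite.injective_iff_surjective.mp
      (show Function.Injective (fun a : s => (⟨(g : Perm α) a, hgsupp a a.2⟩ : s)) from
        fun a b h => Subtype.ext ((g : Perm α).injective (by simpa using h)))
    intro a ha
    obtain ⟨b, hb⟩ := hsurj ⟨a, ha⟩
    have : (g : Perm α) b = a := congrArg Subtype.val hb
    rw [← this]; simp
  -- Sylow
  let F0 : Subgroup (Perm α) := G ⊓ fixingSubgroup (Perm α) s
  have hfix : ∀ h : Perm α, h ∈ fixingSubgroup (Perm α) s ↔ ∀ a ∈ s, h a = a := by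
    intro h; simp [mem_fixingSubgroup_iff]
  have hcs' : ∀ a ∈ s, c a = a := by
    intro a ha
    by_contra hne
    exact ha (by simpa using hne)
  have hcF : c ∈ F0 := ⟨hcG, (hfix c).2 hcs'⟩
  have hcF' : (g : Perm α) * c * (g : Perm α)⁻¹ ∈ F0 := by
    refine ⟨G.mul_mem (G.mul_mem g.2 hcG) (G.inv_mem g.2), (hfix _).2 fun a ha => ?_⟩
    show (g : Perm α) (c ((g : Perm α)⁻¹ a)) = a
    rw [hcs' _ (hginv a ha)]; exact Equiv.apply_symm_apply (g : Perm α) a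
  set ℓ := c.support.card with hℓ
  have : Fact ℓ.Prime := ⟨hp⟩
  have hcardfix : Nat.card (fixingSubgroup (Perm α) s) = ℓ.factorial := by
    have h1 := (Equiv.Perm.isMultiplyPretransitive α (m + 1)).index_of_fixingSubgroup_mul hm
    have h2 := (fixingSubgroup (Perm α) s).index_mul_card
    rw [Nat.card_perm, ← h1] at h2
    have h3 := Nat.eq_of_mul_eq_mul_left (Nat.pos_of_ne_zero (Subgroup.index_ne_zero_of_finite)) h2
    rw [h3, Nat.card_eq_fintype_card]
    congr 1; omega
  have hdvd : Nat.card F0 ∣ ℓ.factorial := by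
    rw [← hcardfix]; exact Subgroup.card_dvd_of_le inf_le_right
  have hfac : (Nat.card F0).factorization ℓ ≤ 1 := by
    have h1 := (Nat.factorization_le_iff_dvd Nat.card_pos.ne' (Nat.factorial_ne_zero _)).2 hdvd ℓ
    refine h1.trans ?_
    obtain ⟨r, hr⟩ : ∃ r, ℓ = r + 1 := ⟨ℓ - 1, by omega⟩
    have h2 : ℓ.factorial = ℓ * (ℓ - 1).factorial := by
      rw [Nat.mul_factorial_pred (by omega)]
    rw [h2, Nat.factorization_mul (by omega) (Nat.factorial_ne_zero _), Finsupp.add_apply,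
      hp.factorization_self, Nat.factorization_eq_zero_of_not_dvd]
    rw [hp.dvd_factorial]; omega
  have hord : ∀ z : F0, orderOf (z : Perm α) = ℓ →
      Nat.card (Subgroup.zpowers z) = ℓ ^ (Nat.card F0).factorization ℓ := by
    intro z hz
    have h1 : Nat.card (Subgroup.zpowers z) = ℓ := by
      rw [Nat.card_zpowers, ← hz, Subgroup.orderOf_coe]
    have h2 : ℓ ∣ Nat.card F0 := by rw [← h1]; exact Subgroup.card_subgroup_dvd_card _
    have h3 := (hp.dvd_iff_one_le_factorization Nat.card_pos.ne').1 h2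
    rw [h1, le_antisymm hfac h3, pow_one]
  have hoc : orderOf c = ℓ := hc.orderOf
  have hoc' : orderOf ((g : Perm α) * c * (g : Perm α)⁻¹) = ℓ := by
    rw [← hoc]
    exact orderOf_injective (MulAut.conj (g : Perm α)).toMonoidHom (MulAut.conj _).injective c
  let z1 : F0 := ⟨c, hcF⟩
  let z2 : F0 := ⟨_, hcF'⟩
  let S1 : Sylow ℓ F0 := Sylow.ofCard _ (hord z1 hoc)
  let S2 : Sylow ℓ F0 := Sylow.ofCard _ (hord z2 hoc')
  obtain ⟨h, hh⟩ := MulAction.exists_smul_eq F0 S2 S1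
  have hmem : h * z2 * h⁻¹ ∈ Subgroup.zpowers z1 := by
    have h1 : z2 ∈ (S2 : Subgroup F0) := Subgroup.mem_zpowers z2
    have h2 : (MulAut.conj h) • z2 ∈ ((h • S2 : Sylow ℓ F0) : Subgroup F0) := by
      exact Subgroup.smul_mem_pointwise_smul _ _ _ h1
    rw [hh] at h2
    exact h2
  obtain ⟨i, hi⟩ := Subgroup.mem_zpowers_iff.1 hmem
  refine ⟨h * g, G.mul_mem h.2.1 g.2, ?_, i, ?_⟩
  · intro a ha
    have ha' : a ∈ s := by simpa [hs] using ha
    rw [Perm.mul_apply, hgs a ha']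
    exact (hfix _).1 h.2.2 _ (hπs a ha')
  · have := congrArg Subtype.val hi
    simp only [Subgroup.coe_mul, Subgroup.coe_inv, SubgroupClass.coe_zpow, z1, z2] at this
    rw [this]; group

theorem jordan_prime_cycle {α : Type*} [Fintype α] [DecidableEq α] {G : Subgroup (Perm α)}
    (hG : IsPreprimitive G α) {c : Perm α} (hc : c.IsCycle) (hcG : c ∈ G)
    (hp : c.support.card.Prime) (hcard : c.support.card + 3 ≤ Fintype.card α) :
    alternatingGroup α ≤ G := by
  classical
  have hcomp : 2 < (c.supportᶜ).card := by rw [Finset.card_compl]; omega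
  obtain ⟨x, hx, y, hy, z, hz, hxy, hxz, hyz⟩ := Finset.two_lt_card.1 hcomp
  simp only [Finset.mem_compl] at hx hy hz
  have hsw : ∀ a b, a ∉ c.support → b ∉ c.support → ∀ w ∈ c.support, swap a b w = w := by
    intro a b ha hb w hw
    exact swap_apply_of_ne_of_ne (by rintro rfl; exact ha hw) (by rintro rfl; exact hb hw)
  obtain ⟨u, huG, hu, i, hi⟩ := jordan_realise hG hc hcG hp hcard (swap x y) (hsw x y hx hy)
  obtain ⟨v, hvG, hv, j, hj⟩ := jordan_realise hG hc hcG hp hcard (swap x z) (hsw x z hx hz)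
  have hconj : ∀ (w : Perm α) (k r : ℤ), w * c * w⁻¹ = c ^ k → w * c ^ r * w⁻¹ = c ^ (k * r) := by
    intro w k r h
    rw [← conj_zpow, h, zpow_mul]
  set w := (v * u)⁻¹ * (u * v) with hw
  have hwc : w * c = c * w := by
    have h1 : (u * v) * c * (u * v)⁻¹ = c ^ (i * j) := by
      rw [← hconj u i j hi, ← hj]; group
    have h2 : (v * u) * c * (v * u)⁻¹ = c ^ (i * j) := by
      rw [mul_comm i j, ← hconj v j i hj, ← hi]; group
    have h3 := h1.trans h2.symm
    rw [mul_inv_eq_iff_eq_mul] at h3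
    rw [hw, mul_assoc, h3]; group
  have hpres : ∀ (g π : Perm α), (∀ a, a ∉ c.support → g a = π a) → (∀ a ∈ c.support, π a = a) →
      ∀ a, a ∉ c.support → g a ∉ c.support := by
    intro g π hg hπ a ha hb
    rw [hg a ha] at hb
    have := π.injective (hπ _ hb)
    rw [this] at hb; exact ha hb
  set W0 := (swap x z * swap x y)⁻¹ * (swap x y * swap x z) with hW0
  have hvu : ∀ a, a ∉ c.support → (v * u) a = (swap x z * swap x y) a := by
    intro a ha
    rw [Perm.mul_apply, Perm.mul_apply, hv _ (hpres u _ hu (hsw x y hx hy) a ha), hu a ha]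
  have huv : ∀ a, a ∉ c.support → (u * v) a = (swap x y * swap x z) a := by
    intro a ha
    rw [Perm.mul_apply, Perm.mul_apply, hu _ (hpres v _ hv (hsw x z hx hz) a ha), hv a ha]
  have hW0fix : ∀ a ∈ c.support, W0 a = a := by
    intro a ha
    simp [hW0, hsw x y hx hy a ha, hsw x z hx hz a ha]
  have hww : ∀ a, a ∉ c.support → w a = W0 a := by
    intro a ha
    have hb : W0 a ∉ c.support := by
      intro hb
      have := W0.injective (hW0fix _ hb)
      rw [this] at hb; exact ha hb
    have h1 := hvu _ hb
    have h2 := huv a ha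
    have h3 : (swap x z * swap x y) (W0 a) = (swap x y * swap x z) a := by
      rw [hW0, ← Perm.mul_apply, mul_inv_cancel_left]
    rw [h3, ← h2] at h1
    rw [hw, Perm.mul_apply, Perm.inv_eq_iff_eq, h1]
  obtain ⟨x0, hx0, hx0c⟩ := hc
  have hx0' : x0 ∈ c.support := by simpa using hx0
  have hcomm : ∀ k : ℤ, w * c ^ k = c ^ k * w := fun k =>
    (Commute.zpow_right (show Commute w c from hwc) k)
  have hwx0 : w x0 ∈ c.support := by
    rw [mem_support, ← Perm.mul_apply, ← hwc, Perm.mul_apply]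
    intro h; exact hx0 (w.injective h)
  obtain ⟨k, hk⟩ := hx0c (by simpa using hwx0)
  have hfin : w * c ^ (-k) = W0 := by
    ext a
    by_cases ha : a ∈ c.support
    · obtain ⟨r, hr⟩ := hx0c (y := a) (by simpa using ha)
      rw [hW0fix a ha, ← hr]
      have : w * c ^ (-k) * c ^ r = c ^ (-k) * c ^ r * w := by
        rw [mul_assoc, ← zpow_add, hcomm]
      rw [← Perm.mul_apply, this, Perm.mul_apply, ← hk, ← Perm.mul_apply, ← zpow_add, ← zpow_add]
      congr 2; ring
    · have h1 : (c ^ (-k)) a = a := zpow_apply_eq_self_of_apply_eq_self (by simpa using ha) _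
      rw [Perm.mul_apply, h1, hww a ha]
  have h3 : W0.IsThreeCycle := by
    have : W0 = (swap x y * swap x z) * (swap x y * swap x z) := by
      rw [hW0, mul_inv_rev, swap_inv, swap_inv]
    rw [this]
    exact (isThreeCycle_swap_mul_swap_same hxy hxz hyz).isThreeCycle_sq
  apply alternatingGroup_le_of_isPreprimitive_of_isThreeCycle_mem hG h3
  rw [← hfin, hw]
  exact G.mul_mem (G.mul_mem (G.inv_mem (G.mul_mem hvG huG)) (G.mul_mem huG hvG)) (G.zpow_mem hcG _)

theorem card_support_cycleOf_eq_minimalPeriod {α : Type*} [Fintype α] [DecidableEq α]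
    (g : Perm α) (i : α) (h : 2 ≤ Function.minimalPeriod g i) :
    (g.cycleOf i).IsCycle ∧ (g.cycleOf i).support.card = Function.minimalPeriod g i := by
  have hne : g i ≠ i := by
    intro h1
    have : Function.minimalPeriod g i = 1 := Function.minimalPeriod_eq_one_iff_isFixedPt.2 h1
    omega
  have hc := isCycle_cycleOf g hne
  refine ⟨hc, ?_⟩
  rw [← hc.orderOf]
  apply Nat.dvd_antisymm
  · rw [orderOf_dvd_iff_pow_eq_one]
    rw [hc.pow_eq_one_iff]
    refine ⟨i, by simpa using hne, ?_⟩
    rw [cycleOf_pow_apply_self, ← iterate_eq_pow]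
    exact Function.isPeriodicPt_minimalPeriod _ _
  · apply Function.IsPeriodicPt.minimalPeriod_dvd
    rw [Function.IsPeriodicPt, Function.IsFixedPt, iterate_eq_pow, ← cycleOf_pow_apply_self,
      pow_orderOf_eq_one]
    rfl

theorem minimalPeriod_add_le {α : Type*} [Fintype α] [DecidableEq α]
    (g : Perm α) (i x : α) (h : 2 ≤ Function.minimalPeriod g i) (hx : ¬ g.SameCycle i x) :
    Function.minimalPeriod g x + Function.minimalPeriod g i ≤ Fintype.card α := by
  have h1 := (card_support_cycleOf_eq_minimalPeriod g i h).2
  have hxs : x ∉ (g.cycleOf i).support := by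
    rw [mem_support_cycleOf_iff]; tauto
  by_cases h2 : 2 ≤ Function.minimalPeriod g x
  · have h3 := (card_support_cycleOf_eq_minimalPeriod g x h2).2
    have hd : Disjoint (g.cycleOf x).support (g.cycleOf i).support := by
      rw [Finset.disjoint_left]
      intro a ha hb
      rw [mem_support_cycleOf_iff] at ha hb
      exact hx (hb.1.trans ha.1.symm)
    rw [← h1, ← h3, ← Finset.card_union_of_disjoint hd]
    exact Finset.card_le_univ _
  · have : (insert x (g.cycleOf i).support).card ≤ Fintype.card α := Finset.card_le_univ _
    rw [Finset.card_insert_of_notMem hxs] at this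
    omega

theorem big_cycle {α : Type*} [Fintype α] [DecidableEq α]
    (g : Perm α) (i : α) (h : 2 ≤ Function.minimalPeriod g i)
    (h2 : Fintype.card α ≤ Function.minimalPeriod g i + 1) :
    g.IsCycle ∧ g.support.card = Function.minimalPeriod g i := by
  have : g.cycleOf i = g := by
    ext x
    rw [cycleOf_apply]
    split_ifs with hx
    · rfl
    · have h3 := minimalPeriod_add_le g i x h hx
      have h4 : Function.minimalPeriod g x = 1 := by
        have : 0 < Function.minimalPeriod g x := by
          apply Function.minimalPeriod_pos_of_mem_periodicPts
          exact g.injective.mem_periodicPts x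
        omega
      exact (Function.minimalPeriod_eq_one_iff_isFixedPt.1 h4).symm
  have h5 := card_support_cycleOf_eq_minimalPeriod g i h
  rwa [this] at h5

/-- The group-theoretic heart. -/
theorem group_core (n : ℕ) (hn : 8 ≤ n) (H : Subgroup (Perm (Fin n))) (r : Perm (Fin n))
    (hr : r ∈ Subgroup.normalizer (H : Set (Perm (Fin n))))
    (hcyc : ∀ ℓ, n < 2 * ℓ → ℓ ≤ n → ∃ g : Perm (Fin n), r⁻¹ * g ∈ H ∧
      ∃ i, Function.minimalPeriod g i = ℓ)
    (hprime : ∃ p : ℕ, p.Prime ∧ n < 2 * p ∧ p + 3 ≤ n) : H = ⊤ := by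
  classical
  set G := Subgroup.normalizer (H : Set (Perm (Fin n))) with hGdef
  have hmemG : ∀ g, r⁻¹ * g ∈ H → g ∈ G := by
    intro g hg
    have := G.mul_mem hr (Subgroup.le_normalizer hg)
    rwa [mul_inv_cancel_left] at this
  obtain ⟨a, haH, i, hi⟩ := hcyc n (by omega) le_rfl
  obtain ⟨b, hbH, j, hj⟩ := hcyc (n - 1) (by omega) (by omega)
  have hcα : Fintype.card (Fin n) = n := Fintype.card_fin n
  obtain ⟨hac, hacard⟩ := big_cycle a i (by omega) (by omega)
  obtain ⟨hbc, hbcard⟩ := big_cycle b j (by omega) (by omega)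
  have haG := hmemG a haH
  have hbG := hmemG b hbH
  have hasupp : a.support = Finset.univ := by
    rw [← Finset.card_eq_iff_eq_univ]; omega
  have htrans : ∀ x y, ∃ g ∈ G, g x = y := by
    intro x y
    have := hac.sameCycle (x := x) (y := y) (by rw [← mem_support, hasupp]; simp)
      (by rw [← mem_support, hasupp]; simp)
    obtain ⟨k, hk⟩ := this
    exact ⟨a ^ k, G.zpow_mem haG k, hk⟩
  obtain ⟨o, ho⟩ : ∃ o, b.supportᶜ = {o} := by
    rw [← Finset.card_eq_one, Finset.card_compl]; omega
  have ho' : ∀ x, x ∉ b.support ↔ x = o := by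
    intro x; rw [← Finset.mem_compl, ho, Finset.mem_singleton]
  have h2t : IsMultiplyPretransitive G (Fin n) 2 := by
    rw [is_two_pretransitive_iff]
    intro x y z w hxy hzw
    obtain ⟨g1, hg1, h1⟩ := htrans x o
    obtain ⟨g2, hg2, h2⟩ := htrans z o
    have hy : g1 y ∈ b.support := by
      by_contra h
      rw [ho', ← h1] at h
      exact hxy (g1.injective h).symm
    have hw : g2 w ∈ b.support := by
      by_contra h
      rw [ho', ← h2] at h
      exact hzw (g2.injective h).symm
    obtain ⟨k, hk⟩ := hbc.sameCycle (mem_support.1 hy) (mem_support.1 hw)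
    have hbo : (b ^ k) o = o :=
      zpow_apply_eq_self_of_apply_eq_self (by have := (ho' o).2 rfl; simpa using this) _
    refine ⟨⟨g2⁻¹ * b ^ k * g1, G.mul_mem (G.mul_mem (G.inv_mem hg2) (G.zpow_mem hbG k)) hg1⟩, ?_, ?_⟩
    · simp only [Subgroup.smul_def, Perm.smul_def, Perm.mul_apply, h1, hbo]
      rw [Perm.inv_eq_iff_eq, h2]
    · simp only [Subgroup.smul_def, Perm.smul_def, Perm.mul_apply, hk]
      rw [Perm.inv_eq_iff_eq]
  have hprim : IsPreprimitive G (Fin n) := isPreprimitive_of_is_two_pretransitive h2t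
  obtain ⟨p, hp, hp1, hp2⟩ := hprime
  obtain ⟨c, hcH, l, hl⟩ := hcyc p hp1 (by omega)
  have hcG := hmemG c hcH
  obtain ⟨hcc, hccard⟩ := card_support_cycleOf_eq_minimalPeriod c l (by rw [hl]; exact hp.two_le)
  set m := (n - p).factorial with hm
  have hcm : c ^ m = (c.cycleOf l) ^ m := by
    ext x
    by_cases hx : c.SameCycle l x
    · rw [hx.cycleOf_eq, cycleOf_pow_apply_self]
    · have h3 := minimalPeriod_add_le c l x (by rw [hl]; exact hp.two_le) hx
      have h4 : 0 < Function.minimalPeriod c x := by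
          apply Function.minimalPeriod_pos_of_mem_periodicPts
          exact c.injective.mem_periodicPts x
      have h5 : (c ^ m) x = x := by
        rw [← iterate_eq_pow]
        apply Function.IsPeriodicPt.trans_dvd (Function.isPeriodicPt_minimalPeriod c x)
        exact Nat.dvd_factorial h4 (by omega)
      rw [h5, pow_apply_eq_self_of_apply_eq_self]
      rw [cycleOf_apply, if_neg hx]
  have hcop : m.Coprime (orderOf (c.cycleOf l)) := by
    rw [hcc.orderOf, hccard, hl, Nat.coprime_comm, hp.coprime_iff_not_dvd, hm, hp.dvd_factorial]
    omega
  have hcyc' : (c ^ m).IsCycle := by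
    rw [hcm, hcc.pow_iff]; exact hcop
  have hcycard : (c ^ m).support.card = p := by
    rw [← hcyc'.orderOf, hcm, Nat.Coprime.orderOf_pow (by rwa [Nat.coprime_comm]), hcc.orderOf,
      hccard, hl]
  have hAG : alternatingGroup (Fin n) ≤ G :=
    jordan_prime_cycle hprim hcyc' (G.pow_mem hcG m) (by rw [hcycard]; exact hp)
      (by rw [hcycard]; omega)
  have hsab : sign a ≠ sign b := by
    rw [hac.sign, hbc.sign, hacard, hbcard, hi, hj]
    obtain ⟨k, rfl⟩ : ∃ k, n = k + 1 := ⟨n - 1, by omega⟩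
    rw [Nat.add_sub_cancel, pow_succ]
    rcases neg_one_pow_eq_or ℤˣ k with h | h <;> rw [h] <;> decide
  have hodd : ∀ (M : Subgroup (Perm (Fin n))), alternatingGroup (Fin n) ≤ M → ∀ u ∈ M, sign u ≠ 1 →
      M = ⊤ := by
    intro M hM u hu hsu
    rw [eq_top_iff]
    intro z _
    by_cases hz : sign z = 1
    · exact hM (mem_alternatingGroup.2 hz)
    · have h1 : sign u = -1 := (Int.units_eq_one_or _).resolve_left hsu
      have h2 : sign z = -1 := (Int.units_eq_one_or _).resolve_left hz
      have : u⁻¹ * z ∈ M := hM (mem_alternatingGroup.2 (by simp [h1, h2]))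
      simpa using M.mul_mem hu this
  have hab : a⁻¹ * b ∈ H := by
    have := H.mul_mem (H.inv_mem haH) hbH
    simpa [mul_assoc] using this
  have hsab' : sign (a⁻¹ * b) ≠ 1 := by
    intro h
    rw [Perm.sign_mul, Perm.sign_inv] at h
    rcases Int.units_eq_one_or (sign a) with h1 | h1 <;>
      rcases Int.units_eq_one_or (sign b) with h2 | h2 <;> rw [h1, h2] at h hsab <;>
      revert h hsab <;> decide
  have hGtop : G = ⊤ := hodd G hAG _ (Subgroup.le_normalizer hab) hsab'
  have hHn : H.Normal := Subgroup.normalizer_eq_top_iff.1 hGtop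
  have hnt : Nontrivial H := by
    refine ⟨⟨⟨a⁻¹ * b, hab⟩, 1, fun h => hsab' ?_⟩⟩
    have := congrArg Subtype.val h
    simp only at this
    rw [this]; simp
  exact hodd H (alternatingGroup_le_of_normal (by simp; omega) hnt) _ hab hsab'

end GroupPart

section NormPart

/-- `w` is an enumeration of the fibre of `f` over `t`. -/
def IsFib {K A : Type} [Field K] [CommRing A] [Algebra K A] {n : ℕ} (f : K[X])
    (w : Fin n → A) (t : A) : Prop :=
  ∏ i, (X - C (w i)) = f.map (algebraMap K A) - C t

theorem esymm_homog (K : Type) [Field K] (n k : ℕ) :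
    (MvPolynomial.esymm (Fin n) K k).IsHomogeneous k := by
  rw [MvPolynomial.esymm]
  refine MvPolynomial.IsHomogeneous.sum _ _ _ fun t ht => ?_
  have := MvPolynomial.IsHomogeneous.prod t (fun i => (MvPolynomial.X i : MvPolynomial (Fin n) K))
    (fun _ => 1) (fun i _ => MvPolynomial.isHomogeneous_X _ _)
  simpa [(Finset.mem_powersetCard.1 ht).2] using this

theorem homogComp_esymm (K : Type) [Field K] (n k : ℕ) (G : MvPolynomial (Fin n) K) :
    MvPolynomial.homogeneousComponent k
      (MvPolynomial.aeval (fun i : Fin n => MvPolynomial.esymm (Fin n) K (i + 1)) G) =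
    MvPolynomial.aeval (fun i : Fin n => MvPolynomial.esymm (Fin n) K (i + 1))
      (MvPolynomial.weightedHomogeneousComponent (fun i : Fin n => (i : ℕ) + 1) k G) := by
  induction G using MvPolynomial.induction_on' with
  | add p q hp hq => simp only [map_add, hp, hq]
  | monomial d c =>
    have h1 : (MvPolynomial.aeval (fun i : Fin n => MvPolynomial.esymm (Fin n) K (i + 1))
        (MvPolynomial.monomial d c)).IsHomogeneous
          (Finsupp.weight (fun i : Fin n => (i : ℕ) + 1) d) := by
      rw [MvPolynomial.aeval_monomial]
      have h2 := (MvPolynomial.IsHomogeneous.prod Finset.univ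
        (fun i : Fin n => MvPolynomial.esymm (Fin n) K (i + 1) ^ d i)
        (fun i : Fin n => ((i : ℕ) + 1) * d i) (fun i _ => (esymm_homog K n (i+1)).pow (d i)))
      have h3 := (MvPolynomial.isHomogeneous_C (Fin n) c).mul h2
      rw [zero_add] at h3
      rw [Finsupp.weight_apply, Finsupp.sum_fintype _ _ (by simp),
        Finsupp.prod_fintype _ _ (by simp)]
      simpa [mul_comm] using h3
    have h2 := MvPolynomial.isWeightedHomogeneous_monomial (fun i : Fin n => (i : ℕ) + 1) d c rfl
    rw [MvPolynomial.homogeneousComponent_of_mem h1,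
      MvPolynomial.weightedHomogeneousComponent_of_mem h2]
    split_ifs with h
    · rfl
    · simp

theorem symm_degree {K : Type} [Field K] {n : ℕ} (hn : 0 < n) (s G : MvPolynomial (Fin n) K)
    (hs : MvPolynomial.aeval (fun i : Fin n => MvPolynomial.esymm (Fin n) K (i + 1)) G = s)
    (d : Fin n →₀ ℕ) (hd : d ∈ G.support) : n * d ⟨n - 1, by omega⟩ ≤ s.totalDegree := by
  set k := Finsupp.weight (fun i : Fin n => (i : ℕ) + 1) d with hk
  have h1 : n * d ⟨n - 1, by omega⟩ ≤ k := by
    rw [hk, Finsupp.weight_apply, Finsupp.sum_fintype _ _ (by simp)]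
    refine le_trans ?_ (Finset.single_le_sum (fun _ _ => Nat.zero_le _)
      (Finset.mem_univ (⟨n - 1, by omega⟩ : Fin n)))
    simp only [smul_eq_mul]
    rw [mul_comm, Nat.sub_add_cancel hn]
  refine h1.trans ?_
  by_contra hlt
  push Not at hlt
  have h2 := MvPolynomial.homogeneousComponent_eq_zero k s hlt
  rw [← hs, homogComp_esymm, ← MvPolynomial.esymmAlgHom_apply] at h2
  have h3 := MvPolynomial.esymmAlgHom_injective (σ := Fin n) (n := n) K (by simp)
    (a₁ := MvPolynomial.weightedHomogeneousComponent (fun i : Fin n => (i : ℕ) + 1) k G) (a₂ := 0)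
    (by apply Subtype.ext; rw [h2]; simp)
  have h4 := congrArg (MvPolynomial.coeff d) h3
  rw [MvPolynomial.coeff_weightedHomogeneousComponent, if_pos hk.symm] at h4
  exact (MvPolynomial.mem_support_iff.1 hd) (by simpa using h4)

theorem fib_esymm {K A : Type} [Field K] [CommRing A] [Algebra K A] {n : ℕ} (f : K[X])
    (w : Fin n → A) (t : A) (h : IsFib f w t) (k : ℕ) (hk : k ≤ n) :
    MvPolynomial.aeval w (MvPolynomial.esymm (Fin n) K k) =
      (-1) ^ k * (algebraMap K A (f.coeff (n - k)) - if n - k = 0 then t else 0) := by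
  rw [MvPolynomial.aeval_esymm_eq_multiset_esymm]
  have h1 := Multiset.prod_X_sub_C_coeff (Finset.univ.val.map w) (k := n - k) (by simp)
  have h2 : ((Finset.univ.val.map w).map (fun t => X - C t)).prod =
      f.map (algebraMap K A) - C t := by
    rw [← h, Multiset.map_map]; rfl
  rw [h2] at h1
  have h3 : Multiset.card (Finset.univ.val.map w) - (n - k) = k := by simp; omega
  rw [h3] at h1
  have h4 : (f.map (algebraMap K A) - C t).coeff (n - k) =
      (algebraMap K A (f.coeff (n - k)) - if n - k = 0 then t else 0) := by
    rw [coeff_sub, coeff_map, coeff_C]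
  rw [← h4, h1, ← mul_assoc, ← mul_pow]; simp

theorem norm_lemma {K : Type} [Field K] {n : ℕ} (hn : 0 < n) (f : K[X])
    (h : MvPolynomial (Fin n) K) (m : ℕ) (hm : h.totalDegree ≤ m) :
    ∃ G : K[X], G.natDegree ≤ (n - 1).factorial * m ∧
      ∀ (A : Type) [CommRing A] [Algebra K A] (w : Fin n → A) (t : A), IsFib f w t →
        ∏ τ : Equiv.Perm (Fin n), MvPolynomial.aeval (w ∘ τ) h = aeval t G := by
  classical
  set s : MvPolynomial (Fin n) K := ∏ τ : Equiv.Perm (Fin n), MvPolynomial.rename τ h with hs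
  have hsym : s.IsSymmetric := by
    intro e
    rw [hs, map_prod]
    simp only [MvPolynomial.rename_rename]
    exact Fintype.prod_equiv (Equiv.mulLeft e) _ _ (fun τ => rfl)
  have hdeg : s.totalDegree ≤ n * ((n - 1).factorial * m) := by
    rw [← mul_assoc, Nat.mul_factorial_pred hn.ne']
    refine (MvPolynomial.totalDegree_finsetProd _ _).trans ?_
    refine (Finset.sum_le_card_nsmul _ _ m ?_).trans ?_
    · intro τ _
      exact (MvPolynomial.totalDegree_rename_le _ _).trans hm
    · rw [Finset.card_univ, Fintype.card_perm, Fintype.card_fin, smul_eq_mul]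
  obtain ⟨G0, hG0⟩ := MvPolynomial.esymmAlgHom_surjective (σ := Fin n) (n := n) K (by simp)
    ⟨s, hsym⟩
  have hG1 : MvPolynomial.aeval (fun i : Fin n => MvPolynomial.esymm (Fin n) K (i + 1)) G0 = s := by
    rw [← MvPolynomial.esymmAlgHom_apply, hG0]
  let v : Fin n → K[X] := fun i => (-1) ^ ((i : ℕ) + 1) *
    (C (f.coeff (n - (i + 1))) - if n - ((i : ℕ) + 1) = 0 then X else 0)
  have hv : ∀ i : Fin n, (v i).natDegree ≤ if i = ⟨n - 1, by omega⟩ then 1 else 0 := by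
    intro i
    have h1 : ((-1 : K[X]) ^ ((i : ℕ) + 1)) = C ((-1) ^ ((i : ℕ) + 1)) := by simp
    simp only [v, h1]
    refine (natDegree_C_mul_le _ _).trans ?_
    by_cases hi : i = ⟨n - 1, by omega⟩
    · rw [if_pos hi]
      refine (natDegree_sub_le _ _).trans ?_
      rw [natDegree_C]
      split_ifs <;> simp
    · rw [if_neg hi, if_neg]
      · simp
      · intro h0
        apply hi
        apply Fin.ext
        simp only
        omega
  refine ⟨MvPolynomial.aeval v G0, ?_, ?_⟩
  · rw [MvPolynomial.aeval_def, MvPolynomial.eval₂_eq]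
    apply natDegree_sum_le_of_forall_le
    intro d hd
    refine (natDegree_C_mul_le _ _).trans ?_
    refine (natDegree_prod_le _ _).trans ?_
    have h1 := symm_degree hn s G0 hG1 d hd
    have h2 := Nat.le_of_mul_le_mul_left (h1.trans hdeg) hn
    refine le_trans ?_ h2
    calc _ ≤ ∑ i ∈ d.support, (if i = ⟨n - 1, by omega⟩ then d i else 0) := by
          apply Finset.sum_le_sum
          intro i _
          refine natDegree_pow_le.trans ?_
          refine (Nat.mul_le_mul_left _ (hv i)).trans ?_
          split_ifs <;> simp
      _ ≤ d ⟨n - 1, by omega⟩ := by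
          rw [Finset.sum_ite_eq']
          split_ifs <;> simp
  · intro A _ _ w t hw
    have h1 : ∀ τ : Equiv.Perm (Fin n), MvPolynomial.aeval (w ∘ τ) h =
        MvPolynomial.aeval w (MvPolynomial.rename τ h) := by
      intro τ; rw [MvPolynomial.aeval_rename]
    rw [Finset.prod_congr rfl (fun τ _ => h1 τ), ← map_prod, ← hs, ← hG1]
    have h2 : (MvPolynomial.aeval w).comp
        (MvPolynomial.aeval (fun i : Fin n => MvPolynomial.esymm (Fin n) K (i + 1))) =
        (aeval t : K[X] →ₐ[K] A).comp (MvPolynomial.aeval v) := by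
      apply MvPolynomial.algHom_ext
      intro i
      simp only [AlgHom.comp_apply, MvPolynomial.aeval_X]
      rw [fib_esymm f w t hw _ (by omega)]
      simp only [v, map_mul, map_pow, map_neg, map_one, map_sub, aeval_C]
      congr 2
      split_ifs <;> simp
    exact DFunLike.congr_fun h2 G0

end NormPart

section GenericPart

/-- `x` is a generic fibre of `f` over `t` with full symmetric monodromy. -/
structure GenFib {K L : Type} [Field K] [Field L] [Algebra K L] {n : ℕ} (f : K[X])
    (x : Fin n → L) (t : L) : Prop where
  fib : IsFib f x t
  trans : Transcendental K t
  sym : ∀ (h : MvPolynomial (Fin n) K) (σ : Equiv.Perm (Fin n)),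
    MvPolynomial.aeval x h = 0 → MvPolynomial.aeval (x ∘ σ) h = 0

theorem fib_root {K A : Type} [Field K] [CommRing A] [Algebra K A] {n : ℕ} {f : K[X]}
    {w : Fin n → A} {t : A} (h : IsFib f w t) (i : Fin n) : aeval (w i) f = t := by
  have h1 := congrArg (eval (w i)) h
  rw [eval_prod, Finset.prod_eq_zero (Finset.mem_univ i) (by simp)] at h1
  rw [eval_sub, eval_C, eval_map_algebraMap] at h1
  exact (sub_eq_zero.1 h1.symm)

theorem monic_sub_C {A : Type} [CommRing A] [Nontrivial A] {g : A[X]} {n : ℕ} (hn : 0 < n)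
    (hg : g.Monic) (hgn : g.natDegree = n) (t : A) :
    (g - C t).Monic ∧ (g - C t).natDegree = n := by
  constructor
  · apply hg.sub_of_left
    refine lt_of_le_of_lt degree_C_le ?_
    rw [degree_eq_natDegree hg.ne_zero, hgn]
    exact_mod_cast hn
  · rw [natDegree_sub_C, hgn]

theorem fib_of_roots {K A : Type} [Field K] [CommRing A] [IsDomain A] [Algebra K A] {n : ℕ}
    (hn : 0 < n) {f : K[X]} (hf : f.Monic) (hfn : f.natDegree = n)
    {w : Fin n → A} {t : A} (hw : Function.Injective w) (h : ∀ i, aeval (w i) f = t) :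
    IsFib f w t := by
  obtain ⟨h1, h2⟩ := monic_sub_C hn (hf.map (algebraMap K A)) (by rw [hf.natDegree_map, hfn]) t
  have h3 : (∏ i, (X - C (w i))).Monic := monic_prod_X_sub_C _ _
  have h4 : (∏ i, (X - C (w i))).natDegree = n := by
    rw [natDegree_finsetProd_X_sub_C_eq_card]; simp
  refine eq_of_degree_le_of_eval_index_eq (s := Finset.univ) (v := w) hw.injOn ?_ ?_ ?_ ?_
  · rw [degree_eq_natDegree h3.ne_zero, h4]; simp
  · rw [degree_eq_natDegree h3.ne_zero, h4, degree_eq_natDegree h1.ne_zero, h2]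
  · rw [h3.leadingCoeff, h1.leadingCoeff]
  · intro i hi
    rw [eval_prod, Finset.prod_eq_zero hi (by simp), eval_sub, eval_C, eval_map_algebraMap, h,
      sub_self]

theorem fib_monic {K A : Type} [Field K] [CommRing A] [IsDomain A] [Algebra K A] {n : ℕ}
    (hn : 0 < n) {f : K[X]} {w : Fin n → A} {t : A} (h : IsFib f w t) :
    f.Monic ∧ f.natDegree = n := by
  have h3 : (∏ i, (X - C (w i))).Monic := monic_prod_X_sub_C _ _
  have h4 : (∏ i, (X - C (w i))).natDegree = n := by
    rw [natDegree_finsetProd_X_sub_C_eq_card]; simp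
  have h5 : f.map (algebraMap K A) = ∏ i, (X - C (w i)) + C t := by rw [h]; ring
  have h6 : (f.map (algebraMap K A)).natDegree = n := by rw [h5, natDegree_add_C, h4]
  have h7 : f.natDegree = n := by
    rw [← h6, natDegree_map]
  refine ⟨?_, h7⟩
  have h8 : (f.map (algebraMap K A)).coeff n = 1 := by
    rw [h5, coeff_add, coeff_C, if_neg hn.ne', add_zero]
    have := h3.coeff_natDegree
    rwa [h4] at this
  rw [coeff_map] at h8
  rw [Monic, leadingCoeff, h7]
  exact (algebraMap K A).injective (by rw [h8, map_one])

theorem fib_comp {K A : Type} [Field K] [CommRing A] [Algebra K A] {n : ℕ} {f : K[X]}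
    {w : Fin n → A} {t : A} (h : IsFib f w t) (σ : Equiv.Perm (Fin n)) : IsFib f (w ∘ σ) t := by
  rw [IsFib, ← h]
  exact Equiv.prod_comp σ (fun i => X - C (w i))

theorem gen_spec {K L A : Type} [Field K] [Infinite K] [Field L] [Algebra K L] [CommRing A]
    [IsDomain A] [Algebra K A] {n : ℕ} (hn : 0 < n) {f : K[X]} {x : Fin n → L} {t : L}
    (hx : GenFib f x t) {w : Fin n → A} {t' : A} (hw : IsFib f w t')
    {h : MvPolynomial (Fin n) K} (hh : MvPolynomial.aeval x h = 0) :
    MvPolynomial.aeval w h = 0 := by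
  classical
  have key : ∀ c : K, ∏ τ : Equiv.Perm (Fin n),
      (algebraMap K A c - MvPolynomial.aeval (w ∘ τ) h) =
      algebraMap K A c ^ Fintype.card (Equiv.Perm (Fin n)) := by
    intro c
    obtain ⟨G, -, hG⟩ := norm_lemma hn f (MvPolynomial.C c - h) _ le_rfl
    have h1 := hG L x t hx.fib
    have h2 : ∀ τ : Equiv.Perm (Fin n), MvPolynomial.aeval (x ∘ τ) (MvPolynomial.C c - h) =
        algebraMap K L c := by
      intro τ
      rw [map_sub, hx.sym h τ hh, sub_zero, MvPolynomial.aeval_C]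
    rw [Finset.prod_congr rfl (fun τ _ => h2 τ), Finset.prod_const, Finset.card_univ] at h1
    have h3 : G = C (c ^ Fintype.card (Equiv.Perm (Fin n))) := by
      have := (transcendental_iff_injective.1 hx.trans)
      apply this
      rw [← h1]; simp
    have h4 := hG A w t' hw
    rw [h3] at h4
    simp only [map_sub, MvPolynomial.aeval_C] at h4
    rw [h4]; simp
  have hpoly : ∏ τ : Equiv.Perm (Fin n), (X - C (MvPolynomial.aeval (w ∘ τ) h)) =
      (X : A[X]) ^ Fintype.card (Equiv.Perm (Fin n)) := by
    apply eq_of_infinite_eval_eq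
    refine Set.Infinite.mono ?_ (Set.infinite_range_of_injective (algebraMap K A).injective)
    rintro _ ⟨c, rfl⟩
    simp only [Set.mem_ofPred_eq, eval_prod, eval_sub, eval_X, eval_C, eval_pow]
    exact key c
  have h5 := congrArg (eval (MvPolynomial.aeval w h)) hpoly
  rw [eval_prod, Finset.prod_eq_zero (Finset.mem_univ (1 : Equiv.Perm (Fin n)))
      (by rw [eval_sub, eval_X, eval_C]; exact sub_self _),
    eval_pow, eval_X] at h5
  exact pow_eq_zero_iff (Fintype.card_ne_zero) |>.1 h5.symm

theorem order_rootMult {K : Type} [Field K] (G : K[X]) (hG : G ≠ 0) (t0 : K) (k : ℕ)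
    (hk : (PowerSeries.X : PowerSeries K) ^ k ∣ aeval (PowerSeries.C t0 + PowerSeries.X) G) :
    k ≤ G.rootMultiplicity t0 := by
  have h1 : aeval (PowerSeries.C t0 + PowerSeries.X : PowerSeries K) G =
      ((G.comp (X + C t0) : K[X]) : PowerSeries K) := by
    have h2 : (aeval (PowerSeries.C t0 + PowerSeries.X : PowerSeries K) : K[X] →ₐ[K] _) =
        (Polynomial.coeToPowerSeries.algHom K).comp (aeval (X + C t0)) := by
      apply algHom_ext
      simp [add_comm]
    rw [h2, AlgHom.comp_apply, comp, aeval_def]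
    simp
  rw [h1, PowerSeries.X_pow_dvd_iff] at hk
  rw [rootMultiplicity_eq_rootMultiplicity, le_rootMultiplicity_iff]
  · rw [map_zero, sub_zero, X_pow_dvd_iff]
    intro d hd
    simpa using hk d hd
  · intro h0
    apply hG
    have := congrArg (fun p => p.comp (X - C t0)) h0
    simpa [comp_assoc] using this

theorem gen_ne_zero {K L : Type} [Field K] [Field L] [Algebra K L] {n : ℕ}
    {f : K[X]} {x : Fin n → L} {t : L} (hx : GenFib f x t) {h : MvPolynomial (Fin n) K}
    (hh : MvPolynomial.aeval x h ≠ 0) {G : K[X]}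
    (hG : ∏ τ : Equiv.Perm (Fin n), MvPolynomial.aeval (x ∘ τ) h = aeval t G) : G ≠ 0 := by
  rintro rfl
  rw [map_zero, Finset.prod_eq_zero_iff] at hG
  obtain ⟨τ, -, hτ⟩ := hG
  rw [← MvPolynomial.aeval_rename] at hτ
  have := hx.sym _ τ⁻¹ hτ
  rw [MvPolynomial.aeval_rename] at this
  apply hh
  convert this using 2
  ext i; simp

theorem gen_order {K L : Type} [Field K] [Field L] [Algebra K L] {n : ℕ} (hn : 0 < n)
    {f : K[X]} {x : Fin n → L} {t : L} (hx : GenFib f x t) {h : MvPolynomial (Fin n) K}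
    (hh : MvPolynomial.aeval x h ≠ 0) {m : ℕ} (hm : h.totalDegree ≤ m) {t0 : K}
    {z : Fin n → PowerSeries K} (hz : IsFib f z (PowerSeries.C t0 + PowerSeries.X)) {k : ℕ}
    (hk : (PowerSeries.X : PowerSeries K) ^ k ∣ MvPolynomial.aeval z h) :
    k ≤ (n - 1).factorial * m := by
  obtain ⟨G, hGd, hG⟩ := norm_lemma hn f h m hm
  have h0 := gen_ne_zero hx hh (hG L x t hx.fib)
  refine le_trans ?_ hGd
  have h1 : k ≤ G.rootMultiplicity t0 := by
    apply order_rootMult G h0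
    rw [← hG _ z _ hz]
    have hz1 : z ∘ ⇑(1 : Equiv.Perm (Fin n)) = z := rfl
    rw [← hz1] at hk
    refine hk.trans ?_
    exact Finset.dvd_prod_of_mem (fun τ : Equiv.Perm (Fin n) => MvPolynomial.aeval (z ∘ τ) h)
      (Finset.mem_univ 1)
  refine h1.trans ?_
  classical
  rw [← count_roots]
  exact (Multiset.count_le_card _ _).trans (card_roots' G)

theorem hensel_fib {K : Type} [Field K] {n : ℕ} (hn : 0 < n) {f : K[X]} {y : Fin n → K} {t0 : K}
    (hy : IsFib f y t0) (hyi : Function.Injective y) :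
    ∃ z : Fin n → PowerSeries K, IsFib f z (PowerSeries.C t0 + PowerSeries.X) ∧
      ∀ i, PowerSeries.constantCoeff (z i) = y i := by
  classical
  obtain ⟨hf, hfn⟩ := fib_monic hn hy
  set P : (PowerSeries K)[X] := f.map (algebraMap K (PowerSeries K)) -
    C (PowerSeries.C t0 + PowerSeries.X) with hP
  have hPm : P.Monic := (monic_sub_C hn (hf.map _) (by rw [hf.natDegree_map, hfn]) _).1
  have hC : ∀ (c : K) (g : K[X]), eval (PowerSeries.C c) (g.map (algebraMap K (PowerSeries K))) =
      PowerSeries.C (eval c g) := by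
    intro c g
    rw [PowerSeries.algebraMap_eq, eval_map_apply]
  have hder : ∀ i, f.derivative.eval (y i) ≠ 0 := by
    intro i
    have h1 : f.derivative = (∏ i, (X - C (y i))).derivative := by
      rw [hy]; simp
    rw [h1, derivative_prod_finset, eval_finsetSum, Finset.sum_eq_single i]
    · simp only [eval_prod, derivative_sub, derivative_X, derivative_C, sub_zero,
        mul_one, eval_sub, eval_X, eval_C]
      rw [Finset.prod_ne_zero_iff]
      intro j hj
      rw [sub_ne_zero]
      intro h
      exact (Finset.mem_erase.1 hj).1 (hyi h).symm
    · intro j _ hj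
      rw [eval_mul, eval_prod, Finset.prod_eq_zero (Finset.mem_erase.2 ⟨hj.symm, Finset.mem_univ i⟩)
        (by simp), zero_mul]
    · simp
  have hex : ∀ i, ∃ a : PowerSeries K, P.IsRoot a ∧
      a - PowerSeries.C (y i) ∈ Ideal.span {(PowerSeries.X : PowerSeries K)} := by
    intro i
    apply HenselianRing.is_henselian P hPm
    · rw [hP, eval_sub, hC, eval_C]
      have := fib_root hy i
      rw [coe_aeval_eq_eval] at this
      rw [this]
      rw [Ideal.mem_span_singleton]
      exact ⟨-1, by ring⟩
    · apply IsUnit.map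
      rw [hP, derivative_sub, derivative_C, sub_zero, derivative_map, hC]
      exact (IsUnit.mk0 _ (hder i)).map _
  choose z hz1 hz2 using hex
  have hzc : ∀ i, PowerSeries.constantCoeff (z i) = y i := by
    intro i
    have := hz2 i
    rw [Ideal.mem_span_singleton, PowerSeries.X_dvd_iff] at this
    simpa [sub_eq_zero] using this
  refine ⟨z, ?_, hzc⟩
  apply fib_of_roots hn hf hfn
  · intro i j hij
    apply hyi
    rw [← hzc, ← hzc, hij]
  · intro i
    have := hz1 i
    rw [IsRoot, hP, eval_sub, eval_C, eval_map_algebraMap, sub_eq_zero] at this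
    exact this

theorem gen_count {K L : Type} [Field K] [Field L] [Algebra K L] {n : ℕ} (hn : 0 < n)
    {f : K[X]} {x : Fin n → L} {t : L} (hx : GenFib f x t) {h : MvPolynomial (Fin n) K}
    (hh : MvPolynomial.aeval x h ≠ 0) {m : ℕ} (hm : h.totalDegree ≤ m)
    (S : Finset (Fin n → K)) (hS : ∀ y ∈ S, Function.Injective y ∧ (∃ t0, IsFib f y t0) ∧
      MvPolynomial.aeval y h = 0) : S.card ≤ (n - 1).factorial * m := by
  classical
  obtain ⟨G, hGd, hG⟩ := norm_lemma hn f h m hm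
  have h0 := gen_ne_zero hx hh (hG L x t hx.fib)
  refine le_trans ?_ hGd
  let T : (Fin n → K) → K := fun y => aeval (y ⟨0, hn⟩) f
  have hT : ∀ y ∈ S, IsFib f y (T y) := by
    intro y hy
    obtain ⟨t0, ht0⟩ := (hS y hy).2.1
    have : T y = t0 := fib_root ht0 _
    rwa [this]
  rw [Finset.card_eq_sum_card_image T S]
  calc _ ≤ ∑ t0 ∈ S.image T, G.roots.count t0 := by
        apply Finset.sum_le_sum
        intro t0 ht0
        rw [count_roots]
        apply order_rootMult G h0
        obtain ⟨y, hyS, rfl⟩ := Finset.mem_image.1 ht0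
        obtain ⟨hyi, -, -⟩ := hS y hyS
        obtain ⟨z, hz, hzc⟩ := hensel_fib hn (hT y hyS) hyi
        rw [← hG _ z _ hz]
        let U : Finset (Equiv.Perm (Fin n)) := Finset.univ.filter (fun τ => y ∘ τ ∈ S)
        have hU : (S.filter (fun y' => T y' = T y)).card ≤ U.card := by
          refine (Finset.card_le_card ?_).trans
            (Finset.card_image_le (s := U) (f := fun τ : Equiv.Perm (Fin n) => y ∘ τ))
          intro y' hy'
          obtain ⟨hy'S, hTT⟩ := Finset.mem_filter.1 hy'
          have hy'i := (hS y' hy'S).1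
          have hfy' := hT y' hy'S
          rw [hTT] at hfy'
          have hex : ∀ i, ∃ j, y j = y' i := by
            intro i
            have h1 := fib_root hfy' i
            have h2 := congrArg (eval (y' i)) (hT y hyS)
            rw [eval_prod, eval_sub, eval_C, eval_map_algebraMap, h1, sub_self,
              Finset.prod_eq_zero_iff] at h2
            obtain ⟨j, -, hj⟩ := h2
            refine ⟨j, ?_⟩
            simpa [sub_eq_zero, eq_comm] using hj
          choose τ hτ using hex
          have hτi : Function.Injective τ := by
            intro i j hij
            apply hy'i
            rw [← hτ, ← hτ, hij]
          rw [Finset.mem_image]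
          have hcomp : y ∘ (Equiv.ofBijective τ (Finite.injective_iff_bijective.1 hτi)) = y' := by
            ext i; simp [hτ]
          refine ⟨Equiv.ofBijective τ (Finite.injective_iff_bijective.1 hτi), ?_, hcomp⟩
          rw [Finset.mem_filter]
          refine ⟨Finset.mem_univ _, ?_⟩
          rw [hcomp]; exact hy'S
        refine (pow_dvd_pow _ hU).trans ?_
        refine dvd_trans ?_ (Finset.prod_dvd_prod_of_subset U Finset.univ _ (Finset.subset_univ _))
        rw [← Finset.prod_const]
        apply Finset.prod_dvd_prod_of_dvd
        intro τ hτ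
        rw [PowerSeries.X_dvd_iff]
        have h1 := (hS _ (Finset.mem_filter.1 hτ).2).2.2
        rw [← h1]
        have h2 : ((PowerSeries.constantCoeff (R := K)).comp
            (MvPolynomial.aeval (z ∘ τ) : MvPolynomial (Fin n) K →ₐ[K] _).toRingHom) =
            (MvPolynomial.aeval (y ∘ τ) : MvPolynomial (Fin n) K →ₐ[K] K).toRingHom := by
          apply MvPolynomial.ringHom_ext
          · intro c; simp
          · intro i; simp [hzc]
        exact DFunLike.congr_fun h2 h
    _ ≤ Multiset.card G.roots := by
        rw [← Multiset.sum_count_eq_card (s := S.image T ∪ G.roots.toFinset) (m := G.roots)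
          (fun a ha => Finset.mem_union_right _ (Multiset.mem_toFinset.2 ha))]
        exact Finset.sum_le_sum_of_subset Finset.subset_union_left
    _ ≤ _ := card_roots' G

end GenericPart

section StepanovPart

theorem stepanov_rel {K L : Type} [Field K] [Field L] [Algebra K L]
    {n : ℕ} (hn : 0 < n) {f : K[X]} {x : Fin n → L} {t : L} (hx : GenFib f x t)
    {t0 : K} {z : Fin n → PowerSeries K} (hz : IsFib f z (PowerSeries.C t0 + PowerSeries.X))
    {ι : Type} [Fintype ι] (b : ι → MvPolynomial (Fin n) K) (m : ℕ)
    (hm : ∀ i, (b i).totalDegree ≤ m) (hcard : (n - 1).factorial * m + 1 < Fintype.card ι) :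
    ∃ c : ι → K, c ≠ 0 ∧ MvPolynomial.aeval x (∑ i, c i • b i) = 0 := by
  classical
  set N := (n - 1).factorial * m + 1
  let Λ : (ι → K) →ₗ[K] (Fin N → K) := LinearMap.pi (fun d => (PowerSeries.coeff (R := K) d) ∘ₗ
    (MvPolynomial.aeval z : MvPolynomial (Fin n) K →ₐ[K] PowerSeries K).toLinearMap ∘ₗ
    (Fintype.linearCombination K b))
  have h1 : LinearMap.ker Λ ≠ ⊥ := by
    apply LinearMap.ker_ne_bot_of_finrank_lt
    simpa using hcard
  obtain ⟨c, hc, hc0⟩ := Submodule.exists_mem_ne_zero_of_ne_bot h1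
  refine ⟨c, hc0, ?_⟩
  by_contra hne
  have h2 : (∑ i, c i • b i).totalDegree ≤ m := by
    refine (MvPolynomial.totalDegree_finsetSum _ _).trans ?_
    apply Finset.sup_le
    intro i _
    exact (MvPolynomial.totalDegree_smul_le _ _).trans (hm i)
  have h3 := gen_order hn hx hne h2 hz (k := N) (by
    rw [PowerSeries.X_pow_dvd_iff]
    intro d hd
    have := congrFun (LinearMap.mem_ker.1 hc) ⟨d, hd⟩
    simpa [Λ, Fintype.linearCombination_apply] using this)
  omega

theorem stepanov_ne {K L : Type} [Field K] [Infinite K] [Field L] [Algebra K L]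
    {p : ℕ} [Fact p.Prime] [CharP K p]
    {n : ℕ} (hn : 0 < n) {f : K[X]} {x : Fin n → L} {t : L} (hx : GenFib f x t)
    {t0 : K} {z : Fin n → PowerSeries K} (hz : IsFib f z (PowerSeries.C t0 + PowerSeries.X))
    {ι : Type} [Fintype ι] (a : ι → MvPolynomial (Fin n) K) (m e : ℕ)
    (hm : ∀ i, (a i).totalDegree ≤ m) (hDm : (n - 1).factorial * m < p ^ e)
    (ha : LinearIndependent K (fun i => MvPolynomial.aeval x (a i)))
    (h : ι → MvPolynomial (Fin n) K) (i0 : ι) (hi0 : MvPolynomial.aeval x (h i0) ≠ 0) :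
    MvPolynomial.aeval x (∑ i, a i * h i ^ (p ^ e)) ≠ 0 := by
  classical
  intro h0
  have h1 := gen_spec hn hx hz h0
  have : CharP (PowerSeries K) p :=
    charP_of_injective_algebraMap (algebraMap K (PowerSeries K)).injective p
  have hex : ∃ k, ¬ ∀ i, (PowerSeries.X : PowerSeries K) ^ k ∣ MvPolynomial.aeval z (h i) := by
    refine ⟨(n - 1).factorial * (h i0).totalDegree + 1, fun hh => ?_⟩
    have := gen_order hn hx hi0 le_rfl hz (hh i0)
    omega
  obtain ⟨v, hv⟩ : ∃ v, Nat.find hex = v + 1 := by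
    apply Nat.exists_eq_succ_of_ne_zero
    intro h2
    have := Nat.find_spec hex
    rw [h2] at this
    simp at this
  have hv1 : ∀ i, (PowerSeries.X : PowerSeries K) ^ v ∣ MvPolynomial.aeval z (h i) := by
    by_contra h2
    have := Nat.find_min' hex h2
    omega
  have hv2 := Nat.find_spec hex
  rw [hv] at hv2
  choose w hw using hv1
  obtain ⟨i1, hi1⟩ := not_forall.1 hv2
  have hw1 : PowerSeries.constantCoeff (w i1) ≠ 0 := by
    intro h2
    apply hi1
    rw [hw i1, pow_succ]
    exact mul_dvd_mul_left _ (PowerSeries.X_dvd_iff.2 h2)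
  have hu : ∀ i, ∃ u, w i = PowerSeries.C (PowerSeries.constantCoeff (w i)) + PowerSeries.X * u := by
    intro i
    have : (PowerSeries.X : PowerSeries K) ∣
        w i - PowerSeries.C (PowerSeries.constantCoeff (w i)) := by
      rw [PowerSeries.X_dvd_iff]; simp
    obtain ⟨u, hu⟩ := this
    exact ⟨u, by rw [← hu]; ring⟩
  choose u hu using hu
  have h2 : ∑ i, MvPolynomial.aeval z (a i) * w i ^ (p ^ e) = 0 := by
    rw [map_sum] at h1
    simp only [map_mul, map_pow] at h1
    have h3 : (PowerSeries.X : PowerSeries K) ^ (v * p ^ e) *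
        ∑ i, MvPolynomial.aeval z (a i) * w i ^ (p ^ e) = 0 := by
      rw [← h1, Finset.mul_sum]
      apply Finset.sum_congr rfl
      intro i _
      rw [hw i, mul_pow, ← pow_mul]; ring
    exact (mul_eq_zero.1 h3).resolve_left (pow_ne_zero _ PowerSeries.X_ne_zero)
  set c : ι → K := fun i => (PowerSeries.constantCoeff (w i)) ^ (p ^ e) with hc
  have h3 : (PowerSeries.X : PowerSeries K) ^ (p ^ e) ∣
      MvPolynomial.aeval z (∑ i, c i • a i) := by
    refine ⟨- ∑ i, MvPolynomial.aeval z (a i) * u i ^ (p ^ e), ?_⟩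
    rw [mul_neg, ← sub_eq_zero, sub_neg_eq_add, ← h2, Finset.mul_sum, map_sum,
      ← Finset.sum_add_distrib]
    apply Finset.sum_congr rfl
    intro i _
    conv_rhs => rw [hu i, add_pow_char_pow, mul_pow]
    rw [map_smul, hc, PowerSeries.smul_eq_C_mul, map_pow]
    ring
  have h4 : (∑ i, c i • a i).totalDegree ≤ m := by
    refine (MvPolynomial.totalDegree_finsetSum _ _).trans ?_
    apply Finset.sup_le
    intro i _
    exact (MvPolynomial.totalDegree_smul_le _ _).trans (hm i)
  have h5 : MvPolynomial.aeval x (∑ i, c i • a i) = 0 := by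
    by_contra hne
    have := gen_order hn hx hne h4 hz h3
    omega
  rw [map_sum] at h5
  simp only [map_smul] at h5
  have h6 := Fintype.linearIndependent_iff.1 ha c h5 i1
  exact hw1 (pow_eq_zero_iff (pow_ne_zero _ (Fact.out : p.Prime).ne_zero) |>.1 h6)

theorem stepanov {K L : Type} [Field K] [IsAlgClosed K] [Field L] [Algebra K L]
    {p : ℕ} [Fact p.Prime] [CharP K p]
    {n : ℕ} (hn : 0 < n) {f : K[X]} {x : Fin n → L} {t : L} (hx : GenFib f x t)
    {t0 : K} {z : Fin n → PowerSeries K} (hz : IsFib f z (PowerSeries.C t0 + PowerSeries.X))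
    {ι κ : Type} [Fintype ι] [Fintype κ] (a : ι → MvPolynomial (Fin n) K)
    (g : κ → MvPolynomial (Fin n) K) (m k e e' : ℕ)
    (hm : ∀ i, (a i).totalDegree ≤ m) (hk : ∀ j, (g j).totalDegree ≤ k)
    (ha : LinearIndependent K (fun i => MvPolynomial.aeval x (a i)))
    (hg : LinearIndependent K (fun i => MvPolynomial.aeval x (g i)))
    (hDm : (n - 1).factorial * m < p ^ e')
    (hcard : (n - 1).factorial * (m * p ^ e + k) + 1 < Fintype.card ι * Fintype.card κ)
    (hgQ : ∀ (y : Fin n → K) j, (MvPolynomial.aeval y (g j)) ^ (p ^ (e' + e)) =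
      MvPolynomial.aeval (fun i => y i ^ (p ^ (e' + e))) (g j))
    (σ : Equiv.Perm (Fin n)) (S : Finset (Fin n → K))
    (hS : ∀ y ∈ S, Function.Injective y ∧ (∃ t0, IsFib f y t0) ∧
      ∀ i, y i ^ (p ^ (e' + e)) = y (σ i)) :
    S.card ≤ (n - 1).factorial * (m + k * p ^ e') := by
  classical
  have hinf : Infinite K := IsAlgClosed.instInfinite
  have hpp : 0 < p := (Fact.out : p.Prime).pos
  obtain ⟨c, hc0, hc⟩ := stepanov_rel hn hx hz
    (fun q : ι × κ => a q.1 ^ (p ^ e) * MvPolynomial.rename σ (g q.2)) (m * p ^ e + k)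
    (by
      intro q
      refine (MvPolynomial.totalDegree_mul _ _).trans (add_le_add ?_ ?_)
      · refine (MvPolynomial.totalDegree_pow _ _).trans ?_
        rw [mul_comm]
        exact Nat.mul_le_mul_right _ (hm _)
      · exact (MvPolynomial.totalDegree_rename_le _ _).trans (hk _))
    (by rw [Fintype.card_prod]; exact hcard)
  have hb : ∀ q, ∃ b : K, b ^ (p ^ (e' + e)) = c q := fun q =>
    IsAlgClosed.exists_pow_nat_eq (c q) (by positivity)
  choose b hb using hb
  let h : ι → MvPolynomial (Fin n) K := fun i => ∑ j, b (i, j) • g j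
  obtain ⟨⟨i0, j0⟩, hq⟩ := Function.ne_iff.1 hc0
  have hi0 : MvPolynomial.aeval x (h i0) ≠ 0 := by
    intro h0
    simp only [h, map_sum, map_smul] at h0
    have := Fintype.linearIndependent_iff.1 hg (fun j => b (i0, j)) h0 j0
    apply hq
    rw [← hb, this]
    simp [hpp.ne']
  have hne := stepanov_ne (p := p) hn hx hz a m e' hm hDm ha h i0 hi0
  refine gen_count hn hx hne ?_ S ?_
  · refine (MvPolynomial.totalDegree_finsetSum _ _).trans ?_
    apply Finset.sup_le
    intro i _
    refine (MvPolynomial.totalDegree_mul _ _).trans (add_le_add (hm i) ?_)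
    refine (MvPolynomial.totalDegree_pow _ _).trans ?_
    rw [mul_comm]
    apply Nat.mul_le_mul_right
    refine (MvPolynomial.totalDegree_finsetSum _ _).trans ?_
    apply Finset.sup_le
    intro j _
    exact (MvPolynomial.totalDegree_smul_le _ _).trans (hk j)
  · intro y hy
    obtain ⟨hy1, ⟨t1, hy2⟩, hy3⟩ := hS y hy
    refine ⟨hy1, ⟨t1, hy2⟩, ?_⟩
    have h1 := gen_spec hn hx hy2 hc
    have h2 : (MvPolynomial.aeval y (∑ i, a i * h i ^ (p ^ e'))) ^ (p ^ e) = 0 := by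
      rw [← h1, map_sum, map_sum, sum_pow_char_pow, Fintype.sum_prod_type]
      apply Finset.sum_congr rfl
      intro i _
      simp only [map_mul, map_pow, mul_pow, h, map_sum, map_smul]
      rw [← pow_mul, ← pow_add, sum_pow_char_pow, Finset.mul_sum]
      apply Finset.sum_congr rfl
      intro j _
      rw [_root_.smul_pow, hb, hgQ, MvPolynomial.aeval_rename]
      have : (fun i => y i ^ (p ^ (e' + e))) = y ∘ σ := funext hy3
      rw [this, mul_smul_comm]
    exact pow_eq_zero_iff (pow_ne_zero _ hpp.ne') |>.1 h2

end StepanovPart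

section CountPart

/-- The polynomial `f(X_0)^k X^μ`. -/
noncomputable def gpoly {K : Type} [Field K] {n : ℕ} (hn : 0 < n) (f : K[X]) (k : ℕ)
    (μ : Fin n →₀ ℕ) : MvPolynomial (Fin n) K :=
  (aeval (MvPolynomial.X (⟨0, hn⟩ : Fin n)) f) ^ k * MvPolynomial.monomial μ 1

theorem gpoly_aeval {K A : Type} [Field K] [CommRing A] [Algebra K A] {n : ℕ} (hn : 0 < n)
    (f : K[X]) (k : ℕ) (μ : Fin n →₀ ℕ) (w : Fin n → A) :
    MvPolynomial.aeval w (gpoly hn f k μ) =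
      (aeval (w ⟨0, hn⟩) f) ^ k * μ.prod (fun i e => w i ^ e) := by
  rw [gpoly, map_mul, map_pow, MvPolynomial.aeval_monomial, map_one, one_mul,
    ← aeval_algHom_apply, MvPolynomial.aeval_X]

theorem gpoly_degree {K : Type} [Field K] {n : ℕ} (hn : 0 < n) (f : K[X])
    (hfn : f.natDegree = n) (k : ℕ) (μ : Fin n →₀ ℕ) :
    (gpoly hn f k μ).totalDegree ≤ n * k + μ.degree := by
  refine (MvPolynomial.totalDegree_mul _ _).trans (add_le_add ?_ ?_)
  · refine (MvPolynomial.totalDegree_pow _ _).trans ?_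
    rw [mul_comm]
    apply Nat.mul_le_mul_right
    rw [aeval_eq_sum_range]
    refine (MvPolynomial.totalDegree_finsetSum _ _).trans ?_
    apply Finset.sup_le
    intro i hi
    refine (MvPolynomial.totalDegree_smul_le _ _).trans ?_
    rw [MvPolynomial.totalDegree_X_pow]
    rw [Finset.mem_range] at hi
    omega
  · refine (MvPolynomial.totalDegree_monomial_le _ _).trans ?_
    rfl

theorem fixed_eval {K : Type} [Field K] {p : ℕ} [Fact p.Prime] [CharP K p] (f : K[X]) (e : ℕ)
    (hfc : ∀ i, f.coeff i ^ (p ^ e) = f.coeff i) (y : K) :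
    (aeval y f) ^ (p ^ e) = aeval (y ^ (p ^ e)) f := by
  rw [aeval_eq_sum_range, aeval_eq_sum_range, sum_pow_char_pow]
  apply Finset.sum_congr rfl
  intro i _
  rw [_root_.smul_pow, hfc, ← pow_mul, ← pow_mul, mul_comm]

theorem gpoly_fixed {K : Type} [Field K] {p : ℕ} [Fact p.Prime] [CharP K p] {n : ℕ} (hn : 0 < n)
    (f : K[X]) (e : ℕ) (hfc : ∀ i, f.coeff i ^ (p ^ e) = f.coeff i) (k : ℕ) (μ : Fin n →₀ ℕ)
    (y : Fin n → K) :
    (MvPolynomial.aeval y (gpoly hn f k μ)) ^ (p ^ e) =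
      MvPolynomial.aeval (fun i => y i ^ (p ^ e)) (gpoly hn f k μ) := by
  rw [gpoly_aeval, gpoly_aeval, mul_pow, ← fixed_eval f e hfc, ← pow_mul, ← pow_mul,
    mul_comm k]
  congr 1
  rw [Finsupp.prod, Finsupp.prod, ← Finset.prod_pow]
  apply Finset.prod_congr rfl
  intro i _
  rw [← pow_mul, ← pow_mul, mul_comm]

theorem arith_choice (A β P P' : ℕ) (hA : 0 < A) (hPP : P ≤ P') (hP : 2 * β + 4 ≤ P') :
    ∃ M N : ℕ, A * M + β < P' ∧
      (A * M + β) * P + (A * N + β) + 1 < (A * (M + 1)) * (A * (N + 1)) ∧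
      (A * M + β) + (A * N + β) * P' ≤ P * P' + (3 * β + 6) * P' := by
  set c := 2 * β + 5 with hc
  refine ⟨(P' - 1 - β) / A, (P + c) / A, ?_, ?_, ?_⟩
  · have := Nat.mul_div_le (P' - 1 - β) A
    omega
  · have h1 : P' - 1 - β < A * ((P' - 1 - β) / A + 1) := Nat.lt_mul_div_succ _ hA
    have h2 : P + c < A * ((P + c) / A + 1) := Nat.lt_mul_div_succ _ hA
    have h3 := Nat.mul_div_le (P + c) A
    set M := (P' - 1 - β) / A
    set N := (P + c) / A
    obtain ⟨R, hR⟩ : ∃ R, P' = R + (2 * β + 4) := ⟨P' - (2 * β + 4), by omega⟩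
    have h4 : R + β + 4 ≤ A * (M + 1) := by omega
    have h5 : P + c + 1 ≤ A * (N + 1) := by omega
    have h6 : A * (M + 1) * (P + c + 1) ≤ (A * (M + 1)) * (A * (N + 1)) :=
      Nat.mul_le_mul_left _ h5
    have h7 : (R + β + 4) * (c + 1) ≤ A * (M + 1) * (c + 1) := Nat.mul_le_mul_right _ h4
    have h8 : β * P ≤ β * (R + (2 * β + 4)) := Nat.mul_le_mul_left _ (by omega)
    have h9 : A * (M + 1) = A * M + A := by ring
    have h10 : A * (M + 1) * (P + c + 1) = A * M * P + A * P + A * (M + 1) * (c + 1) := by ring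
    have h11 : (A * M + β) * P = A * M * P + β * P := by ring
    have h12 : (R + β + 4) * (c + 1) = 2 * (β * R) + 2 * (β * β) + 8 * β + 6 * R + 6 * β + 24 := by
      rw [hc]; ring
    have h13 : β * (R + (2 * β + 4)) = β * R + 2 * (β * β) + 4 * β := by ring
    generalize β * R = u at *
    generalize β * β = v at *
    generalize A * M * P = w at *
    generalize A * P = w' at *
    omega
  · have h1 := Nat.mul_div_le (P' - 1 - β) A
    have h3 := Nat.mul_div_le (P + c) A
    set M := (P' - 1 - β) / A
    set N := (P + c) / A
    have h4 : (A * N + β) * P' ≤ (P + c + β) * P' := Nat.mul_le_mul_right _ (by omega)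
    have h5 : (P + c + β) * P' + P' = P * P' + (3 * β + 6) * P' := by rw [hc]; ring
    omega

theorem stepanov_bound {K L : Type} [Field K] [IsAlgClosed K] [Field L] [Algebra K L]
    {p : ℕ} [Fact p.Prime] [CharP K p]
    {n : ℕ} (hn : 0 < n) {f : K[X]} {x : Fin n → L} {t : L} (hx : GenFib f x t)
    {t0 : K} {z : Fin n → PowerSeries K} (hz : IsFib f z (PowerSeries.C t0 + PowerSeries.X))
    (B : ℕ) (μ : Fin n.factorial → (Fin n →₀ ℕ)) (hμ : ∀ j, (μ j).degree ≤ B)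
    (hind : LinearIndependent K (fun q : ℕ × Fin n.factorial =>
      t ^ q.1 * (μ q.2).prod (fun i e => x i ^ e)))
    (e e' : ℕ) (hee : e ≤ e') (hbig : 2 * ((n - 1).factorial * B) + 4 ≤ p ^ e')
    (hfc : ∀ i, f.coeff i ^ (p ^ (e' + e)) = f.coeff i)
    (σ : Equiv.Perm (Fin n)) (S : Finset (Fin n → K))
    (hS : ∀ y ∈ S, Function.Injective y ∧ (∃ t0, IsFib f y t0) ∧
      ∀ i, y i ^ (p ^ (e' + e)) = y (σ i)) :
    S.card ≤ p ^ (e' + e) + (3 * ((n - 1).factorial * B) + 6) * p ^ e' := by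
  have hpp : 0 < p := (Fact.out : p.Prime).pos
  have hfn := (fib_monic hn hz).2
  set D := (n - 1).factorial with hD
  have hfac : n.factorial = n * D := (Nat.mul_factorial_pred hn.ne').symm
  have hDpos : 0 < D := Nat.factorial_pos _
  obtain ⟨M, N, h1, h2, h3⟩ := arith_choice (n * D) (D * B) (p ^ e) (p ^ e') (by positivity)
    (Nat.pow_le_pow_right hpp hee) hbig
  have hli : ∀ M : ℕ, LinearIndependent K (fun q : Fin (M + 1) × Fin n.factorial =>
      MvPolynomial.aeval x (gpoly hn f q.1 (μ q.2))) := by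
    intro M
    have := hind.comp (fun q : Fin (M + 1) × Fin n.factorial => ((q.1 : ℕ), q.2)) (by
      intro a b h
      simp only [Prod.mk.injEq] at h
      exact Prod.ext (Fin.ext h.1) h.2)
    convert this using 2 with q
    rw [gpoly_aeval, fib_root hx.fib]
    rfl
  have hdeg : ∀ (M : ℕ) (q : Fin (M + 1) × Fin n.factorial),
      (gpoly hn f q.1 (μ q.2)).totalDegree ≤ n * M + B := by
    intro M q
    refine (gpoly_degree hn f hfn _ _).trans (add_le_add (Nat.mul_le_mul_left _ ?_) (hμ _))
    omega
  have h4 := stepanov (p := p) hn hx hz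
    (fun q : Fin (M + 1) × Fin n.factorial => gpoly hn f q.1 (μ q.2))
    (fun q : Fin (N + 1) × Fin n.factorial => gpoly hn f q.1 (μ q.2)) (n * M + B) (n * N + B) e e'
    (hdeg M) (hdeg N) (hli M) (hli N) (by
      rw [← hD]
      calc D * (n * M + B) = n * D * M + D * B := by ring
        _ < _ := h1)
    (by
      rw [← hD]
      simp only [Fintype.card_prod, Fintype.card_fin]
      rw [hfac]
      calc _ = (n * D * M + D * B) * p ^ e + (n * D * N + D * B) + 1 := by ring
        _ < _ := h2
        _ = _ := by ring)
    (fun y j => gpoly_fixed hn f _ hfc _ _ y) σ S hS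
  refine h4.trans ?_
  rw [← hD]
  calc _ = (n * D * M + D * B) + (n * D * N + D * B) * p ^ e' := by ring
    _ ≤ _ := h3
    _ = _ := by rw [pow_add]; ring

theorem exists_fib {K : Type} [Field K] [IsAlgClosed K] {n : ℕ} (hn : 0 < n) {f : K[X]}
    (hf : f.Monic) (hfn : f.natDegree = n) (t0 : K)
    (ht0 : ∀ a, f.derivative.eval a = 0 → f.eval a ≠ t0) :
    ∃ y : Fin n → K, Function.Injective y ∧ IsFib f y t0 := by
  classical
  obtain ⟨h1, h2⟩ := monic_sub_C hn hf hfn t0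
  have hsep : (f - C t0).Separable := by
    rw [separable_def, derivative_sub, derivative_C, sub_zero]
    apply IsCoprime.symm
    rw [← EuclideanDomain.gcd_isUnit_iff]
    by_contra hne
    have hg0 : EuclideanDomain.gcd (derivative f) (f - C t0) ≠ 0 := by
      intro h0
      exact h1.ne_zero (EuclideanDomain.gcd_eq_zero_iff.1 h0).2
    obtain ⟨a, ha⟩ := IsAlgClosed.exists_root (EuclideanDomain.gcd (derivative f) (f - C t0))
      (fun h => hne (isUnit_iff_degree_eq_zero.2 h))
    have h3 := (ha.dvd (EuclideanDomain.gcd_dvd_left (derivative f) (f - C t0)))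
    have h4 := (ha.dvd (EuclideanDomain.gcd_dvd_right (derivative f) (f - C t0)))
    rw [IsRoot, eval_sub, eval_C, sub_eq_zero] at h4
    exact ht0 a h3 h4
  have hcard : ((f - C t0).roots.toFinset).card = n := by
    rw [Multiset.toFinset_card_of_nodup (nodup_roots hsep), ← h2]
    exact (IsAlgClosed.splits (f - C t0)).natDegree_eq_card_roots.symm
  let eqv := ((f - C t0).roots.toFinset).equivFinOfCardEq hcard
  refine ⟨fun i => (eqv.symm i : K), fun i j h => eqv.symm.injective (Subtype.ext h), ?_⟩
  apply fib_of_roots hn hf hfn (fun i j h => eqv.symm.injective (Subtype.ext h))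
  intro i
  have := (eqv.symm i).2
  rw [Multiset.mem_toFinset, mem_roots h1.ne_zero, IsRoot, eval_sub, eval_C, sub_eq_zero] at this
  rw [coe_aeval_eq_eval]
  exact this

end CountPart

section ChebPart

theorem card_fixed {K : Type} [Field K] [IsAlgClosed K] {p : ℕ} [Fact p.Prime] [CharP K p]
    (e : ℕ) (he : 0 < e) : ∃ T : Finset K, T.card = p ^ e ∧ ∀ a, a ∈ T ↔ a ^ (p ^ e) = a := by
  classical
  have h1 : 1 < p ^ e := Nat.one_lt_pow he.ne' (Fact.out : p.Prime).one_lt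
  have hne := FiniteField.X_pow_card_sub_X_ne_zero K h1
  refine ⟨(X ^ (p ^ e) - X : K[X]).roots.toFinset, ?_, ?_⟩
  · have hsep : (X ^ (p ^ e) - X : K[X]).Separable := by
      apply galois_poly_separable p
      exact dvd_pow_self p he.ne'
    rw [Multiset.toFinset_card_of_nodup (nodup_roots hsep),
      ← (IsAlgClosed.splits _).natDegree_eq_card_roots,
      FiniteField.X_pow_card_sub_X_natDegree_eq K h1]
  · intro a
    rw [Multiset.mem_toFinset, mem_roots hne, IsRoot, eval_sub, eval_pow, eval_X, sub_eq_zero]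

theorem chebo_count {K L : Type} [Field K] [IsAlgClosed K] [Field L] [Algebra K L]
    {p : ℕ} [Fact p.Prime] [CharP K p]
    {n : ℕ} (hn : 0 < n) {f : K[X]} (hder : f.derivative ≠ 0)
    {x : Fin n → L} {t : L} (hx : GenFib f x t)
    (B : ℕ) (μ : Fin n.factorial → (Fin n →₀ ℕ)) (hμ : ∀ j, (μ j).degree ≤ B)
    (hind : LinearIndependent K (fun q : ℕ × Fin n.factorial =>
      t ^ q.1 * (μ q.2).prod (fun i e => x i ^ e)))
    (e e' : ℕ) (hee : e ≤ e') (hbig : 2 * ((n - 1).factorial * B) + 4 ≤ p ^ e')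
    (hbig2 : n.factorial * (n + (3 * ((n - 1).factorial * B) + 6)) < p ^ e)
    (hfc : ∀ i, f.coeff i ^ (p ^ (e' + e)) = f.coeff i) (σ : Equiv.Perm (Fin n)) :
    ∃ (y : Fin n → K) (t0 : K), Function.Injective y ∧ IsFib f y t0 ∧
      ∀ i, y i ^ (p ^ (e' + e)) = y (σ i) := by
  classical
  have hinf : Infinite K := IsAlgClosed.instInfinite
  have hpp : 0 < p := (Fact.out : p.Prime).pos
  by_contra hcon
  obtain ⟨hf, hfn⟩ := fib_monic hn hx.fib
  set Q := p ^ (e' + e) with hQ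
  set c := 3 * ((n - 1).factorial * B) + 6 with hc
  have hepos : 0 < e' + e := by
    rcases Nat.eq_zero_or_pos (e' + e) with h | h
    · have : e' = 0 := by omega
      rw [this] at hbig; simp at hbig
    · exact h
  let Crit : Finset K := f.derivative.roots.toFinset.image (fun a => f.eval a)
  have hCrit : ∀ t0, t0 ∉ Crit → ∃ y : Fin n → K, Function.Injective y ∧ IsFib f y t0 := by
    intro t0 ht0
    apply exists_fib hn hf hfn
    intro a ha hb
    apply ht0
    rw [Finset.mem_image]
    exact ⟨a, by rw [Multiset.mem_toFinset, mem_roots hder]; exact ha, hb⟩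
  have hCritc : Crit.card ≤ n := by
    refine Finset.card_image_le.trans ?_
    refine (Multiset.toFinset_card_le _).trans ?_
    refine (card_roots' _).trans ?_
    refine (natDegree_derivative_le f).trans ?_
    omega
  obtain ⟨t1, ht1⟩ := Infinite.exists_notMem_finset Crit
  obtain ⟨y1, hy1i, hy1⟩ := hCrit t1 ht1
  obtain ⟨z, hz, -⟩ := hensel_fib hn hy1 hy1i
  obtain ⟨T0, hT0c, hT0⟩ := card_fixed (K := K) (p := p) (e' + e) hepos
  set T := T0 \ Crit with hT
  have hTc : Q ≤ T.card + n := by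
    have hh := Finset.le_card_sdiff Crit T0
    have hh2 : T0.card - Crit.card ≤ T.card := hh
    rw [hT0c, ← hQ] at hh2
    clear_value Q T
    omega
  choose! yy hyi hyf using hCrit
  let φ : K × Equiv.Perm (Fin n) → (Fin n → K) := fun q => yy q.1 ∘ q.2
  let S := (T ×ˢ (Finset.univ : Finset (Equiv.Perm (Fin n)))).image φ
  have hTn : ∀ t0 ∈ T, t0 ∉ Crit := fun t0 h => (Finset.mem_sdiff.1 h).2
  have hScard : S.card = T.card * n.factorial := by
    rw [Finset.card_image_of_injOn, Finset.card_product, Finset.card_univ, Fintype.card_perm,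
      Fintype.card_fin]
    rintro ⟨a, τ⟩ ha ⟨b, τ'⟩ hb hab
    simp only [Finset.coe_product, Set.mem_prod, Finset.mem_coe] at ha hb
    have h1 : a = b := by
      have ha' := fib_root (fib_comp (hyf a (hTn a ha.1)) τ) ⟨0, hn⟩
      have hb' := fib_root (fib_comp (hyf b (hTn b hb.1)) τ') ⟨0, hn⟩
      have h2 := congrFun hab ⟨0, hn⟩
      simp only [φ] at h2
      rw [← ha', ← hb', h2]
    subst h1
    congr 1
    ext i
    have := congrFun hab i
    exact congrArg _ (hyi a (hTn a ha.1) this)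
  have hSp : ∀ y ∈ S, Function.Injective y ∧ (∃ t0, IsFib f y t0) ∧
      ∃ τ : Equiv.Perm (Fin n), ∀ i, y i ^ Q = y (τ i) := by
    intro y hy
    obtain ⟨⟨a, τ⟩, ha, rfl⟩ := Finset.mem_image.1 hy
    have haT := (Finset.mem_product.1 ha).1
    have h1 : Function.Injective (φ (a, τ)) := (hyi a (hTn a haT)).comp τ.injective
    have h2 : IsFib f (φ (a, τ)) a := fib_comp (hyf a (hTn a haT)) τ
    refine ⟨h1, ⟨a, h2⟩, ?_⟩
    set y := φ (a, τ)
    have haQ : a ^ Q = a := (hT0 a).1 (Finset.mem_sdiff.1 haT).1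
    have hex : ∀ i, ∃ j, y i ^ Q = y j := by
      intro i
      have h3 : aeval (y i ^ Q) f = a := by
        rw [hQ, ← fixed_eval f _ hfc, fib_root h2, ← hQ, haQ]
      have h4 := congrArg (eval (y i ^ Q)) h2
      rw [eval_prod, eval_sub, eval_C, eval_map_algebraMap, h3, sub_self,
        Finset.prod_eq_zero_iff] at h4
      obtain ⟨j, -, hj⟩ := h4
      refine ⟨j, ?_⟩
      simpa [sub_eq_zero] using hj
    choose s hs using hex
    have hsi : Function.Injective s := by
      intro i j hij
      apply h1
      have : y i ^ Q = y j ^ Q := by rw [hs, hs, hij]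
      have hinj := iterateFrobenius_inj K p (e' + e)
      apply hinj
      simpa [iterateFrobenius_def] using this
    exact ⟨Equiv.ofBijective s (Finite.injective_iff_bijective.1 hsi), hs⟩
  have hex : ∀ y, ∃ τ : Equiv.Perm (Fin n), y ∈ S → ∀ i, y i ^ Q = y (τ i) := by
    intro y
    by_cases hy : y ∈ S
    · obtain ⟨τ, hτ⟩ := (hSp y hy).2.2
      exact ⟨τ, fun _ => hτ⟩
    · exact ⟨1, fun h => absurd h hy⟩
  choose s hs using hex
  have hsum := Finset.card_eq_sum_card_fiberwise (f := s) (s := S) (t := Finset.univ)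
    (fun _ _ => Finset.mem_coe.2 (Finset.mem_univ _))
  have hb : ∀ τ, (S.filter (fun y => s y = τ)).card ≤ Q + c * p ^ e' := by
    intro τ
    apply stepanov_bound (p := p) hn hx hz B μ hμ hind e e' hee hbig hfc τ
    intro y hy
    obtain ⟨hyS, hyτ⟩ := Finset.mem_filter.1 hy
    refine ⟨(hSp y hyS).1, (hSp y hyS).2.1, ?_⟩
    rw [← hyτ]
    exact hs y hyS
  have hb0 : (S.filter (fun y => s y = σ)).card = 0 := by
    rw [Finset.card_eq_zero, Finset.filter_eq_empty_iff]
    intro y hyS hyσ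
    apply hcon
    obtain ⟨t0, ht0⟩ := (hSp y hyS).2.1
    exact ⟨y, t0, (hSp y hyS).1, ht0, by rw [← hyσ]; exact hs y hyS⟩
  have hle : T.card * n.factorial ≤ (n.factorial - 1) * (Q + c * p ^ e') := by
    rw [← hScard, hsum, ← Finset.add_sum_erase _ _ (Finset.mem_univ σ), hb0, zero_add]
    refine (Finset.sum_le_card_nsmul _ _ _ (fun τ _ => hb τ)).trans ?_
    rw [Finset.card_erase_of_mem (Finset.mem_univ _), Finset.card_univ, Fintype.card_perm,
      Fintype.card_fin, smul_eq_mul]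
  obtain ⟨N, hN⟩ : ∃ N, n.factorial = N + 1 :=
    Nat.exists_eq_succ_of_ne_zero (Nat.factorial_ne_zero n)
  rw [hN, Nat.add_sub_cancel] at hle
  rw [hN] at hbig2
  have hP' : 1 ≤ p ^ e' := Nat.one_le_pow _ _ hpp
  have hQ2 : Q = p ^ e' * p ^ e := by rw [hQ, pow_add]
  have h5 : (N + 1) * Q ≤ N * (Q + c * p ^ e') + (N + 1) * n := by
    calc (N + 1) * Q ≤ (N + 1) * (T.card + n) := Nat.mul_le_mul_left _ hTc
      _ = T.card * (N + 1) + (N + 1) * n := by ring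
      _ ≤ _ := by omega
  have h6 : Q ≤ N * c * p ^ e' + (N + 1) * n := by nlinarith
  have h7 : Q ≤ p ^ e' * ((N + 1) * (n + c)) := by
    refine h6.trans ?_
    nlinarith [Nat.mul_le_mul_left ((N + 1) * n) hP', Nat.zero_le (c * p ^ e')]
  rw [hQ2] at h7
  have := Nat.le_of_mul_le_mul_left h7 hP'
  omega

theorem chebo {K L : Type} [Field K] [IsAlgClosed K] [Field L] [Algebra K L]
    {p : ℕ} [Fact p.Prime] [CharP K p]
    {n : ℕ} (hn : 0 < n) {f : K[X]} (hder : f.derivative ≠ 0)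
    {x : Fin n → L} {t : L} (hx : GenFib f x t)
    (B : ℕ) (μ : Fin n.factorial → (Fin n →₀ ℕ)) (hμ : ∀ j, (μ j).degree ≤ B)
    (hind : LinearIndependent K (fun q : ℕ × Fin n.factorial =>
      t ^ q.1 * (μ q.2).prod (fun i e => x i ^ e)))
    (a : ℕ) (ha : 0 < a) (hfc : ∀ i, f.coeff i ^ (p ^ a) = f.coeff i) :
    ∃ d₀ : ℕ, 0 < d₀ ∧ ∀ d, d₀ < d → ∀ σ : Equiv.Perm (Fin n),
      ∃ (y : Fin n → K) (t0 : K), Function.Injective y ∧ IsFib f y t0 ∧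
        ∀ i, y i ^ ((p ^ a) ^ d) = y (σ i) := by
  set b1 := 2 * ((n - 1).factorial * B) + 4 with hb1
  set b2 := n.factorial * (n + (3 * ((n - 1).factorial * B) + 6)) with hb2
  refine ⟨2 * (b1 + b2) + 2, by omega, fun d hd σ => ?_⟩
  have had : d ≤ a * d := Nat.le_mul_of_pos_left d ha
  have hp2 := (Fact.out : p.Prime).one_lt
  have h1 : a * d / 2 < p ^ (a * d / 2) := Nat.lt_pow_self hp2
  have h2 : a * d - a * d / 2 < p ^ (a * d - a * d / 2) := Nat.lt_pow_self hp2
  have h3 : (a * d - a * d / 2) + a * d / 2 = a * d := by omega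
  have hfc' : ∀ i, f.coeff i ^ (p ^ (a * d)) = f.coeff i := by
    intro i
    rw [pow_mul]
    clear * - hfc
    induction d with
    | zero => simp
    | succ d ih => rw [pow_succ, pow_mul, ih, hfc]
  have := chebo_count (p := p) hn hder hx B μ hμ hind (a * d / 2) (a * d - a * d / 2) (by omega)
    (by omega) (by omega) (by rw [h3]; exact hfc') σ
  rw [h3, pow_mul] at this
  exact this

end ChebPart

section SpecPart

theorem prime_avoid_aux {K : Type} [Field K] {n : ℕ} {G : Type} [Fintype G] [Nonempty G]
    (I : Ideal (MvPolynomial (Fin n) K)) (w : G → Fin n → K)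
    (h : ∀ a ∈ I, ∏ g, MvPolynomial.aeval (w g) a = (0 : K)) :
    ∃ g, ∀ a ∈ I, MvPolynomial.aeval (w g) a = (0 : K) := by
  classical
  obtain ⟨g0⟩ := ‹Nonempty G›
  have h1 : (I : Set (MvPolynomial (Fin n) K)) ⊆
      ⋃ g ∈ ((Finset.univ : Finset G) : Set G),
        ((RingHom.ker (MvPolynomial.aeval (w g) : MvPolynomial (Fin n) K →ₐ[K] K)) :
          Set (MvPolynomial (Fin n) K)) := by
    intro a ha
    have h2 := h a ha
    rw [Finset.prod_eq_zero_iff] at h2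
    obtain ⟨g, hg, hga⟩ := h2
    simp only [Set.mem_iUnion]
    exact ⟨g, by simp, hga⟩
  rw [Ideal.subset_union_prime g0 g0 (fun i _ _ _ => RingHom.ker_isPrime _)] at h1
  obtain ⟨g, -, hg⟩ := h1
  exact ⟨g, fun a ha => hg ha⟩

theorem exists_spec {K L : Type} [Field K] [Field L] [Algebra K L] {n : ℕ} (hn : 0 < n)
    {f : K[X]} {x : Fin n → L} {t : L} (hfib : IsFib f x t) (ht : Transcendental K t)
    {y : Fin n → K} {t0 : K} (hy : IsFib f y t0) :
    ∃ τ : Equiv.Perm (Fin n), ∀ h : MvPolynomial (Fin n) K, MvPolynomial.aeval x h = (0 : L) →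
      MvPolynomial.aeval (y ∘ τ) h = (0 : K) := by
  classical
  refine prime_avoid_aux (RingHom.ker (MvPolynomial.aeval x : MvPolynomial (Fin n) K →ₐ[K] L))
    (fun τ : Equiv.Perm (Fin n) => y ∘ τ) ?_
  intro h hh
  obtain ⟨G, -, hG⟩ := norm_lemma hn f h _ le_rfl
  have h1 := hG L x t hfib
  rw [Finset.prod_eq_zero (Finset.mem_univ (1 : Equiv.Perm (Fin n))) (by simpa using hh)] at h1
  have h2 : G = 0 := by
    by_contra h3
    exact ht ⟨G, h3, h1.symm⟩
  rw [hG K y t0 hy, h2, map_zero]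

theorem spec_trans {K L : Type} [Field K] [Field L] [Algebra K L] {n : ℕ} (hn : 0 < n)
    {f : K[X]} {x : Fin n → L} {t : L} (hfib : IsFib f x t)
    {G : Type} [Fintype G] (s : G → Equiv.Perm (Fin n)) (g1 : G) (hg1 : s g1 = 1)
    (hN : ∀ h : MvPolynomial (Fin n) K, ∃ Γ : K[X],
      ∏ g, MvPolynomial.aeval (x ∘ s g) h = aeval t Γ)
    {y y' : Fin n → K} {t0 : K} (hy : IsFib f y t0) (hy' : IsFib f y' t0)
    (hys : ∀ h : MvPolynomial (Fin n) K, MvPolynomial.aeval x h = (0 : L) → MvPolynomial.aeval y h = (0 : K))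
    (hys' : ∀ h : MvPolynomial (Fin n) K, MvPolynomial.aeval x h = (0 : L) → MvPolynomial.aeval y' h = (0 : K)) :
    ∃ g, ∀ i, y' i = y (s g i) := by
  classical
  have hne : Nonempty G := ⟨g1⟩
  have key := prime_avoid_aux
    (RingHom.ker (MvPolynomial.aeval y' : MvPolynomial (Fin n) K →ₐ[K] K))
    (fun g : G => y ∘ s g) ?_
  · obtain ⟨g, hg⟩ := key
    refine ⟨g, fun i => ?_⟩
    have := hg (MvPolynomial.X i - MvPolynomial.C (y' i)) (by simp [RingHom.mem_ker])
    simp [sub_eq_zero] at this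
    exact this.symm
  · intro h hh
    obtain ⟨Γ, hΓ⟩ := hN h
    let P : MvPolynomial (Fin n) K := ∏ g, MvPolynomial.rename (s g) h -
      aeval (aeval (MvPolynomial.X ⟨0, hn⟩ : MvPolynomial (Fin n) K) f) Γ
    have hP : ∀ (A : Type) [CommRing A] [Algebra K A] (w : Fin n → A) (u : A), IsFib f w u →
        MvPolynomial.aeval w P = ∏ g, MvPolynomial.aeval (w ∘ s g) h - aeval u Γ := by
      intro A _ _ w u hw
      simp only [P, map_sub, map_prod, MvPolynomial.aeval_rename]
      rw [← aeval_algHom_apply, ← aeval_algHom_apply, MvPolynomial.aeval_X, fib_root hw]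
    have h0 : MvPolynomial.aeval x P = 0 := by rw [hP L x t hfib, hΓ, sub_self]
    have h1 := hys P h0
    have h2 := hys' P h0
    rw [hP K y t0 hy] at h1
    rw [hP K y' t0 hy', Finset.prod_eq_zero (Finset.mem_univ g1)
      (by rw [hg1]; simpa using hh), zero_sub, neg_eq_zero] at h2
    rw [h2, sub_zero] at h1
    exact h1

theorem spec_frob {K L : Type} [Field K] [Field L] [Algebra K L] {n : ℕ} (hn : 0 < n)
    {f : K[X]} {x : Fin n → L} {t : L} (hfib : IsFib f x t) (ht : Transcendental K t)
    {G : Type} [Fintype G] (s : G → Equiv.Perm (Fin n)) (g1 : G) (hg1 : s g1 = 1)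
    (hN : ∀ h : MvPolynomial (Fin n) K, ∃ Γ : K[X],
      ∏ g, MvPolynomial.aeval (x ∘ s g) h = aeval t Γ)
    (φ : K →+* K) (hφ : Function.Surjective φ) (hfφ : f.map φ = f)
    (ψ : L →+* L) (hψ : ∀ c, ψ (algebraMap K L c) = algebraMap K L (φ c))
    (r : Equiv.Perm (Fin n)) (hr : ∀ i, ψ (x i) = x (r i))
    {y0 : Fin n → K} {t0 : K} (hy0 : IsFib f y0 t0) (ht0 : φ t0 = t0) :
    ∃ (y : Fin n → K) (g : G), IsFib f y t0 ∧ ∀ j, φ (y j) = y ((r * (s g)⁻¹) j) := by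
  obtain ⟨τ, hτ⟩ := exists_spec hn hfib ht hy0
  have hy : IsFib f (y0 ∘ τ) t0 := fib_comp hy0 τ
  set y := y0 ∘ τ
  choose y' hy' using fun i => hφ (y (r i))
  have hfib' : IsFib f y' t0 := by
    have h1 : Function.Injective (Polynomial.map φ) := map_injective φ φ.injective
    apply h1
    have h2 := fib_comp hy r
    rw [IsFib] at h2
    rw [Algebra.algebraMap_self, Polynomial.map_id] at h2 ⊢
    rw [Polynomial.map_prod, Polynomial.map_sub, hfφ, map_C, ht0, ← h2]
    refine Finset.prod_congr rfl fun i _ => ?_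
    simp [hy']
  have hs' : ∀ h : MvPolynomial (Fin n) K, MvPolynomial.aeval x h = (0 : L) → MvPolynomial.aeval y' h = (0 : K) := by
    intro h hh
    apply φ.injective
    have h3 : MvPolynomial.aeval (x ∘ r) (MvPolynomial.map φ h) = 0 := by
      have h4 := congrArg ψ hh
      rw [map_zero, MvPolynomial.aeval_def, MvPolynomial.hom_eval₂] at h4
      rw [MvPolynomial.aeval_def, MvPolynomial.eval₂_map, ← h4]
      congr 1
      · ext c; simp [hψ]
      · ext i; simp [hr]
    rw [← MvPolynomial.aeval_rename] at h3
    have h5 := hτ _ h3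
    rw [MvPolynomial.aeval_rename, MvPolynomial.aeval_def, MvPolynomial.eval₂_map] at h5
    rw [map_zero, MvPolynomial.aeval_def, MvPolynomial.hom_eval₂, ← h5]
    congr 1
    ext i; simp [hy', y]
  obtain ⟨g, hg⟩ := spec_trans hn hfib s g1 hg1 hN hy hfib' hτ hs'
  refine ⟨y, g, hy, fun j => ?_⟩
  have := hg ((s g)⁻¹ j)
  rw [show s g ((s g)⁻¹ j) = j by simp] at this
  rw [← this, hy', Equiv.Perm.mul_apply]

end SpecPart

section CycPart

theorem frob_pow_iff {k K : Type} [Field k] [Fintype k] [Field K] [Algebra k K] {g : k[X]}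
    (hg : Irreducible g) {z : K} (hz : aeval z g = 0) (m : ℕ) :
    z ^ (Fintype.card k ^ m) = z ↔ g.natDegree ∣ m := by
  rw [hg.natDegree_dvd_iff_dvd_X_pow_card_pow_sub_X, Nat.card_eq_fintype_card]
  have h1 : (minpoly k z) ∣ X ^ Fintype.card k ^ m - X ↔ g ∣ X ^ Fintype.card k ^ m - X := by
    rw [← minpoly.eq_of_irreducible hg hz]
    have h0 : IsUnit (C (g.leadingCoeff)⁻¹) := by
      rw [isUnit_C]; exact (inv_ne_zero (leadingCoeff_ne_zero.2 hg.ne_zero)).isUnit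
    exact h0.mul_right_dvd
  rw [← h1, minpoly.dvd_iff]
  simp [sub_eq_zero]

theorem iter_pow {K : Type} [Field K] {n : ℕ} {y : Fin n → K} {q : ℕ} {ρ : Fin n → Fin n}
    (hρ : ∀ j, y j ^ q = y (ρ j)) (i : Fin n) (m : ℕ) : y (ρ^[m] i) = y i ^ (q ^ m) := by
  induction m with
  | zero => simp
  | succ m ih => rw [Function.iterate_succ_apply', ← hρ, ih, ← pow_mul, pow_succ]

theorem period_eq {k K : Type} [Field k] [Fintype k] [Field K] [Algebra k K] {n : ℕ}
    {y : Fin n → K} {ρ : Fin n → Fin n}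
    (hρ : ∀ j, y j ^ (Fintype.card k) = y (ρ j)) (i : Fin n) (hi : ∀ j, y j = y i → j = i)
    {g : k[X]} (hg : Irreducible g) (hz : aeval (y i) g = 0) :
    Function.minimalPeriod ρ i = g.natDegree := by
  have key : ∀ m, Function.minimalPeriod ρ i ∣ m ↔ g.natDegree ∣ m := by
    intro m
    rw [← Function.isPeriodicPt_iff_minimalPeriod_dvd, ← frob_pow_iff hg hz, ← iter_pow hρ]
    exact ⟨fun h => by rw [h], fun h => hi _ h⟩
  exact Nat.dvd_antisymm ((key _).2 dvd_rfl) ((key _).1 dvd_rfl)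

theorem exists_period {k K : Type} [Field k] [Fintype k] [Field K] [IsAlgClosed K] [Algebra k K]
    {n : ℕ} (hn : 0 < n) {f : k[X]} {t0 : k} {y : Fin n → K}
    (hy : IsFib (f.map (algebraMap k K)) y (algebraMap k K t0)) {ρ : Fin n → Fin n}
    (hρ : ∀ j, y j ^ (Fintype.card k) = y (ρ j)) {g : k[X]} (hg : Irreducible g)
    (hgd : g ∣ f - C t0) (hgn : n < 2 * g.natDegree) :
    ∃ i, Function.minimalPeriod ρ i = g.natDegree := by
  have hy2 : ∏ i, (X - C (y i)) = (f - C t0).map (algebraMap k K) := by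
    have := hy
    rw [IsFib, Algebra.algebraMap_self, Polynomial.map_id] at this
    rw [this]; simp
  have hdeg : (f - C t0).natDegree = n := by
    rw [← natDegree_map (algebraMap k K), ← hy2, natDegree_finsetProd_X_sub_C_eq_card]; simp
  have hne : f - C t0 ≠ 0 := by
    intro h; rw [h] at hdeg; simp at hdeg; omega
  obtain ⟨u, hu⟩ := hgd
  obtain ⟨z, hz⟩ := IsAlgClosed.exists_aeval_eq_zero K g
    (by rw [degree_eq_natDegree hg.ne_zero]; exact_mod_cast (by omega : g.natDegree ≠ 0))
  have hzr : aeval z (f - C t0) = 0 := by rw [hu, map_mul, hz, zero_mul]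
  obtain ⟨i, rfl⟩ : ∃ i, y i = z := by
    have h1 := congrArg (eval z) hy2
    rw [eval_map_algebraMap, hzr, eval_prod, Finset.prod_eq_zero_iff] at h1
    obtain ⟨i, -, hi⟩ := h1
    exact ⟨i, by simpa [sub_eq_zero, eq_comm] using hi⟩
  refine ⟨i, period_eq hρ i ?_ hg hz⟩
  intro j hj
  by_contra hji
  have hd : aeval (y i) (derivative (f - C t0)) = 0 := by
    have h2 : (X - C (y i)) ^ 2 ∣ (f - C t0).map (algebraMap k K) := by
      rw [← hy2, ← Finset.mul_prod_erase _ _ (Finset.mem_univ i),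
        ← Finset.mul_prod_erase _ _ (Finset.mem_erase.2 ⟨hji, Finset.mem_univ j⟩), hj,
        ← mul_assoc, ← sq]
      exact dvd_mul_right _ _
    obtain ⟨v, hv⟩ := h2
    have h3 := congrArg derivative hv
    rw [derivative_map] at h3
    have h4 := congrArg (eval (y i)) h3
    rw [eval_map_algebraMap] at h4
    rw [h4]; simp [derivative_pow]
  have hsep : aeval (y i) (derivative g) ≠ 0 :=
    (PerfectField.separable_of_irreducible hg).aeval_derivative_ne_zero hz
  rw [hu, derivative_mul, map_add, map_mul, map_mul, hz, zero_mul, add_zero, mul_eq_zero] at hd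
  have h5 := hd.resolve_left hsep
  have h6 : g ∣ u := by
    have h0 : IsUnit (C (g.leadingCoeff)⁻¹) := by
      rw [isUnit_C]; exact (inv_ne_zero (leadingCoeff_ne_zero.2 hg.ne_zero)).isUnit
    have := minpoly.dvd _ _ h5
    rw [← minpoly.eq_of_irreducible hg hz] at this
    exact (h0.mul_right_dvd).1 this
  have hu0 : u ≠ 0 := by rintro rfl; rw [mul_zero] at hu; exact hne hu
  have h7 := natDegree_le_of_dvd h6 hu0
  rw [hu, natDegree_mul hg.ne_zero hu0] at hdeg
  omega

end CycPart

section GalPart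

theorem norm_gal {K E L : Type} [Field K] [Field E] [Field L] [Algebra K[X] E]
    [IsFractionRing K[X] E] [Algebra K E] [IsScalarTower K K[X] E] [Algebra E L] [Algebra K L]
    [IsScalarTower K E L] [FiniteDimensional E L] [IsGalois E L]
    {n : ℕ} (hn : 0 < n) {f : K[X]} {x : Fin n → L}
    (hfib : IsFib f x (algebraMap E L (algebraMap K[X] E X)))
    (s : (L ≃ₐ[E] L) → Equiv.Perm (Fin n)) (hs : ∀ g i, g (x i) = x (s g i))
    (h : MvPolynomial (Fin n) K) :
    ∃ Γ : K[X], ∏ g, MvPolynomial.aeval (x ∘ s g) h =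
      aeval (algebraMap E L (algebraMap K[X] E X)) Γ := by
  classical
  obtain ⟨hf, hfn⟩ := fib_monic hn hfib
  let _ : Algebra K[X] L := ((algebraMap E L).comp (algebraMap K[X] E)).toAlgebra
  have _ : IsScalarTower K[X] E L := IsScalarTower.of_algebraMap_eq fun _ => rfl
  have hC : ∀ c : K, algebraMap K[X] L (C c) = algebraMap K L c := by
    intro c
    rw [IsScalarTower.algebraMap_apply K E L, IsScalarTower.algebraMap_apply K K[X] E]
    rfl
  have hxi : ∀ i, IsIntegral K[X] (x i) := by
    intro i
    refine ⟨f.map C - C X, (monic_sub_C hn (hf.map C) (by rw [hf.natDegree_map, hfn]) X).1, ?_⟩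
    rw [eval₂_sub, eval₂_C, eval₂_map]
    have h1 : ((algebraMap K[X] L).comp C) = algebraMap K L := RingHom.ext hC
    rw [h1, ← aeval_def, fib_root hfib i]
    exact sub_self _
  have hIntegral : ∀ h : MvPolynomial (Fin n) K, IsIntegral K[X] (MvPolynomial.aeval x h) := by
    intro h
    induction h using MvPolynomial.induction_on with
    | C a => rw [MvPolynomial.algHom_C, ← hC]; exact isIntegral_algebraMap
    | add p q hp hq => rw [map_add]; exact hp.add hq
    | mul_X p i hp => rw [map_mul, MvPolynomial.aeval_X]; exact hp.mul (hxi i)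
  have h2 := Algebra.isIntegral_norm E (hIntegral h)
  obtain ⟨Γ, hΓ⟩ := IsIntegrallyClosed.isIntegral_iff.1 h2
  refine ⟨Γ, ?_⟩
  have h3 : ∏ g, MvPolynomial.aeval (x ∘ s g) h = ∏ g : L ≃ₐ[E] L, g (MvPolynomial.aeval x h) := by
    refine Finset.prod_congr rfl fun g _ => ?_
    have h4 := MvPolynomial.comp_aeval_apply (f := x)
      ((AlgEquiv.restrictScalars K g : L ≃ₐ[K] L) : L →ₐ[K] L) h
    have h5 : (fun i => ((AlgEquiv.restrictScalars K g : L ≃ₐ[K] L) : L →ₐ[K] L) (x i)) =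
      x ∘ s g := funext fun i => hs g i
    rw [h5] at h4
    rw [← h4]; rfl
  rw [h3, ← Algebra.norm_eq_prod_automorphisms, ← hΓ]
  have h6 : ((algebraMap E L).comp (algebraMap K[X] E)) =
      ((aeval (algebraMap E L (algebraMap K[X] E X)) : K[X] →ₐ[K] L) : K[X] →+* L) := by
    apply Polynomial.ringHom_ext
    · intro c; exact (hC c).trans (aeval_C _ _).symm
    · simp
  exact congrArg (fun φ : K[X] →+* L => φ Γ) h6

/-- the permutation group induced by the Galois group on the indices. -/
def galSub {E L : Type} [Field E] [Field L] [Algebra E L] {n : ℕ} (x : Fin n → L) :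
    Subgroup (Equiv.Perm (Fin n)) where
  carrier := {σ | ∃ g : L ≃ₐ[E] L, ∀ i, g (x i) = x (σ i)}
  mul_mem' := by
    rintro a b ⟨g, hg⟩ ⟨h, hh⟩
    exact ⟨g * h, fun i => by rw [AlgEquiv.mul_apply, hh, hg]; rfl⟩
  one_mem' := ⟨1, fun i => rfl⟩
  inv_mem' := by
    rintro a ⟨g, hg⟩
    refine ⟨g⁻¹, fun i => ?_⟩
    have h1 := hg (a⁻¹ i)
    rw [show a (a⁻¹ i) = i by simp] at h1
    rw [← h1]
    exact g.symm_apply_apply _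

theorem galSub_normalizer {E L : Type} [Field E] [Field L] [Algebra E L] {n : ℕ} (x : Fin n → L)
    (φ : E ≃+* E) (ψ : L ≃+* L) (hψ : ∀ c, ψ (algebraMap E L c) = algebraMap E L (φ c))
    (r : Equiv.Perm (Fin n)) (hr : ∀ i, ψ (x i) = x (r i)) :
    r ∈ Subgroup.normalizer (galSub (E := E) x : Set (Equiv.Perm (Fin n))) := by
  have hψ' : ∀ c, ψ.symm (algebraMap E L c) = algebraMap E L (φ.symm c) := by
    intro c
    rw [RingEquiv.symm_apply_eq, hψ, RingEquiv.apply_symm_apply]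
  have hr' : ∀ i, ψ.symm (x i) = x (r⁻¹ i) := by
    intro i
    rw [RingEquiv.symm_apply_eq, hr]
    simp
  rw [Subgroup.mem_normalizer_iff]
  intro σ
  constructor
  · rintro ⟨g, hg⟩
    refine ⟨AlgEquiv.ofRingEquiv (f := (ψ.symm.trans g.toRingEquiv).trans ψ) ?_, ?_⟩
    · intro c
      change ψ (g (ψ.symm _)) = _
      rw [hψ', AlgEquiv.commutes, hψ, RingEquiv.apply_symm_apply]
    · intro i
      change ψ (g (ψ.symm _)) = _
      rw [hr', hg, hr]
      rfl
  · rintro ⟨g, hg⟩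
    refine ⟨AlgEquiv.ofRingEquiv (f := (ψ.trans g.toRingEquiv).trans ψ.symm) ?_, ?_⟩
    · intro c
      change ψ.symm (g (ψ _)) = _
      rw [hψ, AlgEquiv.commutes, hψ', RingEquiv.symm_apply_apply]
    · intro i
      change ψ.symm (g (ψ _)) = _
      rw [hr, hg, hr']
      simp

theorem exists_perm {L : Type} [Field L] {n : ℕ} {x : Fin n → L} (hx : Function.Injective x)
    (g : L →+* L) (h : ∀ i, ∃ j, g (x i) = x j) :
    ∃ r : Equiv.Perm (Fin n), ∀ i, g (x i) = x (r i) := by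
  choose s hs using h
  have hsi : Function.Injective s := by
    intro i j hij
    apply hx
    apply g.injective
    rw [hs, hs, hij]
  exact ⟨Equiv.ofBijective s (Finite.injective_iff_bijective.1 hsi), hs⟩

end GalPart

section IndPart

theorem linInd_pow_of_transc {K E : Type} [Field K] [Field E] [Algebra K E] {t : E}
    (ht : Transcendental K t) : LinearIndependent K (fun k : ℕ => t ^ k) := by
  have h1 := (Polynomial.basisMonomials K).linearIndependent.map'
    (aeval t : K[X] →ₐ[K] E).toLinearMap
    (LinearMap.ker_eq_bot.2 (transcendental_iff_injective.1 ht))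
  have h2 : (⇑(aeval t : K[X] →ₐ[K] E).toLinearMap ∘ ⇑(basisMonomials K)) =
      (fun k : ℕ => t ^ k) := by
    funext k
    simp
  rw [h2] at h1
  exact h1

theorem exists_monomials {K E L : Type} [Field K] [Field E] [Field L]
    [Algebra K E] [Algebra E L] [Algebra K L]
    [IsScalarTower K E L] [FiniteDimensional E L]
    {n : ℕ} {x : Fin n → L} (hx : Function.Injective x) {t : E} (ht : Transcendental K t)
    (hadj : Algebra.adjoin E (Set.range x) = ⊤) (hH : galSub (E := E) x = ⊤) :
    ∃ (B : ℕ) (μ : Fin n.factorial → (Fin n →₀ ℕ)), (∀ j, (μ j).degree ≤ B) ∧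
      LinearIndependent K (fun q : ℕ × Fin n.factorial =>
        algebraMap E L t ^ q.1 * (μ q.2).prod (fun i e => x i ^ e)) := by
  classical
  have hcard : n.factorial ≤ Module.finrank E L := by
    have h1 : ∀ σ : Equiv.Perm (Fin n), ∃ g : L ≃ₐ[E] L, ∀ i, g (x i) = x (σ i) := by
      intro σ
      have : σ ∈ galSub (E := E) x := by rw [hH]; trivial
      exact this
    choose G hG using h1
    have hGi : Function.Injective G := by
      intro σ τ h
      ext i
      have := hG σ i
      rw [h, hG τ i] at this
      exact congrArg _ (hx this).symm
    have h2 := Fintype.card_le_of_injective G hGi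
    rw [Fintype.card_perm, Fintype.card_fin] at h2
    exact h2.trans AlgEquiv.card_le
  let v : (Fin n →₀ ℕ) → L := fun m => m.prod (fun i e => x i ^ e)
  have hspan : Submodule.span E (Set.range v) = ⊤ := by
    have h1 := (MvPolynomial.basisMonomials (Fin n) E).span_eq
    have h2 := congrArg (Submodule.map (MvPolynomial.aeval x :
      MvPolynomial (Fin n) E →ₐ[E] L).toLinearMap) h1
    rw [Submodule.map_span, Submodule.map_top, ← Set.range_comp] at h2
    have h3 : ((MvPolynomial.aeval x : MvPolynomial (Fin n) E →ₐ[E] L).toLinearMap ∘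
        (MvPolynomial.basisMonomials (Fin n) E)) = v := by
      funext m
      simp [v, MvPolynomial.aeval_monomial]
    rw [h3] at h2
    rw [h2, LinearMap.range_eq_top]
    rw [Algebra.adjoin_range_eq_range_aeval] at hadj
    exact AlgHom.range_eq_top _ |>.1 hadj
  obtain ⟨κ, a, ha, hsp, hli⟩ := exists_linearIndependent' E v
  rw [hspan] at hsp
  let b := Module.Basis.mk hli hsp.ge
  have hfin : Finite κ := Module.Finite.finite_basis b
  let _ : Fintype κ := Fintype.ofFinite κ
  rw [Module.finrank_eq_card_basis b, ← Fintype.card_fin n.factorial] at hcard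
  obtain ⟨emb⟩ := Function.Embedding.nonempty_of_card_le hcard
  refine ⟨∑ j, (a (emb j)).degree, fun j => a (emb j), fun j => ?_, ?_⟩
  · exact Finset.single_le_sum (f := fun j => (a (emb j)).degree) (fun _ _ => Nat.zero_le _)
      (Finset.mem_univ j)
  · have h4 := linearIndependent_smul (linInd_pow_of_transc ht) (hli.comp emb emb.injective)
    have h5 : (fun q : ℕ × Fin n.factorial =>
        algebraMap E L t ^ q.1 * (a (emb q.2)).prod (fun i e => x i ^ e)) =
        (fun q : ℕ × Fin n.factorial => t ^ q.1 • ((v ∘ a) ∘ emb) q.2) := by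
      funext q
      rw [Algebra.smul_def, map_pow]
      rfl
    rw [h5]
    exact h4

theorem gen_of_top {K E L : Type} [Field K] [Field E] [Field L]
    [Algebra K E] [Algebra E L] [Algebra K L] [IsScalarTower K E L]
    {n : ℕ} {x : Fin n → L} {f : K[X]} {t : E} (ht : Transcendental K t)
    (hfib : IsFib f x (algebraMap E L t)) (hH : galSub (E := E) x = ⊤) :
    GenFib f x (algebraMap E L t) := by
  refine ⟨hfib, ?_, ?_⟩
  · rwa [transcendental_algebraMap_iff (algebraMap E L).injective]
  · intro h σ hh
    have : σ ∈ galSub (E := E) x := by rw [hH]; trivial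
    obtain ⟨g, hg⟩ := this
    have h4 := MvPolynomial.comp_aeval_apply (f := x)
      ((AlgEquiv.restrictScalars K g : L ≃ₐ[K] L) : L →ₐ[K] L) h
    have h5 : (fun i => ((AlgEquiv.restrictScalars K g : L ≃ₐ[K] L) : L →ₐ[K] L) (x i)) =
      x ∘ σ := funext fun i => hg i
    rw [h5] at h4
    rw [← h4, hh, map_zero]

end IndPart

section TopPart

theorem exists_fib_mult {K : Type} [Field K] [IsAlgClosed K] {n : ℕ} (hn : 0 < n) {f : K[X]}
    (hf : f.Monic) (hfn : f.natDegree = n) (t0 : K) : ∃ y : Fin n → K, IsFib f y t0 := by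
  obtain ⟨h1, h2⟩ := monic_sub_C hn hf hfn t0
  have hs := IsAlgClosed.splits (f - C t0)
  have h3 := hs.eq_prod_roots_of_monic h1
  have h4 := hs.natDegree_eq_card_roots
  rw [h2] at h4
  obtain ⟨l, hl⟩ := Quot.exists_rep (f - C t0).roots
  have hl' : (l : Multiset K) = (f - C t0).roots := hl
  rw [← hl'] at h3 h4
  rw [Multiset.coe_card] at h4
  subst h4
  refine ⟨fun i => l[i], ?_⟩
  rw [IsFib, Algebra.algebraMap_self, Polynomial.map_id, h3, Multiset.map_coe, Multiset.prod_coe]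
  exact Fin.prod_univ_fun_getElem l (fun a => X - C a)

theorem lift_hom {E L M : Type} [Field E] [Field L] [Field M] [Algebra E L] (P : E[X])
    [IsSplittingField E L P] (j : E →+* M) (h : (P.map j).Splits) :
    ∃ ψ : L →+* M, ∀ c, ψ (algebraMap E L c) = j c := by
  let _ : Algebra E M := j.toAlgebra
  exact ⟨(IsSplittingField.lift L P h : L →ₐ[E] M), fun c => AlgHom.commutes _ c⟩

theorem gal_top {k K E L : Type} [Field k] [Fintype k] [Field K] [IsAlgClosed K] [Algebra k K]
    [Field E] [Field L] [Algebra K[X] E]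
    [IsFractionRing K[X] E] [Algebra K E] [IsScalarTower K K[X] E] [Algebra E L] [Algebra K L]
    [IsScalarTower K E L] [FiniteDimensional E L] [IsGalois E L]
    {n : ℕ} (hn : 8 ≤ n) {f : k[X]} (hf : f.Monic) (hfn : f.natDegree = n)
    {x : Fin n → L} (hxi : Function.Injective x)
    (hfib : IsFib (f.map (algebraMap k K)) x (algebraMap E L (algebraMap K[X] E X)))
    (ht : Transcendental K (algebraMap K[X] E X))
    (φ : E ≃+* E) (hφ : ∀ c : K, φ (algebraMap K E c) = algebraMap K E (c ^ Fintype.card k))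
    (hφX : φ (algebraMap K[X] E X) = algebraMap K[X] E X)
    (ψ : L ≃+* L) (hψ : ∀ c, ψ (algebraMap E L c) = algebraMap E L (φ c))
    (hu : ∀ ℓ, 0 < ℓ → ℓ ≤ n → ∃ t0 : k, ∃ g : k[X], Irreducible g ∧ g.natDegree = ℓ ∧
      g ∣ f - C t0) : galSub (E := E) x = ⊤ := by
  classical
  have hn0 : 0 < n := by omega
  set fK := f.map (algebraMap k K) with hfK
  set t := algebraMap E L (algebraMap K[X] E X) with htdef
  have hmem : ∀ z : L, aeval z fK = t → ∃ j, z = x j := by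
    intro z hz
    have h4 := congrArg (eval z) hfib
    rw [eval_prod, eval_sub, eval_C, eval_map_algebraMap, hz, sub_self,
      Finset.prod_eq_zero_iff] at h4
    obtain ⟨j, -, hj⟩ := h4
    exact ⟨j, by simpa [sub_eq_zero] using hj⟩
  have hs : ∀ g : L ≃ₐ[E] L, ∃ s : Equiv.Perm (Fin n), ∀ i, g (x i) = x (s i) := by
    intro g
    refine exists_perm hxi (g : L →+* L) fun i => hmem _ ?_
    have h1 := aeval_algHom_apply ((AlgEquiv.restrictScalars K g : L ≃ₐ[K] L) : L →ₐ[K] L)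
      (x i) fK
    rw [fib_root hfib i] at h1
    refine h1.trans ?_
    exact g.commutes _
  choose s hs using hs
  have hs1 : s 1 = 1 := by
    ext i
    exact congrArg _ (hxi (hs 1 i)).symm
  let φK : K →+* K := (FiniteField.frobeniusAlgHom k K : K →ₐ[k] K)
  have hφK : ∀ c, φK c = c ^ Fintype.card k := fun c => rfl
  have hφKs : Function.Surjective φK := by
    intro c
    obtain ⟨z, hz⟩ := IsAlgClosed.exists_pow_nat_eq c (Fintype.card_pos (α := k))
    exact ⟨z, by rw [hφK, hz]⟩
  have hfφ : fK.map φK = fK := by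
    rw [hfK, Polynomial.map_map]
    congr 1
    exact AlgHom.comp_algebraMap _
  have hψK : ∀ c, ψ (algebraMap K L c) = algebraMap K L (φK c) := by
    intro c
    rw [IsScalarTower.algebraMap_apply K E L, hψ, hφ, hφK,
      ← IsScalarTower.algebraMap_apply K E L]
  obtain ⟨r, hr⟩ : ∃ r : Equiv.Perm (Fin n), ∀ i, ψ (x i) = x (r i) := by
    refine exists_perm hxi (ψ : L →+* L) fun i => hmem _ ?_
    have h1 := congrArg ψ (fib_root hfib i)
    rw [htdef, hψ, hφX, ← htdef] at h1
    rw [← h1]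
    have h2 := hom_eval₂ fK (algebraMap K L) (ψ : L →+* L) (x i)
    have h3 : ((ψ : L →+* L).comp (algebraMap K L)) = (algebraMap K L).comp φK :=
      RingHom.ext hψK
    rw [h3, ← eval₂_map, hfφ] at h2
    exact h2.symm
  refine group_core n hn _ r (galSub_normalizer x φ ψ hψ r hr) ?_ (exists_prime_for_jordan n hn)
  intro ℓ hℓ1 hℓ2
  obtain ⟨t0, g, hg, hgn, hgd⟩ := hu ℓ (by omega) hℓ2
  obtain ⟨y0, hy0⟩ := exists_fib_mult (K := K) hn0 (hf.map (algebraMap k K))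
    (by rw [hf.natDegree_map, hfn]) (algebraMap k K t0)
  have htL : Transcendental K t := by
    rwa [htdef, transcendental_algebraMap_iff (algebraMap E L).injective]
  obtain ⟨y, γ, hy, hρ⟩ := spec_frob hn0 hfib htL s 1 hs1 (norm_gal hn0 hfib s hs) φK hφKs hfφ
    (ψ : L →+* L) hψK r hr hy0 (AlgHom.commutes (FiniteField.frobeniusAlgHom k K) t0)
  refine ⟨r * (s γ)⁻¹, ?_, ?_⟩
  · rw [inv_mul_cancel_left]
    exact Subgroup.inv_mem _ ⟨γ, hs γ⟩
  · obtain ⟨i, hi⟩ := exists_period hn0 hy hρ hg hgd (by omega)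
    exact ⟨i, by rw [hi, hgn]⟩

end TopPart

section GenPart

theorem exists_frobE {k K : Type} [Field k] [Fintype k] [Field K] [IsAlgClosed K] [Algebra k K] :
    ∃ φ : RatFunc K ≃+* RatFunc K,
      (∀ c : K, φ (algebraMap K (RatFunc K) c) = algebraMap K (RatFunc K) (c ^ Fintype.card k)) ∧
      φ (algebraMap K[X] (RatFunc K) X) = algebraMap K[X] (RatFunc K) X := by
  let φK : K →+* K := (FiniteField.frobeniusAlgHom k K : K →ₐ[k] K)
  have hφK : ∀ c, φK c = c ^ Fintype.card k := fun c => rfl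
  have hφKs : Function.Surjective φK := by
    intro c
    obtain ⟨z, hz⟩ := IsAlgClosed.exists_pow_nat_eq c (Fintype.card_pos (α := k))
    exact ⟨z, by rw [hφK, hz]⟩
  let e : K ≃+* K := RingEquiv.ofBijective φK ⟨φK.injective, hφKs⟩
  let φ : RatFunc K ≃+* RatFunc K := IsFractionRing.ringEquivOfRingEquiv (Polynomial.mapEquiv e)
  have h1 : ∀ a : K[X], φ (algebraMap K[X] (RatFunc K) a) =
      algebraMap K[X] (RatFunc K) (a.map (e : K →+* K)) := by
    intro a
    simp [φ]
  refine ⟨φ, fun c => ?_, ?_⟩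
  · rw [IsScalarTower.algebraMap_apply K K[X] (RatFunc K), h1,
      IsScalarTower.algebraMap_apply K K[X] (RatFunc K)]
    congr 1
    change map (e : K →+* K) (C c) = C (c ^ _)
    rw [map_C]
    rfl
  · rw [h1]; simp

theorem transc_X {K : Type} [Field K] : Transcendental K (algebraMap K[X] (RatFunc K) X) := by
  rw [transcendental_algebraMap_iff (IsFractionRing.injective K[X] (RatFunc K))]
  exact transcendental_X K

theorem sep_gen {K E : Type} [Field K] [Field E] [Algebra K E] {f : K[X]}
    (hder : f.derivative ≠ 0) {t : E} (ht : Transcendental K t) :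
    (f.map (algebraMap K E) - C t).Separable := by
  rw [separable_def, derivative_sub, derivative_C, sub_zero, derivative_map]
  rw [isCoprime_iff_aeval_ne_zero_of_isAlgClosed E (AlgebraicClosure E)]
  intro a
  by_contra hcon
  push Not at hcon
  obtain ⟨h1, h2⟩ := hcon
  rw [aeval_map_algebraMap] at h2
  rw [map_sub, aeval_map_algebraMap, aeval_C, sub_eq_zero] at h1
  have h3 : IsAlgebraic K a := ⟨_, hder, h2⟩
  have h4 : IsAlgebraic K (aeval a f) := by
    have h5 : Algebra.adjoin K {a} ≤ integralClosure K (AlgebraicClosure E) := by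
      rw [Algebra.adjoin_le_iff, Set.singleton_subset_iff]
      exact h3.isIntegral
    exact IsIntegral.isAlgebraic (h5 (aeval_mem_adjoin_singleton K a))
  rw [h1, isAlgebraic_algebraMap_iff (algebraMap E (AlgebraicClosure E)).injective] at h4
  exact ht h4

theorem gen_exists {k K : Type} [Field k] [Fintype k] [Field K] [IsAlgClosed K] [Algebra k K]
    {n : ℕ} (hn : 8 ≤ n) {f : k[X]} (hf : f.Monic) (hfn : f.natDegree = n)
    (hder : f.derivative ≠ 0)
    (hu : ∀ ℓ, 0 < ℓ → ℓ ≤ n → ∃ t0 : k, ∃ g : k[X], Irreducible g ∧ g.natDegree = ℓ ∧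
      g ∣ f - C t0) :
    ∃ (L : Type) (_ : Field L) (_ : Algebra K L) (x : Fin n → L) (t : L),
      GenFib (f.map (algebraMap k K)) x t ∧
      ∃ (B : ℕ) (μ : Fin n.factorial → (Fin n →₀ ℕ)), (∀ j, (μ j).degree ≤ B) ∧
      LinearIndependent K (fun q : ℕ × Fin n.factorial =>
        t ^ q.1 * (μ q.2).prod (fun i e => x i ^ e)) := by
  classical
  have hn0 : 0 < n := by omega
  set fK := f.map (algebraMap k K) with hfK
  have hfKm : fK.Monic := hf.map _
  have hfKn : fK.natDegree = n := by rw [hfK, hf.natDegree_map, hfn]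
  have hderK : fK.derivative ≠ 0 := by
    rw [hfK, derivative_map]
    exact (Polynomial.map_ne_zero_iff (algebraMap k K).injective).2 hder
  obtain ⟨φ, hφ, hφX⟩ := exists_frobE (k := k) (K := K)
  set tE := algebraMap K[X] (RatFunc K) X with htE
  have ht : Transcendental K tE := transc_X
  set P : (RatFunc K)[X] := fK.map (algebraMap K (RatFunc K)) - C tE with hP
  obtain ⟨hPm, hPn⟩ := monic_sub_C hn0 (hfKm.map (algebraMap K (RatFunc K)))
    (by rw [hfKm.natDegree_map, hfKn]) tE
  have hsep : P.Separable := sep_gen hderK ht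
  let L := P.SplittingField
  have hgal : IsGalois (RatFunc K) L := IsGalois.of_separable_splitting_field hsep
  have hcard := card_rootSet_eq_natDegree (K := L) hsep (SplittingField.splits P)
  rw [hPn] at hcard
  let e := (Fintype.equivFinOfCardEq hcard).symm
  let x : Fin n → L := fun i => (e i : L)
  have hxi : Function.Injective x := Subtype.val_injective.comp e.injective
  have hfib : IsFib fK x (algebraMap (RatFunc K) L tE) := by
    apply fib_of_roots hn0 hfKm hfKn hxi
    intro i
    have h1 : aeval (x i) (fK.map (algebraMap K (RatFunc K)) - C tE) = 0 :=
      (mem_rootSet.1 (e i).2).2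
    rw [map_sub, aeval_map_algebraMap, aeval_C, sub_eq_zero] at h1
    exact h1
  have hrange : Set.range x = P.rootSet L := by
    rw [show x = Subtype.val ∘ e from rfl, Set.range_comp, e.surjective.range_eq, Set.image_univ,
      Subtype.range_coe]
  have hadj : Algebra.adjoin (RatFunc K) (Set.range x) = ⊤ := by
    rw [hrange]; exact SplittingField.adjoin_rootSet P
  have hPφ : P.map (φ : RatFunc K →+* RatFunc K) = P := by
    have hcomp : ((φ : RatFunc K →+* RatFunc K).comp (algebraMap K (RatFunc K))).comp
        (algebraMap k K) = (algebraMap K (RatFunc K)).comp (algebraMap k K) := by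
      apply RingHom.ext
      intro c
      simp only [RingHom.comp_apply, RingHom.coe_coe]
      rw [hφ, ← map_pow, FiniteField.pow_card]
    rw [hP, Polynomial.map_sub, map_C, RingHom.coe_coe, hφX, hfK, Polynomial.map_map,
      Polynomial.map_map, Polynomial.map_map, hcomp]
  obtain ⟨ψ, hψ⟩ := lift_hom (L := L) P
    ((algebraMap (RatFunc K) L).comp (φ : RatFunc K →+* RatFunc K))
    (by rw [← Polynomial.map_map, hPφ]; exact SplittingField.splits P)
  have hψr : ∀ i, ∃ j, ψ (x i) = x j := by
    intro i
    have h1 : ψ (x i) ∈ P.rootSet L := by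
      rw [mem_rootSet]
      refine ⟨hPm.ne_zero, ?_⟩
      have h2 := (mem_rootSet.1 (e i).2).2
      have h3 := congrArg ψ h2
      rw [map_zero, aeval_def, hom_eval₂] at h3
      have h4 : ψ.comp (algebraMap (RatFunc K) L) =
        (algebraMap (RatFunc K) L).comp (φ : RatFunc K →+* RatFunc K) := RingHom.ext hψ
      rw [h4, ← eval₂_map, hPφ] at h3
      exact h3
    rw [← hrange] at h1
    obtain ⟨j, hj⟩ := h1
    exact ⟨j, hj.symm⟩
  obtain ⟨r, hr⟩ := exists_perm hxi ψ hψr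
  have hψs : Function.Surjective ψ := by
    let S : Subalgebra (RatFunc K) L := { ψ.range with
      algebraMap_mem' := fun c => ⟨algebraMap _ _ (φ.symm c), by rw [hψ]; simp⟩ }
    have hS : S = ⊤ := by
      rw [eq_top_iff, ← hadj, Algebra.adjoin_le_iff]
      rintro _ ⟨i, rfl⟩
      exact ⟨x (r.symm i), by rw [hr]; simp⟩
    intro z
    have : z ∈ S := by rw [hS]; trivial
    exact this
  let ψe : L ≃+* L := RingEquiv.ofBijective ψ ⟨ψ.injective, hψs⟩
  have htop : galSub (E := RatFunc K) x = ⊤ :=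
    gal_top hn hf hfn hxi hfib ht φ hφ hφX ψe hψ hu
  exact ⟨L, inferInstance, inferInstance, x, algebraMap (RatFunc K) L tE,
    gen_of_top ht hfib htop, exists_monomials hxi ht hadj htop⟩

end GenPart

section FinalPart

theorem exists_cycle_len {n ℓ : ℕ} (h0 : 0 < ℓ) (hl : ℓ ≤ n) :
    ∃ (σ : Equiv.Perm (Fin n)) (i : Fin n), Function.minimalPeriod σ i = ℓ := by
  obtain ⟨m, rfl⟩ : ∃ m, n = m + 1 := ⟨n - 1, by omega⟩
  rcases Nat.lt_or_ge 1 ℓ with h1 | h1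
  · let j : Fin (m + 1) := ⟨ℓ - 1, by omega⟩
    have hj : j ≠ 0 := by
      intro h
      have := congrArg Fin.val h
      simp [j] at this
      omega
    have hc := Fin.isCycle_cycleRange hj
    have ht := Fin.cycleType_cycleRange hj
    have ho : orderOf (Fin.cycleRange j) = ℓ := by
      rw [← Equiv.Perm.lcm_cycleType, ht]
      simp [j]
      omega
    obtain ⟨i, hi, -⟩ := id hc
    refine ⟨Fin.cycleRange j, i, ?_⟩
    have key : ∀ k, Function.minimalPeriod (Fin.cycleRange j) i ∣ k ↔ ℓ ∣ k := by
      intro k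
      rw [← Function.isPeriodicPt_iff_minimalPeriod_dvd, ← ho, orderOf_dvd_iff_pow_eq_one,
        hc.pow_eq_one_iff' hi, Function.IsPeriodicPt, Function.IsFixedPt,
        Equiv.Perm.iterate_eq_pow]
    exact Nat.dvd_antisymm ((key _).2 dvd_rfl) ((key _).1 dvd_rfl)
  · have : ℓ = 1 := by omega
    subst this
    refine ⟨1, 0, ?_⟩
    rw [Function.minimalPeriod_eq_one_iff_isFixedPt]
    rfl

theorem main_monic (F : Type) [Field F] [Fintype F] (f : Polynomial F) (hm : f.Monic)
    (hf : f.derivative ≠ 0) (hn : 8 ≤ f.natDegree)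
    (dbar : ℕ) (hdbar : 0 < dbar) (h : IsDUniversal f dbar) :
    ∃ d₀ : ℕ, 0 < d₀ ∧ ∀ d : ℕ, d₀ < d → IsDUniversal f d := by
  classical
  obtain ⟨p, hp⟩ := CharP.exists F
  have hpf : Fact p.Prime := ⟨CharP.char_is_prime F p⟩
  have hnz : NeZero dbar := ⟨hdbar.ne'⟩
  obtain ⟨⟨a, ha⟩, hpp, hcardF⟩ := FiniteField.card F p
  simp only [PNat.mk_coe] at hcardF
  let k := FiniteField.Extension F p dbar
  let _ : Fintype k := Fintype.ofFinite k
  have hk : Fintype.card k = Fintype.card F ^ dbar := by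
    rw [← Nat.card_eq_fintype_card, ← Nat.card_eq_fintype_card]
    exact FiniteField.natCard_extension F p dbar
  have hu := h k hk
  let K := AlgebraicClosure k
  have hKp : CharP K p := charP_of_injective_algebraMap (algebraMap F K).injective p
  have hfk : (f.map (algebraMap F k)).derivative ≠ 0 := by
    rw [derivative_map]
    exact (Polynomial.map_ne_zero_iff (algebraMap F k).injective).2 hf
  obtain ⟨L, _, _, x, t, hgen, B, μ, hμ, hind⟩ := gen_exists (k := k) (K := K) hn
    (hm.map (algebraMap F k)) (by rw [hm.natDegree_map]) hfk hu
  have hmap : (f.map (algebraMap F k)).map (algebraMap k K) = f.map (algebraMap F K) := by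
    rw [Polynomial.map_map, ← IsScalarTower.algebraMap_eq F k K]
  rw [hmap] at hgen
  set fK := f.map (algebraMap F K) with hfK
  have hder : fK.derivative ≠ 0 := by
    rw [hfK, derivative_map]
    exact (Polynomial.map_ne_zero_iff (algebraMap F K).injective).2 hf
  have hfc : ∀ i, fK.coeff i ^ (p ^ a) = fK.coeff i := by
    intro i
    rw [hfK, coeff_map, ← map_pow, ← hcardF, FiniteField.pow_card]
  obtain ⟨d₀, hd₀, hd⟩ := chebo (p := p) (by omega) hder hgen B μ hμ hind a ha hfc
  refine ⟨d₀, hd₀, fun d hdd => ?_⟩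
  intro K' _ _ _ hK' ℓ hℓ0 hℓ
  obtain ⟨σ, i, hσ⟩ := exists_cycle_len hℓ0 hℓ
  obtain ⟨y, t0, hyi, hyf, hyσ⟩ := hd d hdd σ
  rw [← hcardF, ← hK'] at hyσ
  have halg : Algebra.IsAlgebraic F K' := by
    have : Module.Finite F K' := Module.Finite.of_finite
    infer_instance
  let j : K' →ₐ[F] K := IsAlgClosed.lift
  let _ : Algebra K' K := j.toRingHom.toAlgebra
  have hjF : (algebraMap K' K).comp (algebraMap F K') = algebraMap F K := j.comp_algebraMap
  have hfK2 : (f.map (algebraMap F K')).map (algebraMap K' K) = fK := by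
    rw [Polynomial.map_map, hjF]
  have ht0 : t0 ^ Fintype.card K' = t0 := by
    have h1 := fib_root hyf i
    have h2 : Fintype.card K' = p ^ (a * d) := by rw [hK', hcardF, pow_mul]
    have h3 : (aeval (y i) fK) ^ (p ^ (a * d)) = aeval ((y i) ^ (p ^ (a * d))) fK := by
      apply fixed_eval
      intro i
      rw [← h2, hfK, coeff_map, ← map_pow, hK', FiniteField.pow_card_pow]
    rw [← h2, hyσ, h1, fib_root hyf] at h3
    exact h3
  have hQ : 1 < Fintype.card K' := Fintype.one_lt_card
  obtain ⟨t1, ht1⟩ : ∃ t1 : K', algebraMap K' K t1 = t0 := by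
    have hIntegral : IsIntegral K' t0 := by
      rw [← isAlgebraic_iff_isIntegral]
      exact ⟨X ^ Fintype.card K' - X, FiniteField.X_pow_card_sub_X_ne_zero K' hQ,
        by simp [ht0]⟩
    have h4 := (frob_pow_iff (minpoly.irreducible hIntegral) (minpoly.aeval _ _) 1).1
      (by rw [pow_one, ht0])
    have h5 := Nat.dvd_one.1 h4
    have h6 := minpoly.natDegree_eq_one_iff.1 h5
    exact h6
  have hroot : aeval (y i) (f.map (algebraMap F K') - C t1) = 0 := by
    have h9 : aeval (y i) (f.map (algebraMap F K')) = aeval (y i) fK := by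
      rw [← hfK2]
      exact (aeval_map_algebraMap K (y i) (f.map (algebraMap F K'))).symm
    rw [map_sub, aeval_C, ht1, h9, fib_root hyf i, sub_self]
  have hne : f.map (algebraMap F K') - C t1 ≠ 0 := by
    have h7 : (f.map (algebraMap F K') - C t1).natDegree = f.natDegree := by
      rw [natDegree_sub_C, hm.natDegree_map]
    intro h8
    rw [h8, natDegree_zero] at h7
    omega
  have hIntegral : IsIntegral K' (y i) := by
    rw [← isAlgebraic_iff_isIntegral]
    exact ⟨_, hne, hroot⟩
  refine ⟨t1, minpoly K' (y i), minpoly.irreducible hIntegral, ?_, minpoly.dvd _ _ hroot⟩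
  rw [← period_eq hyσ i (fun j hj => hyi hj) (minpoly.irreducible hIntegral) (minpoly.aeval _ _), hσ]

theorem univ_scale {F : Type} [Field F] [Fintype F] {f : F[X]} {c : F} (hc : c ≠ 0) {d : ℕ}
    (h : IsDUniversal f d) : IsDUniversal (C c * f) d := by
  intro K _ _ _ hK ℓ h0 hℓ
  rw [natDegree_C_mul hc] at hℓ
  obtain ⟨t0, g, hg, hgn, hgd⟩ := h K hK ℓ h0 hℓ
  refine ⟨algebraMap F K c * t0, g, hg, hgn, ?_⟩
  rw [Polynomial.map_mul, map_C, C_mul, ← mul_sub]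
  exact Dvd.dvd.mul_left hgd _

end FinalPart

/-- **Corollary 3.4.** If `f` (separable, of degree `≥ 8`) is `d̄`-universal for some
positive integer `d̄`, then there is `d₀` such that `f` is `d`-universal for all `d > d₀`. -/
theorem stmt_2 (F : Type) [Field F] [Fintype F] (f : Polynomial F)
    (hf : f.derivative ≠ 0) (hn : 8 ≤ f.natDegree)
    (dbar : ℕ) (hdbar : 0 < dbar) (h : IsDUniversal f dbar) :
    ∃ d₀ : ℕ, 0 < d₀ ∧ ∀ d : ℕ, d₀ < d → IsDUniversal f d := by
  have hf0 : f ≠ 0 := by rintro rfl; simp at hf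
  have hc : f.leadingCoeff ≠ 0 := leadingCoeff_ne_zero.2 hf0
  have hci : f.leadingCoeff⁻¹ ≠ 0 := inv_ne_zero hc
  have hm : (C f.leadingCoeff⁻¹ * f).Monic := by
    rw [mul_comm]; exact monic_mul_leadingCoeff_inv hf0
  obtain ⟨d₀, hd₀, hd⟩ := main_monic F (C f.leadingCoeff⁻¹ * f) hm
    (by rw [derivative_C_mul]; exact mul_ne_zero (C_ne_zero.2 hci) hf)
    (by rw [natDegree_C_mul hci]; exact hn) dbar hdbar (univ_scale hci h)
  refine ⟨d₀, hd₀, fun d hdd => ?_⟩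
  have h1 := univ_scale hc (hd d hdd)
  rwa [← mul_assoc, ← C_mul, mul_inv_cancel₀ hc, C_1, one_mul] at h1
end

section
/- (Turnwald) Let k be a field of characteristic different from 2 and let g ∈ k[X] be a polynomial of degree n ≥ 1 whose degree is not divisible by the characteristic of k. Suppose that the formal derivative g' of g has at least one simple root in an algebraic closure of k (i.e. a root of multiplicity exactly 1), and that for any two distinct roots α, β of g' in the algebraic closure of k one has g(α) ≠ g(β). Then the Galois group of g(X) - t over the rational function field k(t) has cardinality n!, i.e. it is the full symmetric group S_n. -/
open Polynomial

/-- polynomial part: no nontrivial decomposition. -/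
theorem no_decomp {K : Type*} [Field K] [IsAlgClosed K] (g a b : K[X]) (hg : g = a.comp b)
    (hn : (g.natDegree : K) ≠ 0) (ha : 2 ≤ a.natDegree) (hb : 2 ≤ b.natDegree)
    (α₀ : K) (h1 : g.derivative.eval α₀ = 0) (h2 : ¬ (X - C α₀) ^ 2 ∣ g.derivative)
    (hvals : ∀ α β : K, g.derivative.eval α = 0 → g.derivative.eval β = 0 → α ≠ β →
      g.eval α ≠ g.eval β) : False := by
  have hdeg : g.natDegree = a.natDegree * b.natDegree := by rw [hg, natDegree_comp]
  rw [hdeg, Nat.cast_mul] at hn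
  have ha0 : (a.natDegree : K) ≠ 0 := left_ne_zero_of_mul hn
  have hb0 : (b.natDegree : K) ≠ 0 := right_ne_zero_of_mul hn
  have hd : g.derivative = b.derivative * a.derivative.comp b := by
    rw [hg, derivative_comp]
  -- the key structural fact
  have key : ∀ γ : K, a.derivative.eval γ = 0 → ∃ δ c : K, b = C γ + C c * (X - C δ) ^ b.natDegree ∧ c ≠ 0 := by
    intro γ hγ
    have hbd : (b - C γ).natDegree = b.natDegree := natDegree_sub_C
    have hbd0 : (b - C γ).degree ≠ 0 := by
      intro h
      have : (b - C γ).natDegree = 0 := natDegree_eq_of_degree_eq_some h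
      omega
    obtain ⟨δ, hδ⟩ := IsAlgClosed.exists_root (b - C γ) hbd0
    have hbne : b - C γ ≠ 0 := by
      intro h; rw [h] at hbd; simp at hbd; omega
    have hall : ∀ x ∈ (b - C γ).roots, x = δ := by
      intro x hx
      by_contra hne
      have hx' := (mem_roots hbne).1 hx
      have e1 : b.eval x = γ := by simpa [sub_eq_zero] using hx'
      have e2 : b.eval δ = γ := by simpa [sub_eq_zero] using hδ
      refine hvals x δ ?_ ?_ hne ?_
      · simp [hd, e1, hγ]
      · simp [hd, e2, hγ]
      · simp [hg, e1, e2]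
    have hs := IsAlgClosed.splits (b - C γ)
    have hcard := hs.natDegree_eq_card_roots
    have hrep := Multiset.eq_replicate.2 ⟨hcard.symm, hall⟩
    have := hs.eq_prod_roots
    rw [hrep] at this
    simp only [Multiset.map_replicate, Multiset.prod_replicate, hbd] at this
    refine ⟨δ, (b - C γ).leadingCoeff, ?_, leadingCoeff_ne_zero.2 hbne⟩
    rw [← this]; ring
  have caseA : a.derivative.eval (b.eval α₀) = 0 → False := by
    intro h
    obtain ⟨δ, c, hbe, hc⟩ := key _ h
    have hδ : α₀ = δ := by
      have := congrArg (eval α₀) hbe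
      simp [hc] at this
      exact sub_eq_zero.1 this.1
    apply h2
    rw [hd]
    apply Dvd.dvd.mul_left
    have e : b - C (b.eval α₀) ∣ a.derivative.comp b := by
      have := dvd_iff_isRoot.2 h
      obtain ⟨q, hq⟩ := this
      rw [hq]; simp
    refine dvd_trans ?_ e
    have : b - C (b.eval α₀) = C c * (X - C δ) ^ b.natDegree := by
      conv_lhs => rw [hbe]
      have := congrArg (eval α₀) hbe
      rw [← hbe]
      conv_lhs => lhs; rw [hbe]
      ring
    rw [this, hδ]
    exact Dvd.dvd.mul_left (pow_dvd_pow _ hb) _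
  have hor : b.derivative.eval α₀ = 0 := by
    rw [hd, eval_mul, mul_eq_zero, eval_comp] at h1
    exact h1.resolve_right caseA
  have hada : a.derivative.degree ≠ 0 := by
    intro h
    have : a.derivative.natDegree = 0 := natDegree_eq_of_degree_eq_some h
    have h3 : a.derivative.coeff (a.natDegree - 1) = 0 := coeff_eq_zero_of_natDegree_lt (by omega)
    rw [coeff_derivative, show a.natDegree - 1 + 1 = a.natDegree by omega] at h3
    have h4 : ((a.natDegree - 1 : ℕ) : K) + 1 = a.natDegree := by
      norm_cast; congr 1; omega
    rw [h4] at h3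
    simp at h3
    rcases h3 with h | h
    · simp [h] at ha
    · exact ha0 h
  obtain ⟨γ, hγ⟩ := IsAlgClosed.exists_root _ hada
  obtain ⟨δ, c, hbe, hc⟩ := key γ hγ
  have hδ : α₀ = δ := by
    rw [hbe] at hor
    have : b.natDegree - 1 ≠ 0 := by omega
    simp [hc, derivative_X_sub_C_pow, hb0] at hor
    exact sub_eq_zero.1 hor.1
  apply caseA
  have : b.eval α₀ = γ := by
    rw [hbe, hδ]; simp; omega
  rw [this]; exact hγ


theorem coprime_rep {K : Type*} [Field K] (u y : RatFunc K)
    (hy : y ∈ IntermediateField.adjoin K {u}) :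
    ∃ r s : K[X], IsCoprime r s ∧ aeval u s ≠ 0 ∧ y * aeval u s = aeval u r := by
  obtain ⟨r, s, h⟩ := (IntermediateField.mem_adjoin_simple_iff _ _).1 hy
  by_cases hs : aeval u s = 0
  · refine ⟨0, 1, isCoprime_zero_left.2 isUnit_one, by simp, by simp [h, hs]⟩
  have hs0 : s ≠ 0 := by rintro rfl; simp at hs
  classical
  obtain ⟨d, r', s', hd, hrs, rfl, rfl⟩ : ∃ d r' s' : K[X], d ≠ 0 ∧ IsCoprime r' s' ∧
      r = d * r' ∧ s = d * s' := by
    have hd : EuclideanDomain.gcd r s ≠ 0 := fun h => hs0 (EuclideanDomain.gcd_eq_zero_iff.1 h).2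
    obtain ⟨d, A, B, hd0, hdr, hds, hAB⟩ : ∃ d A B : K[X], d ≠ 0 ∧ d ∣ r ∧ d ∣ s ∧
        d = r * A + s * B :=
      ⟨_, _, _, hd, EuclideanDomain.gcd_dvd_left r s, EuclideanDomain.gcd_dvd_right r s,
        EuclideanDomain.gcd_eq_gcd_ab r s⟩
    obtain ⟨r', rfl⟩ := hdr
    obtain ⟨s', rfl⟩ := hds
    refine ⟨d, r', s', hd0, ⟨A, B, mul_left_cancel₀ hd0 ?_⟩, rfl, rfl⟩
    linear_combination -hAB
  rw [map_mul] at hs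
  refine ⟨r', s', hrs, right_ne_zero_of_mul hs, ?_⟩
  have h1 := left_ne_zero_of_mul hs
  have h2 := right_ne_zero_of_mul hs
  rw [h, map_mul, map_mul]
  field_simp

theorem root_integral {K : Type*} [Field K] (q : K[X][X]) (w : RatFunc K) (hw : w ≠ 0)
    (c : K) (hc : c ≠ 0) (h0 : q.coeff 0 = C c) (hq : aeval w q = 0) :
    IsIntegral K[X] w⁻¹ := by
  have hCc : q.coeff 0 ≠ 0 := by rw [h0]; simpa
  have htr : q.reverse.leadingCoeff = C c := by
    rw [reverse_leadingCoeff, trailingCoeff_eq_coeff_zero hCc, h0]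
  let := invertibleOfNonzero hw
  have hroot : aeval w⁻¹ q.reverse = 0 := by
    have := (eval₂_reverse_eq_zero_iff (algebraMap K[X] (RatFunc K)) w q).2 hq
    simpa [aeval_def] using this
  refine ⟨C (C c⁻¹) * q.reverse, ?_, ?_⟩
  · rw [Monic, leadingCoeff_mul, htr, leadingCoeff_C, ← C_mul]; simp [hc]
  · rw [← aeval_def, map_mul, hroot, mul_zero]

theorem luroth_poly {K : Type*} [Field K] [IsAlgClosed K] (g : K[X]) (hg : 0 < g.natDegree)
    (L : IntermediateField K (RatFunc K)) (hL : algebraMap K[X] (RatFunc K) g ∈ L) :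
    ∃ a b : K[X], g = a.comp b ∧ L = IntermediateField.adjoin K {algebraMap K[X] (RatFunc K) b} := by
  have step1 : ∃ b : K[X], L = IntermediateField.adjoin K {algebraMap K[X] (RatFunc K) b} := by
    obtain ⟨u, hu⟩ : ∃ u, L = IntermediateField.adjoin K {u} := ⟨_, RatFunc.Luroth.eq_adjoin_generator⟩
    obtain ⟨r, s, hrs, hs, h⟩ := coprime_rep u _ (hu ▸ hL)
    by_cases hdeg : s.degree = 0
    · -- u integral
      rw [eq_C_of_degree_eq_zero hdeg] at h hs
      set e := s.coeff 0
      have he : e ≠ 0 := by rintro h; simp [h] at hs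
      have hr : 0 < r.natDegree := by
        by_contra hr
        rw [eq_C_of_natDegree_eq_zero (by omega : r.natDegree = 0)] at h
        have h' : algebraMap K[X] (RatFunc K) (g * C e) = algebraMap K[X] (RatFunc K) (C (r.coeff 0)) := by
          rw [map_mul]
          simpa [aeval_C] using h
        have h'' := RatFunc.algebraMap_injective K h'
        have := congrArg natDegree h''
        rw [natDegree_mul_C he, natDegree_C] at this
        omega
      have hintg : IsIntegral K[X] u := by
        have hr0 : r ≠ 0 := by rintro rfl; simp at hr
        refine ⟨(C (C r.leadingCoeff⁻¹)) * (r.map C - C (g * C e)), ?_, ?_⟩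
        · rw [Monic, leadingCoeff_mul, leadingCoeff_sub_of_degree_lt, leadingCoeff_map, leadingCoeff_C, ← C_mul]
          · rw [inv_mul_cancel₀ (leadingCoeff_ne_zero.2 hr0), C_1]
          · refine lt_of_le_of_lt degree_C_le ?_
            rw [degree_map]
            exact natDegree_pos_iff_degree_pos.1 hr
        · rw [← aeval_def, map_mul, map_sub, aeval_C, map_mul]
          have : aeval u (r.map (C : K →+* K[X])) = aeval u r := by
            rw [← algebraMap_eq, aeval_map_algebraMap]
          rw [this, ← h]
          simp [aeval_C]
      obtain ⟨b, hb⟩ := IsIntegrallyClosed.isIntegral_iff.1 hintg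
      exact ⟨b, by rw [hb, hu]⟩
    · obtain ⟨c, hc⟩ := IsAlgClosed.exists_root s hdeg
      have hc : s.eval c = 0 := hc
      have hrc : r.eval c ≠ 0 := by
        intro h0
        obtain ⟨A, B, hAB⟩ := hrs
        have := congrArg (eval c) hAB
        simp [h0, hc] at this
      have hw : u - RatFunc.C c ≠ 0 := by
        intro h0
        have : aeval u s = 0 := by
          rw [sub_eq_zero.1 h0, ← RatFunc.algebraMap_eq_C, aeval_algebraMap_apply]
          simp [hc]
        exact hs this
      have hintg : IsIntegral K[X] (u - RatFunc.C c)⁻¹ := by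
        refine root_integral ((r.comp (X + C c)).map C - C g * (s.comp (X + C c)).map C) _ hw _ hrc ?_ ?_
        · simp [coeff_zero_eq_eval_zero, eval_comp, eval_map, hc]
        · have key : ∀ r : K[X], aeval (u - RatFunc.C c) ((r.comp (X + C c)).map (C : K →+* K[X])) = aeval u r := by
            intro r
            rw [← algebraMap_eq, aeval_map_algebraMap, aeval_comp]
            congr 2
            simp [← RatFunc.algebraMap_eq_C]
          rw [map_sub, map_mul, key, key, aeval_C, h, sub_self]
      obtain ⟨b, hb⟩ := IsIntegrallyClosed.isIntegral_iff.1 hintg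
      refine ⟨b, ?_⟩
      rw [hb, hu]
      have hC : ∀ M : IntermediateField K (RatFunc K), RatFunc.C c ∈ M := by
        intro M
        rw [← RatFunc.algebraMap_eq_C]; exact M.algebraMap_mem c
      apply le_antisymm
      · rw [IntermediateField.adjoin_simple_le_iff]
        have h1 := IntermediateField.mem_adjoin_simple_self K (u - RatFunc.C c)⁻¹
        have := add_mem (inv_mem h1) (hC _)
        simpa using this
      · rw [IntermediateField.adjoin_simple_le_iff]
        exact inv_mem (sub_mem (IntermediateField.mem_adjoin_simple_self K u) (hC _))
  obtain ⟨b, hb⟩ := step1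
  obtain ⟨r, s, hrs, hs, h⟩ := coprime_rep _ _ (hb ▸ hL)
  have hae : ∀ r : K[X], aeval (algebraMap K[X] (RatFunc K) b) r = algebraMap K[X] (RatFunc K) (r.comp b) := by
    intro r
    rw [aeval_algebraMap_apply]; rfl
  rw [hae] at hs
  rw [hae, hae, ← map_mul] at h
  have h := RatFunc.algebraMap_injective K h
  have hunit : IsUnit (s.comp b) := by
    obtain ⟨A, B, hAB⟩ := hrs
    have := congrArg (fun p => p.comp b) hAB
    simp only [add_comp, mul_comp, one_comp, ← h] at this
    refine IsUnit.of_mul_eq_one (A.comp b * g + B.comp b) ?_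
    rw [← this]; ring
  obtain ⟨e, he, hee⟩ := Polynomial.isUnit_iff.1 hunit
  refine ⟨C (e⁻¹) * r, b, ?_, hb⟩
  rw [mul_comp, ← h, C_comp, ← hee, mul_left_comm, ← C_mul, inv_mul_cancel₀ he.ne_zero]
  simp


theorem turn_perfect_res {K : Type*} [Field K] [IsAlgClosed K] (c : K)
    [hp : (Ideal.span {(X - C c : K[X])}).IsPrime] [hm : (Ideal.span {(X - C c : K[X])}).IsMaximal] :
    PerfectField (Ideal.span {(X - C c : K[X])}).ResidueField := by
  set p := Ideal.span {(X - C c : K[X])} with hpdef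
  have hsurj : Function.Surjective (algebraMap K p.ResidueField) := by
    intro y
    obtain ⟨z, rfl⟩ := (Ideal.bijective_algebraMap_quotient_residueField p).2 y
    obtain ⟨q, rfl⟩ := Ideal.Quotient.mk_surjective z
    refine ⟨q.eval c, ?_⟩
    have : Ideal.Quotient.mk p q = Ideal.Quotient.mk p (C (q.eval c)) := by
      rw [Ideal.Quotient.eq, hpdef, Ideal.mem_span_singleton, dvd_iff_isRoot]
      simp
    rw [this]
    rfl
  have : Algebra.IsAlgebraic K p.ResidueField := by
    constructor
    intro y
    obtain ⟨x, rfl⟩ := hsurj y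
    exact isAlgebraic_algebraMap x
  exact Algebra.IsAlgebraic.perfectField (K := K)

theorem turn_exists_swap {K E : Type*} [Field K] [DecidableEq K] [IsAlgClosed K] [Field E] [Algebra K[X] E]
    [Algebra (RatFunc K) E] [IsScalarTower K[X] (RatFunc K) E] [FiniteDimensional (RatFunc K) E]
    [IsGalois (RatFunc K) E] (g : K[X]) (hg : 0 < g.natDegree) (α : K)
    (h2 : (X - C α) ^ 2 ∣ g - C (g.eval α))
    (hcard : g.natDegree ≤ (g - C (g.eval α)).roots.toFinset.card + 1)
    (f : K[X][X]) (hf : f = g.map C - C X)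
    (hsplit : (f.map (algebraMap K[X] (integralClosure K[X] E))).Splits)
    [DecidableEq (f.rootSet (integralClosure K[X] E))] :
    ∃ σ : Gal(E/RatFunc K), σ ≠ 1 ∧
      (MulAction.toPermHom Gal(E/RatFunc K) (f.rootSet (integralClosure K[X] E)) σ = 1 ∨
       (MulAction.toPermHom Gal(E/RatFunc K) (f.rootSet (integralClosure K[X] E)) σ).IsSwap) := by
  set B := integralClosure K[X] E with hB
  have hfr : IsFractionRing B E := integralClosure.isFractionRing_of_finite_extension (RatFunc K) E
  have hfin : Module.Finite K[X] B := IsIntegralClosure.finite K[X] (RatFunc K) E B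
  have hded : IsDedekindDomain B := integralClosure.isDedekindDomain K[X] (RatFunc K) E
  have hGal : IsGaloisGroup Gal(E/RatFunc K) K[X] B :=
    IsGaloisGroup.of_isFractionRing _ K[X] B (RatFunc K) E
  have hinjE : Function.Injective (algebraMap K[X] E) := by
    rw [IsScalarTower.algebraMap_eq K[X] (RatFunc K) E]
    exact (algebraMap (RatFunc K) E).injective.comp (RatFunc.algebraMap_injective K)
  have hinjB : Function.Injective (algebraMap K[X] B) := by
    intro x y h
    exact hinjE (congrArg (algebraMap B E) h)
  have : FaithfulSMul K[X] B := (faithfulSMul_iff_algebraMap_injective _ _).2 hinjB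
  have htf : Module.IsTorsionFree K[X] B := inferInstance
  have hflat : Module.Flat K[X] B := inferInstance
  set t0 := g.eval α
  have hprime : Prime (X - C t0) := prime_X_sub_C t0
  have hpm : (Ideal.span {(X - C t0 : K[X])}).IsMaximal :=
    PrincipalIdealRing.isMaximal_of_irreducible hprime.irreducible
  have hpp : (Ideal.span {(X - C t0 : K[X])}).IsPrime := hpm.isPrime
  have hperf := turn_perfect_res t0
  set p := Ideal.span {(X - C t0 : K[X])} with hpdef
  have hp0 : p ≠ ⊥ := by
    rw [hpdef, Ne, Ideal.span_singleton_eq_bot]; exact hprime.ne_zero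
  obtain ⟨P, hPm, hPp⟩ := Ideal.exists_maximal_ideal_liesOver_of_isIntegral (S := B) p
  have hPprime := hPm.isPrime
  have htP : algebraMap K[X] B (X - C t0) ∈ P := by
    have : X - C t0 ∈ p := Ideal.mem_span_singleton_self _
    rw [hPp.over] at this
    exact this
  -- a root congruent to α
  have hev : ∀ x : B, (f.map (algebraMap K[X] B)).eval x =
      g.eval₂ ((algebraMap K[X] B).comp C) x - algebraMap K[X] B X := by
    intro x
    rw [hf, Polynomial.map_sub, Polynomial.map_map, map_C, eval_sub, eval_C, eval_map]
  have hfdeg : 0 < f.natDegree := by rw [hf, natDegree_sub_C, natDegree_map]; exact hg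
  have hflc : f.leadingCoeff = C g.leadingCoeff := by
    rw [hf, leadingCoeff_sub_of_degree_lt, leadingCoeff_map]
    refine lt_of_le_of_lt degree_C_le ?_
    rw [degree_map]
    exact natDegree_pos_iff_degree_pos.1 hg
  have hf0 : f ≠ 0 := by rintro h; rw [h] at hfdeg; simp at hfdeg
  have hroot : ∃ x : B, (f.map (algebraMap K[X] B)).eval x = 0 ∧ x - algebraMap K[X] B (C α) ∈ P := by
    have h1 := hsplit.eq_prod_roots
    have h3 := congrArg (eval (algebraMap K[X] B (C α))) h1
    rw [hev] at h3
    have h4 : g.eval₂ ((algebraMap K[X] B).comp C) (algebraMap K[X] B (C α)) = algebraMap K[X] B (C t0) := by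
      have := hom_eval₂ g (RingHom.id K) ((algebraMap K[X] B).comp C) α
      simp only [RingHom.comp_id] at this
      rw [RingHom.comp_apply, RingHom.comp_apply] at this
      rw [← this]; rfl
    rw [h4, eval_mul, eval_C, leadingCoeff_map_of_injective hinjB, hflc, eval_multiset_prod, Multiset.map_map] at h3
    have h5 : algebraMap K[X] B (C g.leadingCoeff) *
      (Multiset.map ((eval ((algebraMap K[X] B) (C α))) ∘ fun a ↦ X - C a) (f.map (algebraMap K[X] B)).roots).prod ∈ P := by
      rw [← h3, ← neg_sub, ← map_sub]
      exact neg_mem htP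
    rcases hPprime.mem_or_mem h5 with h6 | h6
    · exfalso
      refine hPprime.ne_top (Ideal.eq_top_of_isUnit_mem _ h6 ?_)
      have hg0 : g ≠ 0 := by rintro rfl; simp at hg
      exact (isUnit_C.2 (leadingCoeff_ne_zero.2 hg0).isUnit).map _
    · obtain ⟨y, hy, hyP⟩ := (Ideal.IsPrime.multiset_prod_mem_iff_exists_mem hPprime _).1 h6
      obtain ⟨x, hx, rfl⟩ := Multiset.mem_map.1 hy
      refine ⟨x, (mem_roots'.1 hx).2, ?_⟩
      have := neg_mem hyP
      simpa using this
  have hle2 : p.map (algebraMap K[X] B) ≤ P ^ 2 := by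
    obtain ⟨x, hx0, hxP⟩ := hroot
    rw [hpdef, Ideal.map_span, Set.image_singleton, Ideal.span_singleton_le_iff_mem]
    rw [hev, sub_eq_zero] at hx0
    obtain ⟨q, hq⟩ := h2
    have : algebraMap K[X] B (X - C t0) = (x - algebraMap K[X] B (C α)) ^ 2 * q.eval₂ ((algebraMap K[X] B).comp C) x := by
      have := congrArg (eval₂ ((algebraMap K[X] B).comp C) x) hq
      rw [eval₂_sub, hx0, eval₂_C, eval₂_mul, eval₂_pow, eval₂_sub, eval₂_X, eval₂_C] at this
      rw [map_sub]; exact this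
    rw [this]
    exact Ideal.mul_mem_right _ _ (Ideal.pow_mem_pow hxP 2)
  have hle1 : p.map (algebraMap K[X] B) ≤ P := hle2.trans (Ideal.pow_le_self two_ne_zero)
  have hcardI : Nat.card (P.inertia Gal(E/RatFunc K)) ≠ 1 := by
    rw [Ideal.card_inertia_eq_ramificationIdxIn p P, Ideal.ramificationIdxIn_eq_ramificationIdx p P Gal(E/RatFunc K),
      ← Ideal.ramificationIdx'_eq_ramificationIdx p P hp0, Ideal.ramificationIdx'_ne_one_iff hle1]
    exact hle2
  have hI : P.inertia Gal(E/RatFunc K) ≠ ⊥ := by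
    intro h; apply hcardI; rw [h]; simp
  obtain ⟨⟨σ, hσ⟩, hσ'⟩ := Subgroup.ne_bot_iff_exists_ne_one.1 hI
  have hσ1 : σ ≠ 1 := fun h => hσ' (Subtype.ext h)
  refine ⟨σ, hσ1, ?_⟩
  refine hsplit.toPermHom_apply_eq_one_or_isSwap_of_ncard_le_of_mem_inertia P ?_ σ hσ
  have hmapne : f.map (algebraMap K[X] (B ⧸ P)) ≠ 0 := by
    intro h
    have := congrArg (fun q => q.coeff f.natDegree) h
    simp only [coeff_map, coeff_natDegree, hflc, coeff_zero] at this
    have hg0 : g ≠ 0 := by rintro rfl; simp at hg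
    have hu : IsUnit (algebraMap K[X] (B ⧸ P) (C g.leadingCoeff)) :=
      (isUnit_C.2 (leadingCoeff_ne_zero.2 hg0).isUnit).map _
    rw [this] at hu
    exact not_isUnit_zero hu
  -- cards
  have hc1 : (f.rootSet B).ncard ≤ g.natDegree := by
    classical
    rw [rootSet_def, Set.ncard_coe_finset]
    refine (Multiset.toFinset_card_le _).trans ((card_roots' _).trans ?_)
    refine natDegree_map_le.trans ?_
    rw [hf, natDegree_sub_C, natDegree_map]
  have hc2 : (g - C t0).roots.toFinset.card ≤ (f.rootSet (B ⧸ P)).ncard := by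
    let φ : K →+* B ⧸ P := (algebraMap K[X] (B ⧸ P)).comp C
    have hφ : Function.Injective φ := φ.injective
    classical
    rw [← Finset.card_image_of_injective _ hφ, ← Set.ncard_coe_finset]
    refine Set.ncard_le_ncard ?_ (rootSet_finite _ _)
    intro y hy
    obtain ⟨x, hx, rfl⟩ := Finset.mem_image.1 hy
    rw [mem_rootSet']
    refine ⟨hmapne, ?_⟩
    have hx := (mem_roots'.1 (Multiset.mem_toFinset.1 hx)).2
    have hx : g.eval x = t0 := by simpa [sub_eq_zero] using hx
    rw [hf, map_sub, aeval_C, aeval_def, eval₂_map]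
    have h4 : g.eval₂ φ (φ x) = φ t0 := by rw [eval₂_at_apply, hx]
    change g.eval₂ φ (φ x) - _ = 0
    rw [h4]
    have : algebraMap K[X] (B ⧸ P) (X - C t0) = 0 := by
      rw [IsScalarTower.algebraMap_apply K[X] B (B ⧸ P)]
      exact Ideal.Quotient.eq_zero_iff_mem.2 htP
    rw [map_sub, sub_eq_zero] at this
    rw [this]
    exact sub_self _
  omega


theorem turn_mult {K : Type*} [Field K] [DecidableEq K] [IsAlgClosed K] (g : K[X]) (hg : 0 < g.natDegree)
    (α : K) (h1 : g.derivative.eval α = 0) (h2 : ¬ (X - C α) ^ 2 ∣ g.derivative)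
    (hvals : ∀ α β : K, g.derivative.eval α = 0 → g.derivative.eval β = 0 → α ≠ β →
      g.eval α ≠ g.eval β) :
    (X - C α) ^ 2 ∣ g - C (g.eval α) ∧
    g.natDegree ≤ (g - C (g.eval α)).roots.toFinset.card + 1 := by
  set q := g - C (g.eval α) with hq
  have hqd : q.derivative = g.derivative := by simp [hq]
  have hqn : q.natDegree = g.natDegree := natDegree_sub_C
  have hq0 : q ≠ 0 := by intro h; rw [h] at hqn; simp at hqn; omega
  constructor
  · rw [← le_rootMultiplicity_iff hq0]
    apply (one_lt_rootMultiplicity_iff_isRoot hq0).2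
    exact ⟨by simp [hq], by rw [hqd]; exact h1⟩
  · have hnd : (q.roots.erase α).Nodup := by
      rw [Multiset.nodup_iff_count_le_one]
      intro x
      by_cases hx : x = α
      · subst hx
        rw [Multiset.count_erase_self, count_roots]
        by_contra hlt
        have : 3 ≤ q.rootMultiplicity x := by omega
        obtain ⟨w, hw⟩ := (le_rootMultiplicity_iff hq0).1 this
        apply h2
        rw [← hqd, hw, derivative_mul, derivative_X_sub_C_pow]
        apply dvd_add
        · apply Dvd.dvd.mul_right
          exact Dvd.dvd.mul_left (by simp) _
        · apply Dvd.dvd.mul_right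
          exact pow_dvd_pow _ (by norm_num)
      · rw [Multiset.count_erase_of_ne hx, count_roots]
        by_contra hlt
        have := (one_lt_rootMultiplicity_iff_isRoot hq0).1 (not_le.1 hlt)
        rw [hqd] at this
        refine hvals x α this.2 h1 hx ?_
        have := this.1
        simpa [hq, sub_eq_zero] using this
    have hcard := (IsAlgClosed.splits q).natDegree_eq_card_roots
    have hmem : α ∈ q.roots := (mem_roots hq0).2 (by simp [hq])
    have e1 := Multiset.card_erase_add_one hmem
    have e2 : (q.roots.erase α).card ≤ q.roots.toFinset.card := by
      rw [← Multiset.toFinset_card_of_nodup hnd]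
      exact Finset.card_le_card (Multiset.toFinset_subset.2 (Multiset.erase_subset _ _))
    omega

theorem turn_irred {K : Type*} [Field K] (g : K[X]) (hg : 0 < g.natDegree) :
    Irreducible (g.map (RatFunc.C : K →+* RatFunc K) - C RatFunc.X) := by
  have hirr : Irreducible (g.map C - C X : K[X][X]) := by
    have : (g.map C - C X : K[X][X]) = Bivariate.swap (C (-1) * X + C g) := by
      have e : (aeval (X : K[X][X]) g) = g.map C := by
        rw [aeval_def, Polynomial.map]; rfl
      simp [Bivariate.swap_apply, e]
      ring
    rw [this, MulEquiv.irreducible_iff]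
    refine irreducible_C_mul_X_add_C (by simp) ?_
    exact IsCoprime.isRelPrime (IsCoprime.neg_left isCoprime_one_left)
  have hprim : (g.map C - C X : K[X][X]).IsPrimitive := by
    apply hirr.isPrimitive
    rw [natDegree_sub_C, natDegree_map]; omega
  have := (hprim.irreducible_iff_irreducible_map_fraction_map (K := RatFunc K)).1 hirr
  rw [Polynomial.map_sub, Polynomial.map_map, map_C, RatFunc.algebraMap_X] at this
  exact this

theorem turn_separable {K : Type*} [Field K] (g : K[X]) (hg : 0 < g.natDegree) (hn : (g.natDegree : K) ≠ 0) :
    (g.map (RatFunc.C : K →+* RatFunc K) - C RatFunc.X).Separable := by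
  rw [separable_iff_derivative_ne_zero (turn_irred g hg)]
  intro h
  rw [derivative_sub, derivative_C, sub_zero, derivative_map] at h
  rw [Polynomial.map_eq_zero] at h
  have h3 : g.derivative.coeff (g.natDegree - 1) = 0 := by rw [h]; simp
  rw [coeff_derivative, show g.natDegree - 1 + 1 = g.natDegree by omega] at h3
  have h4 : ((g.natDegree - 1 : ℕ) : K) + 1 = g.natDegree := by
    norm_cast; congr 1; omega
  rw [h4] at h3
  simp at h3
  rcases h3 with h | h
  · simp [h] at hg
  · exact hn h

/-- The property of having no proper intermediate fields. -/
def NoInter {K : Type*} [Field K] (g : K[X]) : Prop :=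
  ∀ L : IntermediateField K (RatFunc K), algebraMap K[X] (RatFunc K) g ∈ L →
    L = ⊤ ∨ L = IntermediateField.adjoin K {algebraMap K[X] (RatFunc K) g}

open IntermediateField in
theorem turn_inter {K E : Type*} [Field K] [Field E] [Algebra K E]
    [Algebra (RatFunc K) E] [IsScalarTower K (RatFunc K) E] (g : K[X]) 
    (H : NoInter g) (x : E) (hx : aeval x g = algebraMap (RatFunc K) E RatFunc.X)
    (M : IntermediateField (RatFunc K) E) (hM : M ≤ (RatFunc K)⟮x⟯) :
    M = ⊥ ∨ M = (RatFunc K)⟮x⟯ := by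
  have htr : Transcendental K x := by
    intro hal
    have h1 : IsAlgebraic K (aeval x g) := by
      rw [isAlgebraic_iff_isIntegral] at hal ⊢
      change aeval x g ∈ integralClosure K E
      rw [aeval_eq_sum_range]
      exact sum_mem fun i _ => Subalgebra.smul_mem _ (pow_mem (show x ∈ integralClosure K E from hal) _) _
    rw [hx] at h1
    exact RatFunc.transcendental_X (isAlgebraic_algebraMap_iff (algebraMap (RatFunc K) E).injective |>.1 h1)
  have hinj : Function.Injective (aeval x : K[X] →ₐ[K] E) := transcendental_iff_injective.1 htr
  let φ : RatFunc K →ₐ[K] E := IsFractionRing.liftAlgHom (A := K[X]) hinj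
  have hφ : ∀ q : K[X], φ (algebraMap K[X] (RatFunc K) q) = aeval x q := fun q =>
    IsFractionRing.lift_algebraMap (K := RatFunc K) hinj q
  have hφg : φ (algebraMap K[X] (RatFunc K) g) = algebraMap (RatFunc K) E RatFunc.X := by rw [hφ, hx]
  have hφX : φ RatFunc.X = x := by rw [← RatFunc.algebraMap_X, hφ, aeval_X]
  have hgM : algebraMap K[X] (RatFunc K) g ∈ (M.restrictScalars K).comap φ := by
    change φ _ ∈ M
    rw [hφg]; exact M.algebraMap_mem _
  rcases H _ hgM with h | h
  · right
    apply le_antisymm hM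
    rw [adjoin_simple_le_iff]
    have : RatFunc.X ∈ (M.restrictScalars K).comap φ := by rw [h]; trivial
    change φ _ ∈ M at this
    rwa [hφX] at this
  · left
    rw [eq_bot_iff]
    -- every element of the base is in K(t)
    have hbase : ∀ z : RatFunc K, z ∈ IntermediateField.adjoin K {(RatFunc.X : RatFunc K)} := by
      intro z; rw [RatFunc.adjoin_X]; trivial
    have hsub : ∀ z : RatFunc K, algebraMap (RatFunc K) E z ∈ φ.fieldRange := by
      intro z
      have h1 : IntermediateField.adjoin K {(RatFunc.X : RatFunc K)} ≤
          φ.fieldRange.comap (IsScalarTower.toAlgHom K (RatFunc K) E) := by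
        rw [adjoin_simple_le_iff]
        exact ⟨_, hφg⟩
      exact h1 (hbase z)
    have hrange : ∀ y ∈ (RatFunc K)⟮x⟯, y ∈ φ.fieldRange := by
      intro y hy
      obtain ⟨r, s, rfl⟩ := (mem_adjoin_simple_iff _ _).1 hy
      have hae : ∀ r : (RatFunc K)[X], aeval x r ∈ φ.fieldRange := by
        intro r
        rw [aeval_eq_sum_range]
        refine sum_mem fun i _ => ?_
        rw [Algebra.smul_def]
        have hxr : x ∈ φ.fieldRange := ⟨_, hφX⟩
        exact mul_mem (hsub _) (pow_mem hxr _)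
      exact div_mem (hae r) (hae s)
    intro y hy
    obtain ⟨z, hz⟩ := hrange y (hM hy)
    have hz : φ z = y := hz
    have hzL : z ∈ (M.restrictScalars K).comap φ := by
      change φ z ∈ M
      rw [hz]; exact hy
    rw [h] at hzL
    have h1 : IntermediateField.adjoin K {algebraMap K[X] (RatFunc K) g} ≤
        ((⊥ : IntermediateField (RatFunc K) E).restrictScalars K).comap φ := by
      rw [adjoin_simple_le_iff]
      change φ _ ∈ (⊥ : IntermediateField (RatFunc K) E)
      rw [hφg]
      exact IntermediateField.algebraMap_mem _ _
    have := h1 hzL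
    change φ z ∈ (⊥ : IntermediateField (RatFunc K) E) at this
    rwa [hz] at this

theorem turn_card_le {F F' : Type*} [Field F] [Field F'] [Algebra F F'] (p : F[X]) :
    Nat.card (p.map (algebraMap F F')).Gal ≤ Nat.card p.Gal := by
  set q := p.map (algebraMap F F') with hq
  let S := q.SplittingField
  have hs : (p.map (algebraMap F S)).Splits := by
    have := SplittingField.splits q
    rw [hq, Polynomial.map_map, ← IsScalarTower.algebraMap_eq F F' S] at this
    exact this
  have : Fact (p.map (algebraMap F S)).Splits := ⟨hs⟩
  let r : q.Gal → p.Gal := fun σ => Gal.restrict p S (AlgEquiv.restrictScalars F (σ : S ≃ₐ[F'] S))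
  apply Nat.card_le_card_of_injective r
  intro σ τ h
  apply Gal.ext
  intro x hx
  have hx' : x ∈ p.rootSet S := by
    have e0 : p.map (algebraMap F S) = q.map (algebraMap F' S) :=
      (congrArg (fun φ => p.map φ) (IsScalarTower.algebraMap_eq F F' S)).trans (Polynomial.map_map _ _ _).symm
    have e9 : aeval x q = aeval x p := aeval_map_algebraMap F' x p
    rw [mem_rootSet'] at hx ⊢
    exact ⟨by rw [e0]; exact hx.1, e9.symm.trans hx.2⟩
  have e1 := Gal.restrict_smul (p := p) (E := S) (AlgEquiv.restrictScalars F (σ : S ≃ₐ[F'] S)) ⟨x, hx'⟩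
  have e2 := Gal.restrict_smul (p := p) (E := S) (AlgEquiv.restrictScalars F (τ : S ≃ₐ[F'] S)) ⟨x, hx'⟩
  have h' : Gal.restrict p S (AlgEquiv.restrictScalars F (σ : S ≃ₐ[F'] S)) = Gal.restrict p S (AlgEquiv.restrictScalars F (τ : S ≃ₐ[F'] S)) := h
  rw [h'] at e1
  exact e1.symm.trans e2

theorem turn_card_le_fact {F : Type*} [Field F] (p : F[X]) :
    Nat.card p.Gal ≤ p.natDegree.factorial := by
  classical
  have : Fact (p.map (algebraMap F p.SplittingField)).Splits := ⟨SplittingField.splits p⟩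
  refine (Nat.card_le_card_of_injective _ (Gal.galActionHom_injective p p.SplittingField)).trans ?_
  rw [Nat.card_perm]
  apply Nat.factorial_le
  rw [Nat.card_coe_set_eq, rootSet_def, Set.ncard_coe_finset]
  refine (Multiset.toFinset_card_le _).trans ((card_roots' _).trans natDegree_map_le)


theorem turn_noInter {K : Type*} [Field K] [IsAlgClosed K] (g : K[X])
    (hg0 : 0 < g.natDegree) (hn : (g.natDegree : K) ≠ 0) (α₀ : K)
    (h1 : g.derivative.eval α₀ = 0) (h2 : ¬ (X - C α₀) ^ 2 ∣ g.derivative)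
    (hvals : ∀ α β : K, g.derivative.eval α = 0 → g.derivative.eval β = 0 → α ≠ β →
      g.eval α ≠ g.eval β) : NoInter g := by
  intro L hL
  obtain ⟨a, b, hab, hLb⟩ := luroth_poly g hg0 L hL
  have hdeg : g.natDegree = a.natDegree * b.natDegree := by rw [hab, natDegree_comp]
  have ha : a.natDegree ≠ 0 := by intro h; rw [h] at hdeg; simp at hdeg; omega
  have hb : b.natDegree ≠ 0 := by intro h; rw [h] at hdeg; simp at hdeg; omega
  have hlin : ∀ c : K[X], c.natDegree = 1 → ∃ u v : K, u ≠ 0 ∧ c = C u * X + C v := by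
    intro c hc
    refine ⟨c.coeff 1, c.coeff 0, ?_, eq_X_add_C_of_natDegree_le_one hc.le⟩
    rw [← hc]
    exact leadingCoeff_ne_zero.2 (by intro h; simp [h] at hc)
  have hCmem : ∀ (M : IntermediateField K (RatFunc K)) (u : K), algebraMap K[X] (RatFunc K) (C u) ∈ M := by
    intro M u
    have := M.algebraMap_mem u
    rwa [IsScalarTower.algebraMap_apply K K[X] (RatFunc K)] at this
  have hsolve : ∀ (M : IntermediateField K (RatFunc K)) (u v : K) (w : K[X]), u ≠ 0 →
      algebraMap K[X] (RatFunc K) (C u * w + C v) ∈ M → algebraMap K[X] (RatFunc K) w ∈ M := by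
    intro M u v w hu h
    have e : w = C u⁻¹ * ((C u * w + C v) - C v) := by
      rw [add_sub_cancel_right, ← mul_assoc, ← C_mul, inv_mul_cancel₀ hu, C_1, one_mul]
    rw [e, map_mul, map_sub]
    exact mul_mem (hCmem _ _) (sub_mem h (hCmem _ _))
  by_cases hb1 : b.natDegree = 1
  · left
    obtain ⟨u, v, hu, hbe⟩ := hlin b hb1
    have hbL : algebraMap K[X] (RatFunc K) b ∈ L := by
      rw [hLb]; exact IntermediateField.mem_adjoin_simple_self _ _
    rw [hbe] at hbL
    have hX := hsolve L u v X hu hbL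
    rw [RatFunc.algebraMap_X] at hX
    rw [eq_top_iff, ← RatFunc.adjoin_X, IntermediateField.adjoin_simple_le_iff]
    exact hX
  by_cases ha1 : a.natDegree = 1
  · right
    obtain ⟨u, v, hu, hae⟩ := hlin a ha1
    apply le_antisymm
    · rw [hLb, IntermediateField.adjoin_simple_le_iff]
      apply hsolve _ u v b hu
      have : C u * b + C v = g := by rw [hab, hae]; simp
      rw [this]
      exact IntermediateField.mem_adjoin_simple_self _ _
    · rw [IntermediateField.adjoin_simple_le_iff]; exact hL
  exact (no_decomp g a b hab hn (by omega) (by omega) α₀ h1 h2 hvals).elim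

open IntermediateField in
theorem turn_main {K E : Type*} [Field K] [IsAlgClosed K] [Field E] [Algebra K E] [Algebra K[X] E]
    [Algebra (RatFunc K) E] [IsScalarTower K (RatFunc K) E] [IsScalarTower K[X] (RatFunc K) E]
    (g : K[X]) (hg0 : 0 < g.natDegree) (hn : (g.natDegree : K) ≠ 0) (α₀ : K)
    (h1 : g.derivative.eval α₀ = 0) (h2 : ¬ (X - C α₀) ^ 2 ∣ g.derivative)
    (hvals : ∀ α β : K, g.derivative.eval α = 0 → g.derivative.eval β = 0 → α ≠ β →
      g.eval α ≠ g.eval β) (p : (RatFunc K)[X])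
    (hp : p = g.map (RatFunc.C : K →+* RatFunc K) - C RatFunc.X)
    [IsSplittingField (RatFunc K) E p] :
    Nat.card Gal(E/RatFunc K) = g.natDegree.factorial := by
  classical
  have hirr : Irreducible p := hp ▸ turn_irred g hg0
  have hsep : p.Separable := hp ▸ turn_separable g hg0 hn
  have hpd : p.natDegree = g.natDegree := by rw [hp, natDegree_sub_C, natDegree_map]
  have hfd : FiniteDimensional (RatFunc K) E := IsSplittingField.finiteDimensional E p
  have hgal : IsGalois (RatFunc K) E := IsGalois.of_separable_splitting_field hsep
  obtain ⟨f, hf⟩ : ∃ f : K[X][X], f = g.map C - C X := ⟨_, rfl⟩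
  have hfp : f.map (algebraMap K[X] (RatFunc K)) = p := by
    rw [hf, hp, Polynomial.map_sub, Polynomial.map_map, map_C, RatFunc.algebraMap_X]
    rfl
  have hinjE : Function.Injective (algebraMap K[X] E) := by
    rw [IsScalarTower.algebraMap_eq K[X] (RatFunc K) E]
    exact (algebraMap (RatFunc K) E).injective.comp (IsFractionRing.injective K[X] (RatFunc K))
  have hae : ∀ x : E, aeval x p = aeval x f := fun x => by
    rw [← hfp]; exact aeval_map_algebraMap (RatFunc K) x f
  have haeg : ∀ x : E, aeval x p = 0 → aeval x g = algebraMap (RatFunc K) E RatFunc.X := by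
    intro x hx
    rw [hp, map_sub, aeval_C, sub_eq_zero] at hx
    rw [← hx]
    exact (aeval_map_algebraMap (RatFunc K) x g).symm
  have hintg : ∀ x : E, aeval x p = 0 → IsIntegral K[X] x := by
    intro x hx
    rw [hae] at hx
    have hlc : f.leadingCoeff = C g.leadingCoeff := by
      have hd : f.natDegree = g.natDegree := by
        rw [hf, natDegree_sub_C, natDegree_map_eq_of_injective C_injective]
      rw [leadingCoeff, hd, hf, coeff_sub, coeff_map, coeff_C, if_neg hg0.ne', sub_zero]
      rfl
    have hlc0 : g.leadingCoeff ≠ 0 := leadingCoeff_ne_zero.2 (by rintro rfl; simp at hg0)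
    refine ⟨C (C g.leadingCoeff⁻¹) * f, monic_C_mul_of_mul_leadingCoeff_eq_one ?_, ?_⟩
    · rw [hlc, ← C_mul, inv_mul_cancel₀ hlc0, C_1]
    · rw [eval₂_mul]
      have : eval₂ (algebraMap K[X] E) x f = 0 := hx
      rw [this, mul_zero]
  have hinjB : Function.Injective (algebraMap (integralClosure K[X] E) E) := Subtype.val_injective
  have hmapE : (f.map (algebraMap K[X] (integralClosure K[X] E))).map
      (algebraMap (integralClosure K[X] E) E) = p.map (algebraMap (RatFunc K) E) := by
    rw [← hfp, Polynomial.map_map, Polynomial.map_map]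
    rw [← IsScalarTower.algebraMap_eq K[X] (RatFunc K) E, ← IsScalarTower.algebraMap_eq]
  have hsplit : (f.map (algebraMap K[X] (integralClosure K[X] E))).Splits := by
    refine Splits.of_splits_map_of_injective (i := algebraMap (integralClosure K[X] E) E) hinjB ?_ ?_
    · rw [hmapE]; exact IsSplittingField.splits E p
    · intro a ha
      rw [hmapE] at ha
      have : aeval a p = 0 := by
        have := isRoot_of_mem_roots ha
        rwa [IsRoot, eval_map_algebraMap] at this
      exact ⟨⟨a, hintg a this⟩, rfl⟩
  have hf0 : f.map (algebraMap K[X] (integralClosure K[X] E)) ≠ 0 := by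
    intro h
    rw [h, Polynomial.map_zero] at hmapE
    exact hirr.ne_zero ((Polynomial.map_eq_zero _).1 hmapE.symm)
  have hp0 : p.map (algebraMap (RatFunc K) E) ≠ 0 := by
    intro h
    exact hirr.ne_zero ((Polynomial.map_eq_zero _).1 h)
  -- roots
  have hRp : ∀ r : f.rootSet (integralClosure K[X] E), aeval ((r : integralClosure K[X] E) : E) p = 0 := by
    intro r
    have := (mem_rootSet'.1 r.2).2
    rw [hae]
    have h := congrArg (algebraMap (integralClosure K[X] E) E) this
    rw [map_zero, ← aeval_algebraMap_apply] at h
    exact h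
  have hpR : ∀ x : E, aeval x p = 0 →
      ∃ r : f.rootSet (integralClosure K[X] E), ((r : integralClosure K[X] E) : E) = x := by
    intro x hx
    refine ⟨⟨⟨x, hintg x hx⟩, mem_rootSet'.2 ⟨hf0, ?_⟩⟩, rfl⟩
    apply hinjB
    rw [map_zero, ← aeval_algebraMap_apply]
    rw [hae] at hx
    exact hx
  have hRcard : Nat.card (f.rootSet (integralClosure K[X] E)) = g.natDegree := by
    rw [← hpd, ← card_rootSet_eq_natDegree (K := E) hsep (IsSplittingField.splits E p),
      ← Nat.card_eq_fintype_card]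
    refine Nat.card_congr (Equiv.ofBijective
      (fun r => (⟨((r : integralClosure K[X] E) : E), mem_rootSet'.2 ⟨hp0, hRp r⟩⟩ : p.rootSet E)) ⟨?_, ?_⟩)
    · intro r s h
      have h' := congrArg Subtype.val h
      exact Subtype.ext (Subtype.ext h')
    · rintro ⟨x, hx⟩
      obtain ⟨r, hr⟩ := hpR x (mem_rootSet'.1 hx).2
      exact ⟨r, Subtype.ext hr⟩
  have hfinR : Finite (f.rootSet (integralClosure K[X] E)) := inferInstance
  have hact : ∀ (σ : Gal(E/RatFunc K)) (r : f.rootSet (integralClosure K[X] E)),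
      (((σ • r : f.rootSet (integralClosure K[X] E)) : integralClosure K[X] E) : E) =
        σ ((r : integralClosure K[X] E) : E) := fun _ _ => rfl
  -- faithful
  have hfaith : Function.Injective
      (MulAction.toPermHom Gal(E/RatFunc K) (f.rootSet (integralClosure K[X] E))) := by
    intro σ τ h
    have : (σ : E →ₐ[RatFunc K] E) = τ := by
      refine AlgHom.ext_of_adjoin_eq_top (IsSplittingField.adjoin_rootSet E p) ?_
      intro x hx
      obtain ⟨r, rfl⟩ := hpR x (mem_rootSet'.1 hx).2
      have h' := DFunLike.congr_fun h r
      have h'' : σ • r = τ • r := h'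
      change σ _ = τ _
      rw [← hact, ← hact, h'']
    ext x
    exact DFunLike.congr_fun this x
  -- degree at least two
  have hn2 : 2 ≤ g.natDegree := by
    by_contra hlt
    have h1' : g.natDegree = 1 := by omega
    have := eq_X_add_C_of_natDegree_le_one h1'.le
    rw [this] at h1
    simp at h1
    have hlc0 : g.leadingCoeff ≠ 0 := leadingCoeff_ne_zero.2 (by rintro rfl; simp at hg0)
    rw [leadingCoeff, h1'] at hlc0
    exact hlc0 h1
  have hnt : Nontrivial (f.rootSet (integralClosure K[X] E)) := by
    rw [← Finite.one_lt_card_iff_nontrivial, hRcard]; omega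
  -- transitive
  have htrans : MulAction.IsPretransitive Gal(E/RatFunc K) (f.rootSet (integralClosure K[X] E)) := by
    constructor
    intro r s
    have hc : IsConjRoot (RatFunc K) ((s : integralClosure K[X] E) : E) ((r : integralClosure K[X] E) : E) := by
      have e1 := minpoly.eq_of_irreducible hirr (hRp r)
      have e2 := minpoly.eq_of_irreducible hirr (hRp s)
      exact e2.symm.trans e1
    obtain ⟨σ, hσ⟩ := isConjRoot_iff_exists_algEquiv.1 hc
    exact ⟨σ, Subtype.ext (Subtype.ext hσ)⟩
  obtain ⟨a⟩ : Nonempty (f.rootSet (integralClosure K[X] E)) := inferInstance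
  -- primitive
  have hprim : MulAction.IsPreprimitive Gal(E/RatFunc K) (f.rootSet (integralClosure K[X] E)) := by
    rw [← MulAction.isCoatom_stabilizer_iff_preprimitive _ a]
    set x : E := ((a : integralClosure K[X] E) : E) with hx
    have hstab : MulAction.stabilizer Gal(E/RatFunc K) a = ((RatFunc K)⟮x⟯).fixingSubgroup := by
      ext σ
      rw [MulAction.mem_stabilizer_iff, IntermediateField.mem_fixingSubgroup_iff]
      have := forall_mem_adjoin_smul_eq_self_iff (RatFunc K) (S := {x}) σ
      simp only [Set.mem_singleton_iff, forall_eq] at this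
      refine Iff.trans ?_ this.symm
      constructor
      · intro h
        change σ x = x
        rw [hx, ← hact, h]
      · intro h
        exact Subtype.ext (Subtype.ext h)
    have hNI := turn_noInter g hg0 hn α₀ h1 h2 hvals
    constructor
    · intro htop
      obtain ⟨b, hb⟩ := exists_ne a
      obtain ⟨σ, hσ⟩ := MulAction.exists_smul_eq Gal(E/RatFunc K) a b
      have : σ ∈ MulAction.stabilizer Gal(E/RatFunc K) a := by rw [htop]; trivial
      exact hb (hσ.symm.trans this)
    · intro H hH
      have hle : fixedField H ≤ (RatFunc K)⟮x⟯ := by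
        rw [← IsGalois.fixedField_fixingSubgroup (RatFunc K)⟮x⟯, ← hstab]
        exact fixedField_antitone hH.le
      rcases turn_inter g hNI x (haeg x (hRp a)) _ hle with h | h
      · rw [← fixingSubgroup_fixedField H, h, fixingSubgroup_bot]
      · exfalso
        apply hH.ne
        rw [hstab, ← h, fixingSubgroup_fixedField]
  -- the swap
  obtain ⟨hm1, hm2⟩ := turn_mult g hg0 α₀ h1 h2 hvals
  obtain ⟨σ, hσ1, hσ⟩ := turn_exists_swap (E := E) g hg0 α₀ hm1 hm2 f hf hsplit
  have hswap : (MulAction.toPermHom Gal(E/RatFunc K) (f.rootSet (integralClosure K[X] E)) σ).IsSwap := by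
    rcases hσ with h | h
    · exact (hσ1 (hfaith (h.trans (map_one _).symm))).elim
    · exact h
  have hprim' : MulAction.IsPreprimitive
      (MulAction.toPermHom Gal(E/RatFunc K) (f.rootSet (integralClosure K[X] E))).range
      (f.rootSet (integralClosure K[X] E)) := by
    let φ := (MulAction.toPermHom Gal(E/RatFunc K) (f.rootSet (integralClosure K[X] E))).rangeRestrict
    let F : f.rootSet (integralClosure K[X] E) →ₑ[φ] f.rootSet (integralClosure K[X] E) :=
      { toFun := id, map_smul' := fun _ _ => rfl }
    exact MulAction.IsPreprimitive.of_surjective (f := F) Function.surjective_id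
  have htop := Equiv.Perm.subgroup_eq_top_of_isPreprimitive_of_isSwap_mem hprim' _ hswap ⟨σ, rfl⟩
  have hsurj := MonoidHom.range_eq_top.1 htop
  rw [Nat.card_congr (Equiv.ofBijective _ ⟨hfaith, hsurj⟩), Nat.card_perm, hRcard]

theorem stmt_4 (k : Type) [Field k] (g : Polynomial k)
    (hdeg : 1 ≤ g.natDegree)
    (hchar2 : ringChar k ≠ 2)
    (hcharn : ¬ ringChar k ∣ g.natDegree)
    (hsimple : ∃ α : AlgebraicClosure k,
      Polynomial.rootMultiplicity α
        (g.derivative.map (algebraMap k (AlgebraicClosure k))) = 1)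
    (hvals : ∀ α β : AlgebraicClosure k,
      aeval α g.derivative = 0 → aeval β g.derivative = 0 → α ≠ β →
        aeval α g ≠ aeval β g) :
    Nat.card (g.map (RatFunc.C : k →+* RatFunc k) - C RatFunc.X).Gal
      = Nat.factorial g.natDegree := by
  let K := AlgebraicClosure k
  let ι : k →+* K := algebraMap k K
  have hιinj : Function.Injective ι := ι.injective
  let G : K[X] := g.map ι
  have hGd : G.natDegree = g.natDegree := natDegree_map ι
  have hGder : G.derivative = g.derivative.map ι := derivative_map g ι
  have hmapinj : Function.Injective (mapRingHom ι) := map_injective ι hιinj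
  let Φ : RatFunc k →+* RatFunc K := RatFunc.mapRingHom (mapRingHom ι)
    (nonZeroDivisors_le_comap_nonZeroDivisors_of_injective _ hmapinj)
  have hΦ : ∀ q : k[X], Φ (algebraMap k[X] (RatFunc k) q) = algebraMap K[X] (RatFunc K) (q.map ι) := by
    intro q
    have := RatFunc.map_apply_div_ne_zero (mapRingHom ι)
      (nonZeroDivisors_le_comap_nonZeroDivisors_of_injective _ hmapinj) q 1 one_ne_zero
    simp only [map_one, div_one] at this
    exact this
  letI : Algebra (RatFunc k) (RatFunc K) := Φ.toAlgebra
  obtain ⟨α₀, hα₀⟩ := hsimple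
  have hder0 : G.derivative ≠ 0 := by
    intro h
    rw [hGder] at h
    rw [show g.derivative.map (algebraMap k (AlgebraicClosure k)) = 0 from h] at hα₀
    simp at hα₀
  have hα₀' : G.derivative.rootMultiplicity α₀ = 1 := by rw [hGder]; exact hα₀
  have hn : (G.natDegree : K) ≠ 0 := by
    rw [hGd]
    intro h
    apply hcharn
    rw [← ringChar.spec]
    apply hιinj
    rw [map_natCast, map_zero, h]
  have hd : ∀ α : K, G.derivative.eval α = aeval α g.derivative := by
    intro α; rw [hGder]; exact eval_map_algebraMap _ _
  have hv : ∀ α : K, G.eval α = aeval α g := fun α => eval_map_algebraMap _ _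
  have hmain := turn_main (E := (G.map (RatFunc.C : K →+* RatFunc K) - C RatFunc.X).SplittingField)
    G (by omega) hn α₀
    (by
      have := (rootMultiplicity_pos hder0).1 (by rw [hα₀']; norm_num)
      exact this)
    (by
      rw [← le_rootMultiplicity_iff hder0, hα₀']; norm_num)
    (by
      intro α β ha hb hab
      rw [hd] at ha hb
      rw [hv, hv]
      exact hvals α β ha hb hab)
    (G.map (RatFunc.C : K →+* RatFunc K) - C RatFunc.X) rfl
  have hpmap : (g.map (RatFunc.C : k →+* RatFunc k) - C RatFunc.X).map (algebraMap (RatFunc k) (RatFunc K))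
      = G.map (RatFunc.C : K →+* RatFunc K) - C RatFunc.X := by
    change Polynomial.map Φ _ = _
    rw [Polynomial.map_sub, Polynomial.map_map, map_C, Polynomial.map_map]
    have e1 : Φ.comp (RatFunc.C : k →+* RatFunc k) = (RatFunc.C : K →+* RatFunc K).comp ι := by
      ext c
      change Φ (RatFunc.C c) = RatFunc.C (ι c)
      rw [← RatFunc.algebraMap_C, hΦ, map_C, RatFunc.algebraMap_C]
    have e2 : Φ RatFunc.X = RatFunc.X := by
      rw [← RatFunc.algebraMap_X, hΦ, map_X, RatFunc.algebraMap_X]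
    rw [e1, e2]
  apply le_antisymm
  · refine (turn_card_le_fact _).trans (le_of_eq ?_)
    rw [natDegree_sub_C, natDegree_map]
  · rw [← hGd, ← hmain]
    have := turn_card_le (F' := RatFunc K) (g.map (RatFunc.C : k →+* RatFunc k) - C RatFunc.X)
    rw [hpmap] at this
    exact this
end
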